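/- Every simple polygon P with n vertices that is weakly visible from one of its edges admits a vertex-to-point conflict-free chromatic guarding using at most 2·(⌊log₂ n⌋ + 1)² colours. -/

import Mathlib

/-- A simple polygon: a cyclic sequence of `n ≥ 3` distinct points in the plane
(`ℝ × ℝ`) whose closed edges `[vtx i, vtx (i+1)]` (indices mod `n`) are pairwise
disjoint, except that consecutive edges share exactly their common endpoint. -/
structure SimplePolygon where
  n : ℕ
  three_le : 3 ≤ n
  vtx : Fin n → ℝ × ℝ
  inj : Function.Injective vtx
  consec_edges : ∀ i : Fin n,
    haveI : NeZero n := ⟨by omega⟩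
    segment ℝ (vtx i) (vtx (i + 1)) ∩ segment ℝ (vtx (i + 1)) (vtx (i + 1 + 1))
      = {vtx (i + 1)}
  nonconsec_edges : ∀ i j : Fin n,
    haveI : NeZero n := ⟨by omega⟩
    i ≠ j → j ≠ i + 1 → i ≠ j + 1 →
      segment ℝ (vtx i) (vtx (i + 1)) ∩ segment ℝ (vtx j) (vtx (j + 1)) = ∅

instance (P : SimplePolygon) : NeZero P.n := ⟨by have := P.three_le; omega⟩

namespace SimplePolygon

/-- The boundary of the polygon: the union of its edges. -/
def boundary (P : SimplePolygon) : Set (ℝ × ℝ) :=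
  ⋃ i : Fin P.n, segment ℝ (P.vtx i) (P.vtx (i + 1))

/-- The polygon as a point set: its boundary together with the union of all
bounded connected components of the complement of the boundary. -/
def region (P : SimplePolygon) : Set (ℝ × ℝ) :=
  P.boundary ∪
    {p | p ∉ P.boundary ∧ Bornology.IsBounded (connectedComponentIn P.boundaryᶜ p)}

/-- `p` sees `q` if the closed segment between them lies in the polygon. -/
def Sees (P : SimplePolygon) (p q : ℝ × ℝ) : Prop :=
  segment ℝ p q ⊆ P.region

/-- The planar cross product of two vectors. -/
def cross2 (a b : ℝ × ℝ) : ℝ := a.1 * b.2 - a.2 * b.1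

/-- Counterclockwise orientation: positive shoelace signed area. -/
def Ccw (P : SimplePolygon) : Prop :=
  0 < ∑ i : Fin P.n, cross2 (P.vtx i) (P.vtx (i + 1))

/-- A vertex is convex if the cross product of the incoming and the outgoing
edge vectors is positive (for a counterclockwise-oriented polygon). -/
def ConvexVtx (P : SimplePolygon) (i : Fin P.n) : Prop :=
  0 < cross2 (P.vtx i - P.vtx (i - 1)) (P.vtx (i + 1) - P.vtx i)

/-- A funnel: a counterclockwise-oriented simple polygon with exactly three
convex vertices, two of which (the endpoints of the base edge) are adjacent;
the third convex vertex is the apex. -/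
def IsFunnel (P : SimplePolygon) : Prop :=
  P.Ccw ∧ ∃ b c : Fin P.n, c ≠ b ∧ c ≠ b + 1 ∧
    {i : Fin P.n | P.ConvexVtx i} = {b, b + 1, c}

/-- `G` is a set of vertices of `P` such that every point of `P` is seen by
some vertex in `G`. -/
def GuardsAll (P : SimplePolygon) (G : Finset (ℝ × ℝ)) : Prop :=
  ↑G ⊆ Set.range P.vtx ∧ ∀ p ∈ P.region, ∃ g ∈ G, P.Sees g p

/-- A vertex-to-point conflict-free chromatic guarding of `P` with `k` colours:
a set `G` of vertices of `P` together with a colouring `χ` (only its values on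
`G` matter) such that every point of `P` sees at least one guard whose colour
is unique among the guards that this point sees. -/
def IsCFGuardV2P (P : SimplePolygon) (G : Finset (ℝ × ℝ)) (k : ℕ)
    (χ : ℝ × ℝ → Fin k) : Prop :=
  ↑G ⊆ Set.range P.vtx ∧
  ∀ p ∈ P.region, ∃ g ∈ G, P.Sees g p ∧
    ∀ h ∈ G, h ≠ g → P.Sees h p → χ h ≠ χ g

/-- A vertex-to-vertex conflict-free chromatic guarding of `P` with `k`
colours: every vertex of `P` sees at least one guard whose colour is unique
among the guards that this vertex sees. -/
def IsCFGuardV2V (P : SimplePolygon) (G : Finset (ℝ × ℝ)) (k : ℕ)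
    (χ : ℝ × ℝ → Fin k) : Prop :=
  ↑G ⊆ Set.range P.vtx ∧
  ∀ i : Fin P.n, ∃ g ∈ G, P.Sees g (P.vtx i) ∧
    ∀ h ∈ G, h ≠ g → P.Sees h (P.vtx i) → χ h ≠ χ g

end SimplePolygon


open Topology Filter

/-- Points of the plane. -/
abbrev Pt := ℝ × ℝ

/-- Planar cross product. -/
def cr (a b : Pt) : ℝ := a.1 * b.2 - a.2 * b.1

lemma mem_seg {a b z : Pt} : z ∈ segment ℝ a b ↔
    ∃ t : ℝ, 0 ≤ t ∧ t ≤ 1 ∧ z.1 = a.1 + t * (b.1 - a.1) ∧ z.2 = a.2 + t * (b.2 - a.2) := by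
  rw [segment_eq_image']
  constructor
  · rintro ⟨t, ⟨h0, h1⟩, rfl⟩
    exact ⟨t, h0, h1, by simp, by simp⟩
  · rintro ⟨t, h0, h1, hx, hy⟩
    exact ⟨t, ⟨h0, h1⟩, by ext <;> simp [hx, hy]⟩

lemma seg_cr {a b z : Pt} (h : z ∈ segment ℝ a b) : cr (b - a) (z - a) = 0 := by
  obtain ⟨t, -, -, hx, hy⟩ := mem_seg.1 h
  simp only [cr, Prod.fst_sub, Prod.snd_sub, hx, hy]; ring

open Classical in
/-- Crossing indicator (mod 2) of the rightward horizontal ray from `z` with the segment `a b`. -/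
noncomputable def chi (a b z : Pt) : ZMod 2 :=
  if (a.2 ≤ z.2 ∧ z.2 < b.2 ∧ 0 < cr (b - a) (z - a)) ∨
     (b.2 ≤ z.2 ∧ z.2 < a.2 ∧ 0 < cr (a - b) (z - b)) then 1 else 0

open Classical in
/-- Auxiliary endpoint indicator. -/
noncomputable def sf (z0 q z : Pt) : ZMod 2 := if q.2 ≤ z.2 ∧ z0.1 < q.1 then 1 else 0

lemma chi_comm (a b z : Pt) : chi a b z = chi b a z := by
  unfold chi; simp only [or_comm]

lemma z2_add_self (x : ZMod 2) : x + x = 0 := CharTwo.add_self_eq_zero x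

lemma cont_cr (a b : Pt) : Continuous fun z : Pt => cr (b - a) (z - a) := by
  unfold cr; fun_prop

lemma ev_pos {f : Pt → ℝ} (hf : Continuous f) {z0 : Pt} (h : 0 < f z0) : ∀ᶠ z in 𝓝 z0, 0 < f z :=
  hf.continuousAt.eventually (lt_mem_nhds h)

lemma ev_neg {f : Pt → ℝ} (hf : Continuous f) {z0 : Pt} (h : f z0 < 0) : ∀ᶠ z in 𝓝 z0, f z < 0 :=
  hf.continuousAt.eventually (gt_mem_nhds h)

lemma ev_lt2 {c : ℝ} {z0 : Pt} (h : c < z0.2) : ∀ᶠ z : Pt in 𝓝 z0, c < z.2 :=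
  continuous_snd.continuousAt.eventually (lt_mem_nhds h)

lemma ev_gt2 {c : ℝ} {z0 : Pt} (h : z0.2 < c) : ∀ᶠ z : Pt in 𝓝 z0, z.2 < c :=
  continuous_snd.continuousAt.eventually (gt_mem_nhds h)

/-- case where `a` is strictly below -/
lemma chi_loc_aux1 {a b z0 : Pt} (h : z0 ∉ segment ℝ a b) (ha : a.2 < z0.2) :
    ∃ C, ∀ᶠ z in 𝓝 z0, chi a b z + sf z0 a z + sf z0 b z = C := by
  rcases lt_trichotomy b.2 z0.2 with hb | hb | hb
  · refine ⟨(if z0.1 < a.1 then 1 else 0) + (if z0.1 < b.1 then 1 else 0), ?_⟩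
    filter_upwards [ev_lt2 ha, ev_lt2 hb] with z h1 h2
    simp [chi, sf, not_lt.2 h1.le, not_lt.2 h2.le, h1.le, h2.le]
  · have hne : z0.1 ≠ b.1 := by
      intro hx
      exact h (by rw [show z0 = b from Prod.ext hx hb.symm]; exact right_mem_segment _ _ _)
    have hc : cr (b - a) (z0 - a) = (b.2 - a.2) * (b.1 - z0.1) := by
      simp only [cr, Prod.fst_sub, Prod.snd_sub, ← hb]; ring
    rcases lt_or_gt_of_ne hne with hx | hx
    · have : 0 < cr (b - a) (z0 - a) := by rw [hc]; apply mul_pos <;> linarith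
      refine ⟨(if z0.1 < a.1 then 1 else 0) + 1, ?_⟩
      filter_upwards [ev_lt2 ha, ev_pos (cont_cr a b) this] with z h1 h2
      by_cases h3 : b.2 ≤ z.2
      · simp [chi, sf, not_lt.2 h1.le, h1.le, h2, hx, h3, not_lt.2 h3]
      · simp [chi, sf, not_lt.2 h1.le, h1.le, h2, hx, h3, not_le.1 h3]; ring
    · have : cr (b - a) (z0 - a) < 0 := by rw [hc]; apply mul_neg_of_pos_of_neg <;> linarith
      refine ⟨(if z0.1 < a.1 then 1 else 0), ?_⟩
      filter_upwards [ev_lt2 ha, ev_neg (cont_cr a b) this] with z h1 h2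
      simp [chi, sf, not_lt.2 h1.le, h1.le, not_lt.2 h2.le, not_lt.2 hx.le]
  · have hne : cr (b - a) (z0 - a) ≠ 0 := by
      intro h0
      apply h
      rw [mem_seg]
      refine ⟨(z0.2 - a.2) / (b.2 - a.2), by apply div_nonneg <;> linarith,
        by rw [div_le_one] <;> linarith, ?_, ?_⟩
      · simp only [cr, Prod.fst_sub, Prod.snd_sub] at h0
        have : b.2 - a.2 ≠ 0 := by linarith
        field_simp; linarith
      · have : b.2 - a.2 ≠ 0 := by linarith
        field_simp; ring
    rcases lt_or_gt_of_ne hne with hx | hx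
    · refine ⟨(if z0.1 < a.1 then 1 else 0), ?_⟩
      filter_upwards [ev_lt2 ha, ev_gt2 hb, ev_neg (cont_cr a b) hx] with z h1 h2 h3
      simp [chi, sf, not_lt.2 h1.le, h1.le, not_lt.2 h3.le, h2, not_le.2 h2]
    · refine ⟨(if z0.1 < a.1 then 1 else 0) + 1, ?_⟩
      filter_upwards [ev_lt2 ha, ev_gt2 hb, ev_pos (cont_cr a b) hx] with z h1 h2 h3
      simp [chi, sf, not_lt.2 h1.le, h1.le, h3, h2, not_le.2 h2]; ring

lemma chi_loc {a b z0 : Pt} (h : z0 ∉ segment ℝ a b) :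
    ∃ C, ∀ᶠ z in 𝓝 z0, chi a b z + sf z0 a z + sf z0 b z = C := by
  have h' : z0 ∉ segment ℝ b a := by rwa [segment_symm]
  rcases lt_or_ge a.2 z0.2 with ha | ha
  · exact chi_loc_aux1 h ha
  rcases lt_or_ge b.2 z0.2 with hb | hb
  · obtain ⟨C, hC⟩ := chi_loc_aux1 h' hb
    refine ⟨C, hC.mono fun z hz => ?_⟩
    rw [← hz, chi_comm]; ring
  -- both at least `z0.2`
  have key : ∀ {a b : Pt}, z0 ∉ segment ℝ a b → a.2 = z0.2 → z0.2 < b.2 →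
      ∃ C, ∀ᶠ z in 𝓝 z0, chi a b z + sf z0 a z + sf z0 b z = C := by
    intro a b h ha hb
    have hne : z0.1 ≠ a.1 := by
      intro hx
      exact h (by rw [show z0 = a from Prod.ext hx ha.symm]; exact left_mem_segment _ _ _)
    have hc : cr (b - a) (z0 - a) = (b.2 - a.2) * (a.1 - z0.1) := by
      simp only [cr, Prod.fst_sub, Prod.snd_sub, ← ha]; ring
    refine ⟨0, ?_⟩
    rcases lt_or_gt_of_ne hne with hx | hx
    · have : 0 < cr (b - a) (z0 - a) := by rw [hc]; apply mul_pos <;> linarith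
      filter_upwards [ev_gt2 hb, ev_pos (cont_cr a b) this] with z h1 h2
      by_cases h3 : a.2 ≤ z.2
      · simp [chi, sf, h1, h2, hx, h3, z2_add_self, not_le.2 h1]
      · simp [chi, sf, h1, hx, h3, not_le.2 h1]
    · have : cr (b - a) (z0 - a) < 0 := by rw [hc]; apply mul_neg_of_pos_of_neg <;> linarith
      filter_upwards [ev_gt2 hb, ev_neg (cont_cr a b) this] with z h1 h2
      simp [chi, sf, h1, not_lt.2 h2.le, not_lt.2 hx.le, not_le.2 h1]
  rcases ha.eq_or_lt with ha | ha <;> rcases hb.eq_or_lt with hb | hb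
  · refine ⟨0, Eventually.of_forall fun z => ?_⟩
    have : (z0.1 < a.1 ↔ z0.1 < b.1) := by
      by_contra hcon
      apply h
      have hne : b.1 - a.1 ≠ 0 := by
        intro h0; apply hcon; rw [show b.1 = a.1 by linarith]
      have hle : 0 ≤ (z0.1 - a.1) / (b.1 - a.1) ∧ (z0.1 - a.1) / (b.1 - a.1) ≤ 1 := by
        by_cases h1 : z0.1 < a.1 <;> by_cases h2 : z0.1 < b.1 <;> simp [h1, h2] at hcon
        · have : b.1 - a.1 < 0 := by linarith
          exact ⟨div_nonneg_of_nonpos (by linarith) (by linarith),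
            by rw [div_le_one_of_neg this]; linarith⟩
        · have : 0 < b.1 - a.1 := by linarith
          exact ⟨div_nonneg (by linarith) (by linarith), by rw [div_le_one this]; linarith⟩
      refine mem_seg.2 ⟨_, hle.1, hle.2, by field_simp; ring, ?_⟩
      rw [← ha, ← hb]; ring
    have hab : a.2 = b.2 := by linarith
    simp only [chi, sf, this, hab]
    have h1 : ¬ ((b.2 ≤ z.2 ∧ z.2 < b.2 ∧ 0 < cr (b - a) (z - a)) ∨
      b.2 ≤ z.2 ∧ z.2 < b.2 ∧ 0 < cr (a - b) (z - b)) := by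
      rintro (⟨h1, h2, -⟩ | ⟨h1, h2, -⟩) <;> linarith
    rw [if_neg h1, zero_add, z2_add_self]
  · exact key h ha.symm hb
  · obtain ⟨C, hC⟩ := key h' hb.symm ha
    refine ⟨C, hC.mono fun z hz => ?_⟩
    rw [← hz, chi_comm]; ring
  · refine ⟨0, ?_⟩
    filter_upwards [ev_gt2 ha, ev_gt2 hb] with z h1 h2
    simp [chi, sf, not_le.2 h1, not_le.2 h2]

/-- A mod-2 cycle of segments. -/
def Cyc (S : Multiset (Pt × Pt)) : Prop :=
  ∀ s : Pt → ZMod 2, (S.map fun e => s e.1 + s e.2).sum = 0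

/-- Winding parity. -/
noncomputable def Wd (S : Multiset (Pt × Pt)) (z : Pt) : ZMod 2 :=
  (S.map fun e => chi e.1 e.2 z).sum

/-- The support of a chain. -/
def Sup (S : Multiset (Pt × Pt)) : Set Pt := {z | ∃ e ∈ S, z ∈ segment ℝ e.1 e.2}

lemma Wd_loc {S : Multiset (Pt × Pt)} (hS : Cyc S) {z0 : Pt} (h : z0 ∉ Sup S) :
    ∀ᶠ z in 𝓝 z0, Wd S z = Wd S z0 := by
  have h1 : ∃ C, ∀ᶠ z in 𝓝 z0,
      (S.map fun e => chi e.1 e.2 z + (sf z0 e.1 z + sf z0 e.2 z)).sum = C := by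
    clear hS
    induction S using Multiset.induction with
    | empty => exact ⟨0, by simp⟩
    | cons e S ih =>
      obtain ⟨C, hC⟩ := ih (fun ⟨e, he, hz⟩ => h ⟨e, Multiset.mem_cons_of_mem he, hz⟩)
      obtain ⟨D, hD⟩ := chi_loc (a := e.1) (b := e.2) (z0 := z0)
        (fun hz => h ⟨e, Multiset.mem_cons_self _ _, hz⟩)
      refine ⟨D + C, ?_⟩
      filter_upwards [hC, hD] with z h1 h2
      rw [Multiset.map_cons, Multiset.sum_cons, h1, ← h2]; ring
  obtain ⟨C, hC⟩ := h1
  have h2 : ∀ᶠ z in 𝓝 z0, Wd S z = C := by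
    filter_upwards [hC] with z hz
    rw [Multiset.sum_map_add] at hz
    rw [← hz, hS (fun q => sf z0 q z), add_zero]; rfl
  have h3 := h2.self_of_nhds
  filter_upwards [h2] with z hz
  rw [hz, h3]

lemma Wd_const {S : Multiset (Pt × Pt)} (hS : Cyc S) {K : Set Pt} (hK : IsPreconnected K)
    (hd : ∀ z ∈ K, z ∉ Sup S) {x y : Pt} (hx : x ∈ K) (hy : y ∈ K) : Wd S x = Wd S y := by
  let _ : TopologicalSpace (ZMod 2) := ⊥
  have _ : DiscreteTopology (ZMod 2) := ⟨rfl⟩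
  refine hK.constant (f := Wd S) (fun z hz => ?_) hx hy
  apply ContinuousAt.continuousWithinAt
  rw [ContinuousAt, nhds_discrete (ZMod 2), tendsto_pure]
  exact Wd_loc hS (hd z hz)

lemma Wd_far {S : Multiset (Pt × Pt)} (hS : Cyc S) {M : ℝ}
    (hM : ∀ e ∈ S, ‖e.1‖ ≤ M ∧ ‖e.2‖ ≤ M) {z : Pt} (hz : M < ‖z‖) : Wd S z = 0 := by
  have hc : ∀ q : Pt, ‖q‖ ≤ M → -M ≤ q.1 ∧ q.1 ≤ M ∧ -M ≤ q.2 ∧ q.2 ≤ M := by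
    intro q hq
    rw [Prod.norm_def, max_le_iff, Real.norm_eq_abs, Real.norm_eq_abs, abs_le, abs_le] at hq
    tauto
  have zero : (∀ e ∈ S, chi e.1 e.2 z = 0) → Wd S z = 0 := by
    intro h
    apply Multiset.sum_eq_zero
    intro x hx
    obtain ⟨e, he, rfl⟩ := Multiset.mem_map.1 hx
    exact h e he
  rw [Prod.norm_def, lt_max_iff, Real.norm_eq_abs, Real.norm_eq_abs, lt_abs, lt_abs] at hz
  have hcr : ∀ a b : Pt, cr (b - a) (z - a) =
      (b.1 - z.1) * (z.2 - a.2) + (a.1 - z.1) * (b.2 - z.2) := by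
    intro a b; simp only [cr, Prod.fst_sub, Prod.snd_sub]; ring
  rcases hz with (hz | hz) | (hz | hz)
  · apply zero
    intro e he
    obtain ⟨h1, h2⟩ := hM e he
    have h1 := hc _ h1
    have h2 := hc _ h2
    unfold chi
    rw [if_neg]
    rintro (⟨h3, h4, h5⟩ | ⟨h3, h4, h5⟩) <;> rw [hcr] at h5 <;>
    nlinarith
  · classical
    have : Wd S z = (S.map fun e => (fun q : Pt => if q.2 ≤ z.2 then (1 : ZMod 2) else 0) e.1 +
        (fun q : Pt => if q.2 ≤ z.2 then (1 : ZMod 2) else 0) e.2).sum := by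
      unfold Wd
      congr 1
      apply Multiset.map_congr rfl
      intro e he
      obtain ⟨h1, h2⟩ := hM e he
      have h1 := hc _ h1
      have h2 := hc _ h2
      unfold chi
      rw [hcr, hcr]
      by_cases h3 : e.1.2 ≤ z.2 <;> by_cases h4 : e.2.2 ≤ z.2
      · simp [h3, h4, not_lt.2 h3, not_lt.2 h4, z2_add_self]
      · rw [if_pos]
        · simp [h3, h4]
        · exact Or.inl ⟨h3, not_le.1 h4, by push Not at h4; nlinarith⟩
      · rw [if_pos]
        · simp [h3, h4]
        · exact Or.inr ⟨h4, not_le.1 h3, by push Not at h3; nlinarith⟩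
      · simp [h3, h4]
    rw [this]; exact hS (fun q : Pt => if q.2 ≤ z.2 then (1 : ZMod 2) else 0)
  · apply zero
    intro e he
    obtain ⟨h1, h2⟩ := hM e he
    have h1 := hc _ h1
    have h2 := hc _ h2
    unfold chi
    rw [if_neg]
    rintro (⟨h3, h4, h5⟩ | ⟨h3, h4, h5⟩) <;> linarith
  · apply zero
    intro e he
    obtain ⟨h1, h2⟩ := hM e he
    have h1 := hc _ h1
    have h2 := hc _ h2
    unfold chi
    rw [if_neg]
    rintro (⟨h3, h4, h5⟩ | ⟨h3, h4, h5⟩) <;> linarith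

/-- Subdividing a segment. -/
lemma chi_sub {a b c z : Pt} (hb : b ∈ segment ℝ a c) : chi a c z = chi a b z + chi b c z := by
  obtain ⟨t, h0, h1, hx, hy⟩ := mem_seg.1 hb
  have e1 : cr (b - a) (z - a) = t * cr (c - a) (z - a) := by
    simp only [cr, Prod.fst_sub, Prod.snd_sub, hx, hy]; ring
  have e2 : cr (c - b) (z - b) = (1 - t) * cr (c - a) (z - a) := by
    simp only [cr, Prod.fst_sub, Prod.snd_sub, hx, hy]; ring
  have e3 : cr (a - b) (z - b) = t * cr (a - c) (z - c) := by
    simp only [cr, Prod.fst_sub, Prod.snd_sub, hx, hy]; ring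
  have e4 : cr (b - c) (z - c) = (1 - t) * cr (a - c) (z - c) := by
    simp only [cr, Prod.fst_sub, Prod.snd_sub, hx, hy]; ring
  rcases h0.eq_or_lt with h0 | h0
  · have : b = a := Prod.ext (by rw [hx, ← h0]; ring) (by rw [hy, ← h0]; ring)
    subst this
    have : chi b b z = 0 := by
      unfold chi; rw [if_neg]; rintro (⟨h3, h4, h5⟩ | ⟨h3, h4, h5⟩) <;> linarith
    rw [this, zero_add]
  rcases h1.eq_or_lt with h1 | h1
  · have : b = c := Prod.ext (by rw [hx, h1]; ring) (by rw [hy, h1]; ring)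
    subst this
    have : chi b b z = 0 := by
      unfold chi; rw [if_neg]; rintro (⟨h3, h4, h5⟩ | ⟨h3, h4, h5⟩) <;> linarith
    rw [this, add_zero]
  have h1' : 0 < 1 - t := by linarith
  unfold chi
  rw [e1, e2, e3, e4]
  simp only [mul_pos_iff_of_pos_left h0, mul_pos_iff_of_pos_left h1']
  rcases lt_trichotomy a.2 c.2 with hac | hac | hac
  · have hab : a.2 < b.2 := by nlinarith
    have hbc : b.2 < c.2 := by nlinarith
    by_cases hP : 0 < cr (c - a) (z - a)
    · by_cases q1 : a.2 ≤ z.2 <;> by_cases q2 : b.2 ≤ z.2 <;> by_cases q3 : c.2 ≤ z.2 <;>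
        first
        | (exfalso; linarith)
        | (simp only [lt_iff_not_ge (b := a.2), lt_iff_not_ge (b := b.2), lt_iff_not_ge (b := c.2)]; simp [hP, q1, q2, q3])
    · rw [if_neg, if_neg, if_neg, add_zero] <;>
      · rintro (⟨h3, h4, h5⟩ | ⟨h3, h4, h5⟩)
        · exact hP h5
        · linarith
  · have hab : a.2 = b.2 := by rw [hy, hac]; ring
    have hbc : b.2 = c.2 := by linarith
    rw [if_neg, if_neg, if_neg, add_zero] <;>
    · rintro (⟨h3, h4, h5⟩ | ⟨h3, h4, h5⟩) <;> linarith
  · have hab : b.2 < a.2 := by nlinarith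
    have hbc : c.2 < b.2 := by nlinarith
    by_cases hP : 0 < cr (a - c) (z - c)
    · by_cases q1 : a.2 ≤ z.2 <;> by_cases q2 : b.2 ≤ z.2 <;> by_cases q3 : c.2 ≤ z.2 <;>
        first
        | (exfalso; linarith)
        | (simp only [lt_iff_not_ge (b := a.2), lt_iff_not_ge (b := b.2), lt_iff_not_ge (b := c.2)]; simp [hP, q1, q2, q3])
    · rw [if_neg, if_neg, if_neg, add_zero] <;>
      · rintro (⟨h3, h4, h5⟩ | ⟨h3, h4, h5⟩)
        · linarith
        · exact hP h5

/-- A triangle as a cycle. -/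
def triS (a b c : Pt) : Multiset (Pt × Pt) := {(a, b), (b, c), (c, a)}

lemma triS_cyc (a b c : Pt) : Cyc (triS a b c) := by
  intro s
  simp only [triS, Multiset.insert_eq_cons, Multiset.map_cons, Multiset.map_singleton,
    Multiset.sum_cons, Multiset.sum_singleton]
  linear_combination z2_add_self (s a) + z2_add_self (s b) + z2_add_self (s c)

/-- Points strictly inside a triangle have winding parity one. -/
lemma triS_inside {a b c z : Pt} {x y w : ℝ} (hx : 0 < x) (hy : 0 < y) (hw : 0 < w)
    (hs : x + y + w = 1) (h1 : z.1 = x * a.1 + y * b.1 + w * c.1)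
    (h2 : z.2 = x * a.2 + y * b.2 + w * c.2) (hD : cr (b - a) (c - a) ≠ 0) :
    Wd (triS a b c) z = 1 := by
  have hx' : x = 1 - y - w := by linarith
  have e1 : cr (b - a) (z - a) = w * cr (b - a) (c - a) := by
    simp only [cr, Prod.fst_sub, Prod.snd_sub, h1, h2, hx']; ring
  have e2 : cr (c - b) (z - b) = x * cr (b - a) (c - a) := by
    simp only [cr, Prod.fst_sub, Prod.snd_sub, h1, h2, hx']; ring
  have e3 : cr (a - c) (z - c) = y * cr (b - a) (c - a) := by
    simp only [cr, Prod.fst_sub, Prod.snd_sub, h1, h2, hx']; ring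
  have e4 : cr (a - b) (z - b) = - (w * cr (b - a) (c - a)) := by
    simp only [cr, Prod.fst_sub, Prod.snd_sub, h1, h2, hx']; ring
  have e5 : cr (b - c) (z - c) = - (x * cr (b - a) (c - a)) := by
    simp only [cr, Prod.fst_sub, Prod.snd_sub, h1, h2, hx']; ring
  have e6 : cr (c - a) (z - a) = - (y * cr (b - a) (c - a)) := by
    simp only [cr, Prod.fst_sub, Prod.snd_sub, h1, h2, hx']; ring
  have hnot : ¬ (a.2 ≤ z.2 ∧ b.2 ≤ z.2 ∧ c.2 ≤ z.2) := by
    rintro ⟨k1, k2, k3⟩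
    have j1 : x * (z.2 - a.2) + y * (z.2 - b.2) + w * (z.2 - c.2) = 0 := by
      linear_combination z.2 * hs - (-1) * h2
    have p1 := mul_nonneg hx.le (sub_nonneg.2 k1)
    have p2 := mul_nonneg hy.le (sub_nonneg.2 k2)
    have p3 := mul_nonneg hw.le (sub_nonneg.2 k3)
    have q1 : z.2 - a.2 = 0 := by
      rcases mul_eq_zero.1 (show x * (z.2 - a.2) = 0 by linarith) with h | h <;> linarith
    have q2 : z.2 - b.2 = 0 := by
      rcases mul_eq_zero.1 (show y * (z.2 - b.2) = 0 by linarith) with h | h <;> linarith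
    have q3 : z.2 - c.2 = 0 := by
      rcases mul_eq_zero.1 (show w * (z.2 - c.2) = 0 by linarith) with h | h <;> linarith
    apply hD
    simp only [cr, Prod.fst_sub, Prod.snd_sub]
    rw [show b.2 = a.2 by linarith, show c.2 = a.2 by linarith]; ring
  have hnot2 : a.2 ≤ z.2 ∨ b.2 ≤ z.2 ∨ c.2 ≤ z.2 := by
    by_contra hcon
    push Not at hcon
    obtain ⟨k1, k2, k3⟩ := hcon
    have p1 := mul_pos hx (sub_pos.2 k1)
    have p2 := mul_pos hy (sub_pos.2 k2)
    have p3 := mul_pos hw (sub_pos.2 k3)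
    have j1 : x * (a.2 - z.2) + y * (b.2 - z.2) + w * (c.2 - z.2) = 0 := by
      linear_combination -z.2 * hs - h2
    linarith
  simp only [Wd, triS, Multiset.insert_eq_cons, Multiset.map_cons, Multiset.map_singleton,
    Multiset.sum_cons, Multiset.sum_singleton]
  unfold chi
  rw [e1, e2, e3, e4, e5, e6]
  clear h1 h2 hx' hs e1 e2 e3 e4 e5 e6
  rcases lt_or_gt_of_ne hD with hD | hD
  · have r1 : ¬ 0 < w * cr (b - a) (c - a) := not_lt.2 (mul_neg_of_pos_of_neg hw hD).le
    have r2 : ¬ 0 < x * cr (b - a) (c - a) := not_lt.2 (mul_neg_of_pos_of_neg hx hD).le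
    have r3 : ¬ 0 < y * cr (b - a) (c - a) := not_lt.2 (mul_neg_of_pos_of_neg hy hD).le
    have s1 : 0 < -(w * cr (b - a) (c - a)) := neg_pos.2 (mul_neg_of_pos_of_neg hw hD)
    have s2 : 0 < -(x * cr (b - a) (c - a)) := neg_pos.2 (mul_neg_of_pos_of_neg hx hD)
    have s3 : 0 < -(y * cr (b - a) (c - a)) := neg_pos.2 (mul_neg_of_pos_of_neg hy hD)
    simp only [r1, r2, r3, s1, s2, s3, and_true, and_false, false_or, lt_iff_not_ge]
    by_cases q1 : a.2 ≤ z.2 <;> by_cases q2 : b.2 ≤ z.2 <;> by_cases q3 : c.2 ≤ z.2 <;>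
      first
      | exact (hnot (And.intro (by assumption) (And.intro (by assumption) (by assumption)))).elim
      | (exfalso; rcases hnot2 with h | h | h <;> contradiction)
      | simp [q1, q2, q3]
  · have s1 : 0 < w * cr (b - a) (c - a) := mul_pos hw hD
    have s2 : 0 < x * cr (b - a) (c - a) := mul_pos hx hD
    have s3 : 0 < y * cr (b - a) (c - a) := mul_pos hy hD
    have r1 : ¬ 0 < -(w * cr (b - a) (c - a)) := not_lt.2 (neg_nonpos.2 s1.le)
    have r2 : ¬ 0 < -(x * cr (b - a) (c - a)) := not_lt.2 (neg_nonpos.2 s2.le)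
    have r3 : ¬ 0 < -(y * cr (b - a) (c - a)) := not_lt.2 (neg_nonpos.2 s3.le)
    simp only [r1, r2, r3, s1, s2, s3, and_true, and_false, or_false, lt_iff_not_ge]
    by_cases q1 : a.2 ≤ z.2 <;> by_cases q2 : b.2 ≤ z.2 <;> by_cases q3 : c.2 ≤ z.2 <;>
      first
      | exact (hnot (And.intro (by assumption) (And.intro (by assumption) (by assumption)))).elim
      | (exfalso; rcases hnot2 with h | h | h <;> contradiction)
      | simp [q1, q2, q3]


open Topology Filter

/-- Points in unbounded components of the complement. -/
def extr (B : Set Pt) : Set Pt := {z | z ∉ B ∧ ¬ Bornology.IsBounded (connectedComponentIn Bᶜ z)}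

/-- The filled region. -/
def reg (B : Set Pt) : Set Pt := (extr B)ᶜ

lemma not_reg {B : Set Pt} {z : Pt} : z ∉ reg B ↔ z ∈ extr B := by simp [reg]

lemma bd_reg {B : Set Pt} : B ⊆ reg B := fun _ hz h => h.1 hz

lemma extr_conn {B K : Set Pt} (hK : IsPreconnected K) (hd : ∀ z ∈ K, z ∉ B) {x y : Pt}
    (hx : x ∈ K) (hy : y ∈ K) (h : x ∈ extr B) : y ∈ extr B := by
  refine ⟨hd y hy, ?_⟩
  have h1 : y ∈ connectedComponentIn Bᶜ x :=
    hK.subset_connectedComponentIn hx (fun z hz => hd z hz) hy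
  rw [← connectedComponentIn_eq h1]; exact h.2

lemma extr_comp {B : Set Pt} {x y : Pt} (h : x ∈ extr B) (hy : y ∈ connectedComponentIn Bᶜ x) :
    y ∈ extr B :=
  extr_conn isPreconnected_connectedComponentIn
    (fun _ hz => connectedComponentIn_subset _ _ hz) (mem_connectedComponentIn h.1) hy h

lemma extr_open {B : Set Pt} (hB : IsClosed B) : IsOpen (extr B) := by
  rw [isOpen_iff_mem_nhds]
  intro x hx
  exact mem_of_superset (hB.isOpen_compl.connectedComponentIn.mem_nhds
    (mem_connectedComponentIn hx.1)) (fun y hy => extr_comp hx hy)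

lemma reg_closed {B : Set Pt} (hB : IsClosed B) : IsClosed (reg B) := (extr_open hB).isClosed_compl

lemma extr_far {B : Set Pt} {M : ℝ} (hM : ∀ z ∈ B, ‖z‖ ≤ M) (h0 : 0 ≤ M) {z : Pt} (hz : M < ‖z‖) :
    z ∈ extr B := by
  have hzB : z ∉ B := fun h => not_le.2 hz (hM z h)
  refine ⟨hzB, fun hbd => ?_⟩
  obtain ⟨C, hC⟩ := hbd.exists_norm_le
  have hK : IsPreconnected ((fun t : ℝ => t • z) '' Set.Ici 1) :=
    isPreconnected_Ici.image _ (by fun_prop)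
  have hz0 : 0 < ‖z‖ := by linarith
  have hsub := hK.subset_connectedComponentIn (F := Bᶜ) (x := z) ⟨1, by simp, by simp⟩ (by
    rintro _ ⟨t, ht, rfl⟩ hB
    have := hM _ hB
    simp only [Set.mem_Ici] at ht
    rw [norm_smul, Real.norm_eq_abs, abs_of_nonneg (by linarith)] at this
    nlinarith)
  have ht : (1:ℝ) ≤ max 1 ((C + 1) / ‖z‖) := le_max_left _ _
  have := hC _ (hsub ⟨max 1 ((C + 1) / ‖z‖), ht, rfl⟩)
  simp only at this
  rw [norm_smul, Real.norm_eq_abs, abs_of_nonneg (by linarith)] at this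
  have h2 : (C + 1) / ‖z‖ * ‖z‖ = C + 1 := by field_simp
  have h3 := mul_le_mul_of_nonneg_right (le_max_right 1 ((C + 1) / ‖z‖)) hz0.le
  linarith

lemma Wd_extr {B : Set Pt} {S : Multiset (Pt × Pt)} (hS : Cyc S) (hsub : Sup S ⊆ reg B) {z : Pt}
    (hz : z ∈ extr B) : Wd S z = 0 := by
  obtain ⟨M, hM⟩ : ∃ M : ℝ, ∀ e ∈ S, ‖e.1‖ ≤ M ∧ ‖e.2‖ ≤ M := by
    clear hS hsub
    induction S using Multiset.induction with
    | empty => exact ⟨0, by simp⟩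
    | cons e S ih =>
      obtain ⟨M, hM⟩ := ih
      refine ⟨max M (max ‖e.1‖ ‖e.2‖), fun f hf => ?_⟩
      rcases Multiset.mem_cons.1 hf with rfl | hf
      · exact ⟨by simp, by simp⟩
      · exact ⟨(hM f hf).1.trans (le_max_left _ _), (hM f hf).2.trans (le_max_left _ _)⟩
  have : ∃ w ∈ connectedComponentIn Bᶜ z, M < ‖w‖ := by
    by_contra hcon
    push Not at hcon
    exact hz.2 (isBounded_iff_forall_norm_le.2 ⟨M, hcon⟩)
  obtain ⟨w, hw, hwM⟩ := this
  rw [← Wd_far hS hM hwM]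
  exact Wd_const hS isPreconnected_connectedComponentIn
    (fun y hy h => (hsub h) (extr_comp hz hy)) (mem_connectedComponentIn hz.1) hw

lemma Sup_triS {a b c z : Pt} : z ∈ Sup (triS a b c) ↔
    z ∈ segment ℝ a b ∨ z ∈ segment ℝ b c ∨ z ∈ segment ℝ c a := by
  simp [Sup, triS]

lemma tri_mem {B : Set Pt} {p m m' c : Pt} (h1 : segment ℝ p m ⊆ reg B)
    (h2 : segment ℝ p m' ⊆ reg B) (h3 : segment ℝ m m' ⊆ reg B) {x y w : ℝ} (hx : 0 ≤ x)
    (hy : 0 ≤ y) (hw : 0 ≤ w) (hs : x + y + w = 1) (hc1 : c.1 = x * p.1 + y * m.1 + w * m'.1)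
    (hc2 : c.2 = x * p.2 + y * m.2 + w * m'.2) : c ∈ reg B := by
  have hx' : x = 1 - y - w := by linarith
  rcases hx.eq_or_lt with hx0 | hx0
  · exact h3 (mem_seg.2 ⟨w, hw, by linarith, by rw [hc1, ← hx0, show y = 1 - w by linarith]; ring,
      by rw [hc2, ← hx0, show y = 1 - w by linarith]; ring⟩)
  rcases hy.eq_or_lt with hy0 | hy0
  · exact h2 (mem_seg.2 ⟨w, hw, by linarith, by rw [hc1, hx', ← hy0]; ring,
      by rw [hc2, hx', ← hy0]; ring⟩)
  rcases hw.eq_or_lt with hw0 | hw0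
  · exact h1 (mem_seg.2 ⟨y, hy, by linarith, by rw [hc1, hx', ← hw0]; ring,
      by rw [hc2, hx', ← hw0]; ring⟩)
  by_cases hD : cr (m - p) (m' - p) = 0
  · by_cases hpm : m = p
    · subst hpm
      exact h2 (mem_seg.2 ⟨w, hw, by linarith, by rw [hc1, hx']; ring, by rw [hc2, hx']; ring⟩)
    obtain ⟨t, ht1, ht2⟩ : ∃ t : ℝ, m'.1 = p.1 + t * (m.1 - p.1) ∧ m'.2 = p.2 + t * (m.2 - p.2) := by
      simp only [cr, Prod.fst_sub, Prod.snd_sub] at hD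
      by_cases hd : m.1 - p.1 = 0
      · have hd2 : m.2 - p.2 ≠ 0 := fun h => hpm (Prod.ext (by linarith) (by linarith))
        refine ⟨(m'.2 - p.2) / (m.2 - p.2), ?_, by field_simp; ring⟩
        rw [hd] at hD
        have : (m.2 - p.2) * (m'.1 - p.1) = 0 := by linarith
        rcases mul_eq_zero.1 this with h | h
        · exact absurd h hd2
        · rw [hd]; linarith
      · exact ⟨(m'.1 - p.1) / (m.1 - p.1), by field_simp; ring, by field_simp; linarith⟩
    have e1 : c.1 = p.1 + (y + w * t) * (m.1 - p.1) := by rw [hc1, ht1, hx']; ring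
    have e2 : c.2 = p.2 + (y + w * t) * (m.2 - p.2) := by rw [hc2, ht2, hx']; ring
    by_cases hs1 : 0 ≤ y + w * t ∧ y + w * t ≤ 1
    · exact h1 (mem_seg.2 ⟨_, hs1.1, hs1.2, e1, e2⟩)
    have ht0 : t ≠ 0 := by
      rintro rfl
      apply hs1; constructor <;> linarith
    have : 0 ≤ (y + w * t) / t ∧ (y + w * t) / t ≤ 1 := by
      rcases lt_or_gt_of_ne ht0 with h | h
      · have : y + w * t < 0 := by
          by_contra hcon
          exact hs1 ⟨by linarith, by nlinarith⟩
        exact ⟨div_nonneg_of_nonpos (by linarith) (by linarith),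
          by rw [div_le_one_of_neg h]; nlinarith⟩
      · have : 1 < y + w * t := by
          by_contra hcon
          exact hs1 ⟨by positivity, by linarith⟩
        have ht1 : 1 < t := by nlinarith
        exact ⟨div_nonneg (by linarith) (by linarith), by rw [div_le_one h]; nlinarith⟩
    refine h2 (mem_seg.2 ⟨_, this.1, this.2, ?_, ?_⟩)
    · rw [e1, ht1]; field_simp; ring
    · rw [e2, ht2]; field_simp; ring
  · by_contra hc
    have k1 := triS_inside hx0 hy0 hw0 hs hc1 hc2 hD
    have k2 : Wd (triS p m m') c = 0 := by
      apply Wd_extr (B := B) (triS_cyc _ _ _) _ (not_reg.1 hc)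
      intro z hz
      rcases Sup_triS.1 hz with h | h | h
      · exact h1 h
      · exact h3 h
      · rw [segment_symm] at h; exact h2 h
    rw [k1] at k2; exact absurd k2 (by decide)

lemma tri_see {B : Set Pt} {p m m' c : Pt} (h1 : segment ℝ p m ⊆ reg B)
    (h2 : segment ℝ p m' ⊆ reg B) (h3 : segment ℝ m m' ⊆ reg B) (hc : c ∈ segment ℝ m m') :
    segment ℝ p c ⊆ reg B := by
  intro z hz
  obtain ⟨t, t0, t1, ha, hb⟩ := mem_seg.1 hc
  obtain ⟨s, s0, s1, ha', hb'⟩ := mem_seg.1 hz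
  refine tri_mem h1 h2 h3 (x := 1 - s) (y := s * (1 - t)) (w := s * t) (by linarith)
    (mul_nonneg s0 (by linarith)) (mul_nonneg s0 t0) (by ring) ?_ ?_
  · rw [ha', ha]; ring
  · rw [hb', hb]; ring

lemma mem_seg' {a b z : Pt} : z ∈ segment ℝ a b ↔
    ∃ t : ℝ, 0 ≤ t ∧ t ≤ 1 ∧ z = a + t • (b - a) := by
  rw [mem_seg]
  constructor
  · rintro ⟨t, h0, h1, h2, h3⟩; exact ⟨t, h0, h1, by ext <;> simp [h2, h3]⟩
  · rintro ⟨t, h0, h1, rfl⟩; exact ⟨t, h0, h1, by simp, by simp⟩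

lemma mem_oseg {a b z : Pt} : z ∈ openSegment ℝ a b ↔
    ∃ t : ℝ, 0 < t ∧ t < 1 ∧ z = a + t • (b - a) := by
  rw [openSegment_eq_image']
  constructor
  · rintro ⟨t, ⟨h0, h1⟩, rfl⟩; exact ⟨t, h0, h1, rfl⟩
  · rintro ⟨t, h0, h1, rfl⟩; exact ⟨t, ⟨h0, h1⟩, rfl⟩

/-- First exit from the region along a segment. -/
lemma exit_pt {B : Set Pt} (hB : IsClosed B) {x y : Pt} (hx : x ∈ reg B) (hy : y ∉ reg B) :
    ∃ s : ℝ, 0 ≤ s ∧ s < 1 ∧ (∀ u, 0 ≤ u → u ≤ s → x + u • (y - x) ∈ reg B) ∧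
      x + s • (y - x) ∈ B ∧ ∀ ε > 0, ∃ u, s < u ∧ u < s + ε ∧ u ≤ 1 ∧ x + u • (y - x) ∈ extr B := by
  set f : ℝ → Pt := fun u => x + u • (y - x) with hf
  have hfc : Continuous f := by fun_prop
  set T : Set ℝ := {u | 0 ≤ u ∧ u ≤ 1 ∧ f u ∈ extr B} with hT
  have h1T : (1:ℝ) ∈ T := ⟨by norm_num, le_refl _, by simpa [hf] using not_reg.1 hy⟩
  have hbd : BddBelow T := ⟨0, fun u hu => hu.1⟩
  have hne : T.Nonempty := ⟨1, h1T⟩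
  have hop : IsOpen (f ⁻¹' extr B) := (extr_open hB).preimage hfc
  set s := sInf T with hs
  have hs0 : 0 ≤ s := le_csInf hne fun u hu => hu.1
  have hs1 : s ≤ 1 := csInf_le hbd h1T
  have hsR : f s ∉ extr B := by
    intro hmem
    have hs0' : s ≠ 0 := by
      intro h
      rw [h] at hmem; exact hx (by simpa [hf] using hmem)
    obtain ⟨ε, he, hball⟩ := Metric.isOpen_iff.1 hop s hmem
    have hpos : 0 < s := lt_of_le_of_ne hs0 (Ne.symm hs0')
    have : max (s - ε / 2) 0 ∈ T := by
      refine ⟨le_max_right _ _, max_le (by linarith) (by norm_num), hball ?_⟩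
      rw [Metric.mem_ball, Real.dist_eq, abs_lt]
      constructor
      · linarith [le_max_left (s - ε / 2) 0]
      · have : max (s - ε / 2) 0 < s := max_lt (by linarith) hpos
        linarith
    have h2 := csInf_le hbd this
    have h3 : max (s - ε / 2) 0 < s := max_lt (by linarith) hpos
    linarith
  have hs1' : s < 1 := lt_of_le_of_ne hs1 (fun h => hsR (by rw [h]; exact h1T.2.2))
  have hnear : ∀ ε > 0, ∃ u, s < u ∧ u < s + ε ∧ u ≤ 1 ∧ f u ∈ extr B := by
    intro ε he
    obtain ⟨u, hu, hlt⟩ := exists_lt_of_csInf_lt hne (show sInf T < s + ε by linarith)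
    refine ⟨u, lt_of_le_of_ne (csInf_le hbd hu) ?_, hlt, hu.2.1, hu.2.2⟩
    rintro h
    exact hsR (by rw [h]; exact hu.2.2)
  refine ⟨s, hs0, hs1', ?_, ?_, hnear⟩
  · intro u hu0 hus
    rcases hus.eq_or_lt with rfl | hlt
    · exact hsR
    · intro hmem
      have := csInf_le hbd (show u ∈ T from ⟨hu0, by linarith, hmem⟩)
      linarith
  · by_contra hmB
    obtain ⟨δ, hd, hball⟩ := Metric.isOpen_iff.1 hB.isOpen_compl _ hmB
    obtain ⟨ε, he, hε⟩ := Metric.continuousAt_iff.1 (hfc.continuousAt (x := s)) δ hd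
    obtain ⟨u, hu1, hu2, -, hu3⟩ := hnear ε he
    refine hsR (extr_conn (convex_ball (f s) δ).isPreconnected (fun z hz => hball hz)
      (hε ?_) (Metric.mem_ball_self hd) hu3)
    rw [Real.dist_eq, abs_lt]; constructor <;> linarith


open Topology Filter

/-- Edge `k` of a closed polygonal line. -/
def sg (v : ℤ → Pt) (k : ℤ) : Set Pt := segment ℝ (v k) (v (k + 1))

/-- The boundary. -/
def bd (v : ℤ → Pt) : Set Pt := {z | ∃ k : ℤ, z ∈ sg v k}

/-- Simple closed polygon indexed by the integers. -/
structure PolyZ (n : ℕ) (v : ℤ → Pt) : Prop where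
  n3 : 3 ≤ n
  per : ∀ k, v (k + n) = v k
  inj : ∀ i j, v i = v j → (n : ℤ) ∣ i - j
  cons : ∀ k z, z ∈ sg v k → z ∈ sg v (k + 1) → z = v (k + 1)
  disj : ∀ i j z, ¬ (n : ℤ) ∣ i - j → ¬ (n : ℤ) ∣ i + 1 - j → ¬ (n : ℤ) ∣ i - (j + 1) →
    z ∈ sg v i → z ∉ sg v j

namespace PolyZ
variable {n : ℕ} {v : ℤ → Pt} (P : PolyZ n v)
include P

lemma per_mul (k t : ℤ) : v (k + t * n) = v k := by
  induction t using Int.induction_on with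
  | zero => simp
  | succ i ih => rw [show k + ((i : ℤ) + 1) * n = (k + i * n) + n by ring, P.per, ih]
  | pred i ih => rw [← P.per, ← ih]; congr 1; ring

lemma per_dvd {i j : ℤ} (h : (n : ℤ) ∣ i - j) : v i = v j := by
  obtain ⟨t, ht⟩ := h
  rw [← P.per_mul j t]; congr 1; linarith

lemma sg_dvd {i j : ℤ} (h : (n : ℤ) ∣ i - j) : sg v i = sg v j := by
  unfold sg
  rw [P.per_dvd h, P.per_dvd (i := i + 1) (j := j + 1) (by simpa using h)]

lemma npos : (0 : ℤ) < n := by have := P.n3; omega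

/-- Two edges meet only in the obvious way. -/
lemma meet {i j : ℤ} {z : Pt} (hi : z ∈ sg v i) (hj : z ∈ sg v j) :
    (n : ℤ) ∣ i - j ∨ ((n : ℤ) ∣ i + 1 - j ∧ z = v j) ∨ ((n : ℤ) ∣ i - (j + 1) ∧ z = v i) := by
  by_cases h1 : (n : ℤ) ∣ i - j
  · exact Or.inl h1
  by_cases h2 : (n : ℤ) ∣ i + 1 - j
  · refine Or.inr (Or.inl ⟨h2, ?_⟩)
    rw [P.cons i z hi (by rw [P.sg_dvd h2]; exact hj), P.per_dvd h2]
  by_cases h3 : (n : ℤ) ∣ i - (j + 1)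
  · refine Or.inr (Or.inr ⟨h3, ?_⟩)
    rw [P.cons j z hj (by rw [← P.sg_dvd h3]; exact hi), P.per_dvd h3]
  · exact absurd hj (P.disj i j z h1 h2 h3 hi)

lemma ne_succ (k : ℤ) : v k ≠ v (k + 1) := by
  intro h
  have := P.inj _ _ h
  rw [show k - (k + 1) = -1 by ring, dvd_neg] at this
  have := Int.le_of_dvd one_pos this
  have := P.n3
  omega

lemma oseg_uniq {i j : ℤ} {z : Pt} (hi : z ∈ openSegment ℝ (v i) (v (i + 1))) (hj : z ∈ sg v j) :
    (n : ℤ) ∣ i - j := by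
  have hzi : z ≠ v i := by
    rintro rfl
    exact P.ne_succ i (left_mem_openSegment_iff.1 hi)
  have hzi' : z ≠ v (i + 1) := by
    rintro rfl
    exact P.ne_succ i (right_mem_openSegment_iff.1 hi)
  rcases P.meet (openSegment_subset_segment _ _ _ hi) hj with h | ⟨h, e⟩ | ⟨h, e⟩
  · exact h
  · rw [← P.per_dvd h] at e; exact absurd e hzi'
  · exact absurd e hzi

lemma vtx_uniq {i j : ℤ} (hj : v i ∈ sg v j) : (n : ℤ) ∣ i - j ∨ (n : ℤ) ∣ i - (j + 1) := by
  rcases P.meet (i := i) (left_mem_segment _ _ _) hj with h | ⟨h, e⟩ | ⟨h, e⟩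
  · exact Or.inl h
  · exact Or.inl (P.inj _ _ e)
  · exact Or.inr h

lemma bd_fin {z : Pt} : z ∈ bd v ↔ ∃ k : ℕ, k < n ∧ z ∈ sg v k := by
  constructor
  · rintro ⟨k, hk⟩
    have h0 := Int.emod_nonneg k P.npos.ne'
    have h1 := Int.emod_lt_of_pos k P.npos
    refine ⟨(k % n).toNat, by omega, ?_⟩
    rw [Int.toNat_of_nonneg h0, P.sg_dvd (j := k)]
    · exact hk
    · exact (Int.dvd_iff_emod_eq_zero).2 (by simp [Int.sub_emod])
  · rintro ⟨k, -, hk⟩; exact ⟨k, hk⟩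

omit P in
lemma sg_compact (k : ℤ) : IsCompact (sg v k) := by
  unfold sg
  rw [segment_eq_image']
  exact isCompact_Icc.image (by fun_prop)

lemma bd_eq : bd v = ⋃ k ∈ Finset.range n, sg v (k : ℤ) := by
  ext z; simp [P.bd_fin]

lemma bd_compact : IsCompact (bd v) := by
  rw [P.bd_eq]
  exact (Finset.range n).isCompact_biUnion fun k _ => sg_compact _

lemma bd_closed : IsClosed (bd v) := P.bd_compact.isClosed

/-- Locally, only the edges through the point matter. -/
lemma loc_nhds (m : Pt) : ∀ᶠ z in 𝓝 m, ∀ j, z ∈ sg v j → m ∈ sg v j := by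
  have h : ∀ k ∈ Finset.range n, ∀ᶠ z in 𝓝 m, z ∈ sg v (k : ℤ) → m ∈ sg v (k : ℤ) := by
    intro k _
    by_cases hm : m ∈ sg v (k : ℤ)
    · exact Eventually.of_forall fun _ _ => hm
    · filter_upwards [(sg_compact (v := v) (k : ℤ)).isClosed.isOpen_compl.mem_nhds hm] with z hz hz'
      exact absurd hz' hz
  rw [← Filter.eventually_all_finset] at h
  filter_upwards [h] with z hz j hj
  have h0 := Int.emod_nonneg j P.npos.ne'
  have h1 := Int.emod_lt_of_pos j P.npos
  have h2 : (n : ℤ) ∣ ((j % n).toNat : ℤ) - j := by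
    rw [Int.toNat_of_nonneg h0]
    exact (Int.dvd_iff_emod_eq_zero).2 (by simp [Int.sub_emod])
  have := hz (j % n).toNat (by simp; omega)
  rw [P.sg_dvd h2] at this
  exact this hj

end PolyZ

lemma hp_convex (c : ℝ) (d a : Pt) : Convex ℝ {z : Pt | 0 < c * cr d (z - a)} := by
  intro x hx y hy s t hs ht hst
  simp only [Set.mem_ofPred_eq] at *
  have : c * cr d (s • x + t • y - a) = s * (c * cr d (x - a)) + t * (c * cr d (y - a)) := by
    have : s = 1 - t := by linarith
    subst this
    simp only [cr, Prod.fst_sub, Prod.snd_sub, Prod.fst_add, Prod.snd_add, Prod.smul_fst,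
      Prod.smul_snd, smul_eq_mul]; ring
  rw [this]
  rcases hs.eq_or_lt with h | h
  · subst h
    have : t = 1 := by linarith
    subst this; linarith
  · have := mul_pos h hx
    have := mul_nonneg ht hy.le
    linarith

/-- Perpendicular vector. -/
def perp (d : Pt) : Pt := (-d.2, d.1)

lemma cr_perp_pos {d : Pt} (h : d ≠ 0) : 0 < cr d (perp d) := by
  have : cr d (perp d) = d.1 ^ 2 + d.2 ^ 2 := by simp only [cr, perp]; ring
  rw [this]
  by_contra hcon
  apply h
  have h1 : d.1 ^ 2 = 0 := by nlinarith [sq_nonneg d.1, sq_nonneg d.2]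
  have h2 : d.2 ^ 2 = 0 := by nlinarith [sq_nonneg d.1, sq_nonneg d.2]
  exact Prod.ext (by simpa using h1) (by simpa using h2)

lemma tend_zero (m q : Pt) : Tendsto (fun t : ℝ => m + t • q) (𝓝[>] 0) (𝓝 m) := by
  have : Tendsto (fun t : ℝ => m + t • q) (𝓝 0) (𝓝 (m + (0:ℝ) • q)) :=
    Continuous.tendsto (by fun_prop) 0
  rw [zero_smul, add_zero] at this
  exact this.mono_left nhdsWithin_le_nhds

lemma ev_Ioi : ∀ᶠ t : ℝ in 𝓝[>] 0, 0 < t := self_mem_nhdsWithin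

lemma ev_Ioi_lt {c : ℝ} (hc : 0 < c) : ∀ᶠ t : ℝ in 𝓝[>] 0, t < c :=
  nhdsWithin_le_nhds (gt_mem_nhds hc)

lemma cr_add_smul (d x q : Pt) (t : ℝ) : cr d (x + t • q) = cr d x + t * cr d q := by
  simp only [cr, Prod.fst_add, Prod.snd_add, Prod.smul_fst, Prod.smul_snd, smul_eq_mul]; ring

/-- An open set contains points off two lines. -/
lemma perturb {U : Set Pt} (hU : IsOpen U) {z : Pt} (hz : z ∈ U) {d1 d2 : Pt} (h1 : d1 ≠ 0)
    (h2 : d2 ≠ 0) (a b : Pt) : ∃ z' ∈ U, cr d1 (z' - a) ≠ 0 ∧ cr d2 (z' - b) ≠ 0 := by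
  have off : ∀ {W : Set Pt}, IsOpen W → ∀ {z : Pt}, z ∈ W → ∀ {d : Pt}, d ≠ 0 → ∀ a : Pt,
      ∃ z' ∈ W, cr d (z' - a) ≠ 0 := by
    intro W hW z hz d hd a
    by_cases h : cr d (z - a) = 0
    · have e1 := (tend_zero z (perp d)).eventually (hW.mem_nhds hz)
      obtain ⟨t, ht, ht0⟩ := (e1.and ev_Ioi).exists
      refine ⟨_, ht, ?_⟩
      rw [show z + t • perp d - a = (z - a) + t • perp d by abel, cr_add_smul, h, zero_add]
      exact (mul_pos ht0 (cr_perp_pos hd)).ne'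
    · exact ⟨z, hz, h⟩
  obtain ⟨z1, hz1, hc1⟩ := off hU hz h1 a
  have hop : IsOpen (U ∩ {z | cr d1 (z - a) ≠ 0}) := by
    apply hU.inter
    have : Continuous fun z : Pt => cr d1 (z - a) := by unfold cr; fun_prop
    exact isOpen_ne_fun this continuous_const
  obtain ⟨z2, hz2, hc2⟩ := off hop ⟨hz1, hc1⟩ h2 b
  exact ⟨z2, hz2.1, hz2.2, hc2⟩

namespace PolyZ
variable {n : ℕ} {v : ℤ → Pt} (P : PolyZ n v)
include P

/-- If one interior point of an edge is approached from outside, all are. -/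
lemma edge_ext {k : ℤ} {m m' : Pt} (hm : m ∈ openSegment ℝ (v k) (v (k + 1)))
    (hm' : m' ∈ openSegment ℝ (v k) (v (k + 1))) (h : m ∈ closure (extr (bd v))) :
    m' ∈ closure (extr (bd v)) := by
  have hd : v (k + 1) - v k ≠ 0 := sub_ne_zero.2 (P.ne_succ k).symm
  have hsub : segment ℝ m m' ⊆ openSegment ℝ (v k) (v (k + 1)) :=
    (convex_openSegment _ _).segment_subset hm hm'
  have hcomp : IsCompact (segment ℝ m m') := by
    rw [segment_eq_image']
    exact isCompact_Icc.image (by fun_prop)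
  -- a strip meeting the boundary only in edge `k`
  obtain ⟨δ, hδ, hstrip⟩ : ∃ δ > 0, ∀ z ∈ Metric.thickening δ (segment ℝ m m'), ∀ j,
      z ∈ sg v j → z ∈ sg v k := by
    set C : Set Pt := ⋃ j ∈ (Finset.range n).filter (fun j : ℕ => ¬ (n : ℤ) ∣ k - j), sg v (j : ℤ)
      with hC
    have hCc : IsCompact C := Finset.isCompact_biUnion _ fun j _ => sg_compact _
    have hdis : Disjoint (segment ℝ m m') C := by
      rw [Set.disjoint_left]
      intro z hz hzC
      simp only [hC, Set.mem_iUnion, Finset.mem_filter] at hzC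
      obtain ⟨j, ⟨-, hj⟩, hzj⟩ := hzC
      exact hj (P.oseg_uniq (hsub hz) hzj)
    obtain ⟨δ, hδ, hdd⟩ := hdis.exists_thickenings hcomp hCc.isClosed
    refine ⟨δ, hδ, fun z hz j hj => ?_⟩
    obtain ⟨i, hi, hzi⟩ := P.bd_fin.1 ⟨j, hj⟩
    by_cases hki : (n : ℤ) ∣ k - i
    · rw [P.sg_dvd hki]; exact hzi
    · exfalso
      refine Set.disjoint_left.1 hdd hz (Metric.self_subset_thickening hδ C ?_)
      simp only [hC, Set.mem_iUnion, Finset.mem_filter]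
      exact ⟨i, ⟨by simpa using hi, hki⟩, hzi⟩
  have hTo : IsOpen (Metric.thickening δ (segment ℝ m m')) := Metric.isOpen_thickening
  have hmT : m ∈ Metric.thickening δ (segment ℝ m m') :=
    Metric.self_subset_thickening hδ _ (left_mem_segment _ _ _)
  have hmT' : m' ∈ Metric.thickening δ (segment ℝ m m') :=
    Metric.self_subset_thickening hδ _ (right_mem_segment _ _ _)
  obtain ⟨z0, hz0, hz0'⟩ := mem_closure_iff_nhds.1 h _ (hTo.mem_nhds hmT)
  obtain ⟨z, ⟨hzT, hzE⟩, hne, -⟩ := perturb (hTo.inter (extr_open P.bd_closed)) ⟨hz0, hz0'⟩ hd hd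
    (v k) (v k)
  set d := v (k + 1) - v k with hdd
  set c := cr d (z - v k) with hc
  have hKc : Convex ℝ (Metric.thickening δ (segment ℝ m m') ∩ {z : Pt | 0 < c * cr d (z - v k)}) :=
    ((convex_segment m m').thickening δ).inter (hp_convex _ _ _)
  have hcr' : cr d (m' - v k) = 0 := seg_cr (openSegment_subset_segment _ _ _ hm')
  apply mem_closure_of_tendsto (tend_zero m' (c • perp d))
  filter_upwards [ev_Ioi, (tend_zero m' (c • perp d)).eventually (hTo.mem_nhds hmT')] with t ht htT
  have hzK : z ∈ Metric.thickening δ (segment ℝ m m') ∩ {z : Pt | 0 < c * cr d (z - v k)} :=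
    ⟨hzT, mul_self_pos.2 hne⟩
  refine extr_conn hKc.isPreconnected ?_ hzK ⟨htT, ?_⟩ hzE
  · rintro y ⟨hy1, hy2⟩ ⟨j, hj⟩
    have := seg_cr (hstrip y hy1 j hj)
    simp only [Set.mem_ofPred_eq, hdd, this, mul_zero, lt_self_iff_false] at hy2
  · show 0 < c * cr d (m' + t • c • perp d - v k)
    rw [show m' + t • c • perp d - v k = (m' - v k) + (t * c) • perp d by rw [mul_smul]; abel,
      cr_add_smul, hcr', zero_add]
    have := cr_perp_pos hd
    have h2 := mul_self_pos.2 hne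
    calc 0 < t * (c * c) * cr d (perp d) := by positivity
      _ = _ := by ring

/-- Around a vertex, outside points are adjacent to both edges. -/
lemma vtx_ext (k : ℤ) : ∃ ε > 0, ∀ z ∈ Metric.ball (v (k + 1)) ε, z ∈ extr (bd v) →
    (∃ m ∈ openSegment ℝ (v k) (v (k + 1)), m ∈ closure (extr (bd v))) ∧
    (∃ m ∈ openSegment ℝ (v (k + 1)) (v (k + 1 + 1)), m ∈ closure (extr (bd v))) := by
  obtain ⟨ε, hε, hball⟩ := Metric.eventually_nhds_iff_ball.1 (P.loc_nhds (v (k + 1)))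
  refine ⟨ε, hε, ?_⟩
  set w := v (k + 1) with hw
  set d1 := v k - w with hd1
  set d2 := v (k + 1 + 1) - w with hd2
  have h1 : d1 ≠ 0 := sub_ne_zero.2 (P.ne_succ k)
  have h2 : d2 ≠ 0 := sub_ne_zero.2 (P.ne_succ (k + 1)).symm
  set D := cr d1 d2 with hD
  -- description of the boundary near the vertex
  have hB : ∀ z ∈ Metric.ball w ε, z ∈ bd v → ∃ t : ℝ, 0 ≤ t ∧ (z - w = t • d1 ∨ z - w = t • d2) := by
    rintro z hz ⟨j, hj⟩
    rcases P.vtx_uniq (hball z hz j hj) with h | h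
    · rw [← P.sg_dvd h] at hj
      obtain ⟨t, t0, -, rfl⟩ := mem_seg'.1 hj
      exact ⟨t, t0, Or.inr (by simp [hd2, hw])⟩
    · have h' : (n : ℤ) ∣ k - j := by rwa [show k - j = k + 1 - (j + 1) by ring]
      rw [← P.sg_dvd h', sg, segment_symm] at hj
      obtain ⟨t, t0, -, rfl⟩ := mem_seg'.1 hj
      exact ⟨t, t0, Or.inl (by simp [hd1, hw])⟩
  have hcs : ∀ (a b : Pt) (t : ℝ), cr a (t • b) = t * cr a b := by
    intro a b t; simp only [cr, Prod.smul_fst, Prod.smul_snd, smul_eq_mul]; ring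
  have hself : ∀ a : Pt, cr a a = 0 := by intro a; simp only [cr]; ring
  have hanti : cr d2 d1 = - D := by simp only [hD, cr]; ring
  -- points on the radii in the ball
  have hrad : ∀ d : Pt, ∃ t : ℝ, 0 < t ∧ t < 1 ∧ w + t • d ∈ Metric.ball w ε := by
    intro d
    obtain ⟨t, ⟨a, b⟩, c⟩ := ((ev_Ioi.and (ev_Ioi_lt one_pos)).and
      ((tend_zero w d).eventually (Metric.ball_mem_nhds w hε))).exists
    exact ⟨t, a, b, c⟩
  obtain ⟨t1, t10, t11, hm1⟩ := hrad d1
  obtain ⟨t2, t20, t21, hm2⟩ := hrad d2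
  set m1 := w + t1 • d1 with hm1d
  set m2 := w + t2 • d2 with hm2d
  have hm1o : m1 ∈ openSegment ℝ (v k) (v (k + 1)) := by
    rw [openSegment_symm]; exact mem_oseg.2 ⟨t1, t10, t11, rfl⟩
  have hm2o : m2 ∈ openSegment ℝ (v (k + 1)) (v (k + 1 + 1)) := mem_oseg.2 ⟨t2, t20, t21, rfl⟩
  have em1 : m1 - w = t1 • d1 := by simp [hm1d]
  have em2 : m2 - w = t2 • d2 := by simp [hm2d]
  have hbo := Metric.isOpen_ball (x := w) (ε := ε)
  have hcont : ∀ d : Pt, Continuous fun z : Pt => cr d (z - w) := by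
    intro d; unfold cr; fun_prop
  -- generic adjacency
  have adj : ∀ (m d q : Pt) (c : ℝ), m ∈ Metric.ball w ε → cr d (m - w) = 0 → d ≠ 0 → c ≠ 0 →
      (∀ᶠ t in 𝓝[>] (0:ℝ), (0 < c * cr d (m + t • c • perp d - w)) → m + t • c • perp d ∈ extr (bd v))
      → m ∈ closure (extr (bd v)) := by
    intro m d q c hm hz hd hc hev
    apply mem_closure_of_tendsto (tend_zero m (c • perp d))
    filter_upwards [hev, ev_Ioi] with t h ht
    apply h
    rw [show m + t • c • perp d - w = (m - w) + (t * c) • perp d by rw [mul_smul]; abel,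
      cr_add_smul, hz, zero_add]
    have := cr_perp_pos hd
    have h2 := mul_self_pos.2 hc
    calc 0 < t * (c * c) * cr d (perp d) := by positivity
      _ = _ := by ring
  intro z0 hz0 hz0E
  obtain ⟨z, ⟨hzT, hzE⟩, hne1, hne2⟩ := perturb (hbo.inter (extr_open P.bd_closed)) ⟨hz0, hz0E⟩
    h1 h2 w w
  have evb : ∀ m q : Pt, m ∈ Metric.ball w ε → ∀ᶠ t in 𝓝[>] (0:ℝ), m + t • q ∈ Metric.ball w ε :=
    fun m q hm => (tend_zero m q).eventually (hbo.mem_nhds hm)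
  have z1 : cr d1 (m1 - w) = 0 := by rw [em1, hcs, hself, mul_zero]
  have z2 : cr d2 (m2 - w) = 0 := by rw [em2, hcs, hself, mul_zero]
  by_cases hD0 : D = 0
  · set c := cr d1 (z - w) with hc
    have hK := ((convex_ball w ε).inter (hp_convex c d1 w)).isPreconnected
    have hoff : ∀ y ∈ Metric.ball w ε ∩ {z : Pt | 0 < c * cr d1 (z - w)}, y ∉ bd v := by
      rintro y ⟨hy1, hy2⟩ hyB
      obtain ⟨t, -, h | h⟩ := hB y hy1 hyB <;> rw [Set.mem_ofPred_eq, h, hcs] at hy2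
      · rw [hself] at hy2; simp at hy2
      · rw [← hD, hD0] at hy2; simp at hy2
    have hzK : z ∈ Metric.ball w ε ∩ {z : Pt | 0 < c * cr d1 (z - w)} := ⟨hzT, mul_self_pos.2 hne1⟩
    refine ⟨⟨m1, hm1o, ?_⟩, ⟨m2, hm2o, ?_⟩⟩
    · apply adj m1 d1 0 c hm1 z1 h1 hne1
      filter_upwards [evb m1 (c • perp d1) hm1] with t ht hpos
      exact extr_conn hK hoff hzK ⟨ht, hpos⟩ hzE
    · apply adj m2 d1 0 c hm2 (by rw [em2, hcs, ← hD, hD0, mul_zero]) h1 hne1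
      filter_upwards [evb m2 (c • perp d1) hm2] with t ht hpos
      exact extr_conn hK hoff hzK ⟨ht, hpos⟩ hzE
  have hDD : 0 < D * D := mul_self_pos.2 hD0
  have hK1 := ((convex_ball w ε).inter (hp_convex (-D) d1 w)).isPreconnected
  have hK2 := ((convex_ball w ε).inter (hp_convex D d2 w)).isPreconnected
  have hK3 := ((convex_ball w ε).inter ((hp_convex D d1 w).inter (hp_convex (-D) d2 w))).isPreconnected
  have hoff1 : ∀ y ∈ Metric.ball w ε ∩ {z : Pt | 0 < -D * cr d1 (z - w)}, y ∉ bd v := by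
    rintro y ⟨hy1, hy2⟩ hyB
    obtain ⟨t, t0, h | h⟩ := hB y hy1 hyB <;> rw [Set.mem_ofPred_eq, h, hcs] at hy2
    · rw [hself] at hy2; simp at hy2
    · rw [← hD] at hy2; nlinarith
  have hoff2 : ∀ y ∈ Metric.ball w ε ∩ {z : Pt | 0 < D * cr d2 (z - w)}, y ∉ bd v := by
    rintro y ⟨hy1, hy2⟩ hyB
    obtain ⟨t, t0, h | h⟩ := hB y hy1 hyB <;> rw [Set.mem_ofPred_eq, h, hcs] at hy2
    · rw [hanti] at hy2; nlinarith
    · rw [hself] at hy2; simp at hy2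
  have hoff3 : ∀ y ∈ Metric.ball w ε ∩ ({z : Pt | 0 < D * cr d1 (z - w)} ∩
      {z : Pt | 0 < -D * cr d2 (z - w)}), y ∉ bd v := by
    rintro y ⟨hy1, hy2, hy3⟩ hyB
    obtain ⟨t, t0, h | h⟩ := hB y hy1 hyB <;> rw [Set.mem_ofPred_eq, h, hcs] at hy2 hy3
    · rw [hself] at hy2; simp at hy2
    · rw [hself] at hy3; simp at hy3
  -- a common point of the two half balls
  obtain ⟨η, ⟨hη, hηb⟩⟩ := (ev_Ioi.and (evb w (-(d1 + d2)) (Metric.mem_ball_self hε))).exists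
  set o := w + η • (-(d1 + d2)) with ho
  have ho1 : 0 < -D * cr d1 (o - w) := by
    have : cr d1 (o - w) = - (η * D) := by
      simp only [ho, hD, cr, add_sub_cancel_left, Prod.smul_fst, Prod.smul_snd, smul_eq_mul,
        Prod.fst_neg, Prod.snd_neg, Prod.fst_add, Prod.snd_add]; ring
    rw [this]; nlinarith
  have ho2 : 0 < D * cr d2 (o - w) := by
    have : cr d2 (o - w) = η * D := by
      simp only [ho, hD, cr, add_sub_cancel_left, Prod.smul_fst, Prod.smul_snd, smul_eq_mul,
        Prod.fst_neg, Prod.snd_neg, Prod.fst_add, Prod.snd_add]; ring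
    rw [this]; nlinarith
  have big : o ∈ extr (bd v) → (∃ m ∈ openSegment ℝ (v k) (v (k + 1)), m ∈ closure (extr (bd v))) ∧
    (∃ m ∈ openSegment ℝ (v (k + 1)) (v (k + 1 + 1)), m ∈ closure (extr (bd v))) := by
    intro hoE
    refine ⟨⟨m1, hm1o, ?_⟩, ⟨m2, hm2o, ?_⟩⟩
    · apply adj m1 d1 0 (-D) hm1 z1 h1 (neg_ne_zero.2 hD0)
      filter_upwards [evb m1 (-D • perp d1) hm1] with t ht hpos
      exact extr_conn hK1 hoff1 ⟨hηb, ho1⟩ ⟨ht, hpos⟩ hoE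
    · apply adj m2 d2 0 D hm2 z2 h2 hD0
      filter_upwards [evb m2 (D • perp d2) hm2] with t ht hpos
      exact extr_conn hK2 hoff2 ⟨hηb, ho2⟩ ⟨ht, hpos⟩ hoE
  rcases lt_or_gt_of_ne (mul_ne_zero hD0 hne1) with h | h
  · exact big (extr_conn hK1 hoff1 ⟨hzT, by simp only [Set.mem_ofPred_eq]; linarith⟩ ⟨hηb, ho1⟩ hzE)
  rcases lt_or_gt_of_ne (mul_ne_zero hD0 hne2) with h' | h'
  swap
  · exact big (extr_conn hK2 hoff2 ⟨hzT, h'⟩ ⟨hηb, ho2⟩ hzE)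
  have hzK : z ∈ Metric.ball w ε ∩ ({z : Pt | 0 < D * cr d1 (z - w)} ∩
      {z : Pt | 0 < -D * cr d2 (z - w)}) := ⟨hzT, h, by simp only [Set.mem_ofPred_eq]; linarith⟩
  refine ⟨⟨m1, hm1o, ?_⟩, ⟨m2, hm2o, ?_⟩⟩
  · apply adj m1 d1 0 D hm1 z1 h1 hD0
    have e1 : 0 < -D * cr d2 (m1 - w) := by rw [em1, hcs, hanti]; nlinarith
    have e2 := (tend_zero m1 (D • perp d1)).eventually
      (ev_pos (f := fun z => -D * cr d2 (z - w)) ((hcont d2).const_mul _ |>.congr fun _ => rfl) e1)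
    filter_upwards [evb m1 (D • perp d1) hm1, e2] with t ht hp hpos
    exact extr_conn hK3 hoff3 hzK ⟨ht, hpos, hp⟩ hzE
  · apply adj m2 d2 0 (-D) hm2 z2 h2 (neg_ne_zero.2 hD0)
    have e1 : 0 < D * cr d1 (m2 - w) := by rw [em2, hcs, ← hD]; nlinarith
    have e2 := (tend_zero m2 (-D • perp d2)).eventually
      (ev_pos (f := fun z => D * cr d1 (z - w)) ((hcont d1).const_mul _ |>.congr fun _ => rfl) e1)
    filter_upwards [evb m2 (-D • perp d2) hm2, e2] with t ht hp hpos
    exact extr_conn hK3 hoff3 hzK ⟨ht, hp, hpos⟩ hzE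

end PolyZ


open Topology Filter

lemma seg_cases {a b z : Pt} (h : z ∈ segment ℝ a b) : z = a ∨ z = b ∨ z ∈ openSegment ℝ a b := by
  obtain ⟨t, h0, h1, rfl⟩ := mem_seg'.1 h
  rcases h0.eq_or_lt with h0 | h0
  · left; simp [← h0]
  rcases h1.eq_or_lt with h1 | h1
  · right; left; simp [h1]
  · exact Or.inr (Or.inr (mem_oseg.2 ⟨t, h0, h1, rfl⟩))

/-- An open set contains points off finitely many lines. -/
lemma avoid {U : Set Pt} (hU : IsOpen U) (hne : U.Nonempty) {ι : Type*} (F : Finset ι)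
    (d a : ι → Pt) (hd : ∀ i ∈ F, d i ≠ 0) : ∃ z ∈ U, ∀ i ∈ F, cr (d i) (z - a i) ≠ 0 := by
  classical
  have : ∃ W ⊆ U, IsOpen W ∧ W.Nonempty ∧ ∀ z ∈ W, ∀ i ∈ F, cr (d i) (z - a i) ≠ 0 := by
    induction F using Finset.induction_on with
    | empty => exact ⟨U, subset_rfl, hU, hne, by simp⟩
    | insert i F hi ih =>
      obtain ⟨W, hWU, hWo, ⟨w, hw⟩, hW⟩ := ih (fun j hj => hd j (Finset.mem_insert_of_mem hj))
      obtain ⟨z, hz, hz1, -⟩ := perturb hWo hw (hd i (Finset.mem_insert_self _ _))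
        (hd i (Finset.mem_insert_self _ _)) (a i) (a i)
      refine ⟨W ∩ {z | cr (d i) (z - a i) ≠ 0}, fun y hy => hWU hy.1, hWo.inter ?_, ⟨z, hz, hz1⟩, ?_⟩
      · have : Continuous fun z : Pt => cr (d i) (z - a i) := by unfold cr; fun_prop
        exact isOpen_ne_fun this continuous_const
      · intro y hy j hj
        rcases Finset.mem_insert.1 hj with rfl | hj
        · exact hy.2
        · exact hW y hy.1 j hj
  obtain ⟨W, hWU, -, ⟨w, hw⟩, hW⟩ := this
  exact ⟨w, hWU hw, hW w hw⟩

lemma triS_outside {a b z y : Pt} (h : cr (b - a) (z - a) * cr (b - a) (y - a) < 0) :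
    Wd (triS a b z) y = 0 := by
  set c := cr (b - a) (z - a) with hc
  have hd : b - a ≠ 0 := by
    intro h0; rw [h0] at h; simp [cr] at h
  have hc0 : c ≠ 0 := by rintro h0; rw [h0] at h; simp at h
  have hp := cr_perp_pos hd
  set q := (-c) • perp (b - a) with hq
  have hq0 : q ≠ 0 := by
    intro h0
    rcases smul_eq_zero.1 h0 with h1 | h1
    · exact hc0 (neg_eq_zero.1 h1)
    · rw [h1] at hp; simp [cr] at hp
  set M := ‖a‖ + ‖b‖ + ‖z‖ with hM
  have hq1 : 0 < ‖q‖ := norm_pos_iff.2 hq0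
  set L := (M + ‖y‖ + 1) / ‖q‖ with hL
  have hL0 : 0 ≤ L := by positivity
  have hfar : M < ‖y + L • q‖ := by
    have h1 : ‖L • q‖ = M + ‖y‖ + 1 := by
      rw [norm_smul, Real.norm_eq_abs, abs_of_nonneg hL0, hL]; field_simp
    have h2 : ‖L • q‖ ≤ ‖y + L • q‖ + ‖y‖ := by
      have := norm_sub_le (y + L • q) y
      simpa using this
    linarith
  have hMe : ∀ e ∈ triS a b z, ‖e.1‖ ≤ M ∧ ‖e.2‖ ≤ M := by
    have := norm_nonneg a
    have := norm_nonneg b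
    have := norm_nonneg z
    intro e he
    simp only [triS, Multiset.insert_eq_cons, Multiset.mem_cons, Multiset.mem_singleton] at he
    rcases he with rfl | rfl | rfl <;> constructor <;> simp only [] <;> linarith
  rw [← Wd_far (triS_cyc a b z) hMe hfar]
  refine Wd_const (triS_cyc a b z) (hp_convex (-c) (b - a) a).isPreconnected ?_
    (by simp only [Set.mem_ofPred_eq]; linarith) ?_
  · intro x hx hxS
    simp only [Set.mem_ofPred_eq] at hx
    have hcc := mul_self_pos.2 hc0
    rcases Sup_triS.1 hxS with h1 | h1 | h1
    · rw [seg_cr h1] at hx; simp at hx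
    · obtain ⟨t, t0, t1, e1, e2⟩ := mem_seg.1 h1
      have : cr (b - a) (x - a) = t * c := by
        simp only [hc, cr, Prod.fst_sub, Prod.snd_sub, e1, e2]; ring
      rw [this] at hx; nlinarith
    · obtain ⟨t, t0, t1, e1, e2⟩ := mem_seg.1 h1
      have : cr (b - a) (x - a) = (1 - t) * c := by
        simp only [hc, cr, Prod.fst_sub, Prod.snd_sub, e1, e2]; ring
      rw [this] at hx; nlinarith
  · simp only [Set.mem_ofPred_eq]
    rw [show y + L • q - a = (y - a) + (L * -c) • perp (b - a) by rw [hq, mul_smul]; abel,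
      cr_add_smul]
    have hcc := mul_self_pos.2 hc0
    have : 0 ≤ L * (c * c) * cr (b - a) (perp (b - a)) := by positivity
    nlinarith

/-- A piece of the boundary as a chain. -/
def PS (v : ℤ → Pt) (s : Finset ℕ) : Multiset (Pt × Pt) :=
  s.val.map fun k : ℕ => (v k, v ((k : ℤ) + 1))

lemma PS_sum (v : ℤ → Pt) (s : Finset ℕ) (g : Pt × Pt → ZMod 2) :
    ((PS v s).map g).sum = ∑ k ∈ s, g (v k, v ((k : ℤ) + 1)) := by
  rw [PS, Multiset.map_map]; rfl

lemma PS_Ico (v : ℤ → Pt) (g : Pt → ZMod 2) {a b : ℕ} (h : a ≤ b) :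
    ∑ k ∈ Finset.Ico a b, (g (v k) + g (v ((k : ℤ) + 1))) = g (v a) + g (v b) := by
  induction b, h using Nat.le_induction with
  | base => simp [z2_add_self]
  | succ b hb ih =>
    rw [Finset.sum_Ico_succ_top hb, ih]
    push_cast
    linear_combination z2_add_self (g (v b))

lemma PS_Sup {v : ℤ → Pt} {s : Finset ℕ} {z : Pt} : z ∈ Sup (PS v s) ↔ ∃ k ∈ s, z ∈ sg v k := by
  simp [Sup, PS, sg]

lemma Sup_cons {e : Pt × Pt} {S : Multiset (Pt × Pt)} {z : Pt} :
    z ∈ Sup (e ::ₘ S) ↔ z ∈ segment ℝ e.1 e.2 ∨ z ∈ Sup S := by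
  simp [Sup]

lemma Sup_closed (S : Multiset (Pt × Pt)) : IsClosed (Sup S) := by
  induction S using Multiset.induction with
  | empty => simp [Sup]
  | cons e S ih =>
    have : Sup (e ::ₘ S) = segment ℝ e.1 e.2 ∪ Sup S := by ext z; exact Sup_cons
    rw [this]
    refine IsClosed.union ?_ ih
    rw [segment_eq_image']
    exact (isCompact_Icc.image (by fun_prop)).isClosed

lemma Wd_cons (e : Pt × Pt) (S : Multiset (Pt × Pt)) (z : Pt) :
    Wd (e ::ₘ S) z = chi e.1 e.2 z + Wd S z := by simp [Wd]

namespace PolyZ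
variable {n : ℕ} {v : ℤ → Pt} (P : PolyZ n v)
include P

lemma ext_ne : (extr (bd v)).Nonempty := by
  obtain ⟨M, hM⟩ := P.bd_compact.isBounded.exists_norm_le
  have h0 : 0 ≤ M := (norm_nonneg _).trans (hM (v 0) ⟨0, left_mem_segment _ _ _⟩)
  refine ⟨(M + 1, 0), extr_far hM h0 ?_⟩
  rw [Prod.norm_def]
  refine lt_max_of_lt_left ?_
  rw [Real.norm_eq_abs, abs_of_nonneg (by simp; linarith)]
  simp

/-- Every boundary point is approached from outside. -/
lemma bd_closure : bd v ⊆ closure (extr (bd v)) := by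
  set E : ℤ → Prop := fun k => ∃ m ∈ openSegment ℝ (v k) (v (k + 1)), m ∈ closure (extr (bd v))
    with hE
  have hstart : ∃ k, E k := by
    obtain ⟨y, hy⟩ := P.ext_ne
    have hx : v 0 ∈ reg (bd v) := bd_reg ⟨0, left_mem_segment _ _ _⟩
    obtain ⟨s, -, -, -, hmB, hnear⟩ := exit_pt P.bd_closed hx (not_reg.2 hy)
    set m := v 0 + s • (y - v 0) with hm
    have hmc : m ∈ closure (extr (bd v)) := by
      have hf : Continuous fun u : ℝ => v 0 + u • (y - v 0) := by fun_prop
      rw [Metric.mem_closure_iff]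
      intro ε he
      obtain ⟨δ, hd, hδ⟩ := Metric.continuousAt_iff.1 (hf.continuousAt (x := s)) ε he
      obtain ⟨u, hu1, hu2, -, hu3⟩ := hnear δ hd
      refine ⟨_, hu3, ?_⟩
      rw [dist_comm]
      exact hδ (by rw [Real.dist_eq, abs_lt]; constructor <;> linarith)
    obtain ⟨j, hj⟩ := hmB
    have hv : ∀ k, m = v (k + 1) → E k ∧ E (k + 1) := by
      intro k hk
      obtain ⟨ε, he, h⟩ := P.vtx_ext k
      rw [hk] at hmc
      obtain ⟨z, hz1, hz2⟩ := mem_closure_iff_nhds.1 hmc _ (Metric.ball_mem_nhds _ he)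
      exact h z hz1 hz2
    rcases seg_cases hj with h | h | h
    · have := (hv (j - 1) (by rw [h]; congr 1; ring)).1
      exact ⟨_, this⟩
    · exact ⟨_, (hv j h).1⟩
    · exact ⟨j, m, h, hmc⟩
  have hall : ∀ k, E k → openSegment ℝ (v k) (v (k + 1)) ⊆ closure (extr (bd v)) := by
    rintro k ⟨m, hm, hmc⟩ m' hm'
    exact P.edge_ext hm hm' hmc
  have hseg : ∀ k, E k → sg v k ⊆ closure (extr (bd v)) := by
    intro k hk
    unfold sg
    rw [← closure_openSegment]
    exact closure_minimal (hall k hk) isClosed_closure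
  have hstep : ∀ k, E k → E (k + 1) := by
    intro k hk
    obtain ⟨ε, he, h⟩ := P.vtx_ext k
    have := hseg k hk (right_mem_segment _ _ _)
    obtain ⟨z, hz1, hz2⟩ := mem_closure_iff_nhds.1 this _ (Metric.ball_mem_nhds _ he)
    exact (h z hz1 hz2).2
  obtain ⟨k0, hk0⟩ := hstart
  have hup : ∀ t : ℕ, E (k0 + t) := by
    intro t
    induction t with
    | zero => simpa using hk0
    | succ t ih => have := hstep _ ih; push_cast; rwa [← add_assoc]
  rintro z ⟨j, hj⟩
  have h0 := Int.emod_nonneg (j - k0) P.npos.ne'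
  have h1 := hseg _ (hup ((j - k0) % n).toNat)
  apply h1
  rw [P.sg_dvd (j := j)]
  · exact hj
  · rw [Int.toNat_of_nonneg h0, show k0 + (j - k0) % n - j = (j - k0) % n - (j - k0) by ring]
    exact (Int.dvd_iff_emod_eq_zero).2 (by simp [Int.sub_emod])

/-- Each side of an edge is locally inside or outside. -/
lemma side {k : ℤ} {m : Pt} (hm : m ∈ openSegment ℝ (v k) (v (k + 1))) :
    ∃ ε > 0, ∀ z ∈ Metric.ball m ε, ∀ z' ∈ Metric.ball m ε,
      0 < cr (v (k + 1) - v k) (z - v k) * cr (v (k + 1) - v k) (z' - v k) →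
      z ∈ extr (bd v) → z' ∈ extr (bd v) := by
  obtain ⟨ε, hε, hball⟩ := Metric.eventually_nhds_iff_ball.1 (P.loc_nhds m)
  refine ⟨ε, hε, fun z hz z' hz' hpos hzE => ?_⟩
  set c := cr (v (k + 1) - v k) (z - v k) with hc
  have hc0 : c ≠ 0 := by rintro h; rw [h] at hpos; simp at hpos
  refine extr_conn (K := Metric.ball m ε ∩ {z : Pt | 0 < c * cr (v (k + 1) - v k) (z - v k)})
    ((convex_ball m ε).inter (hp_convex c _ (v k))).isPreconnected ?_ ⟨hz, mul_self_pos.2 hc0⟩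
    ⟨hz', hpos⟩ hzE
  rintro y ⟨hy1, hy2⟩ ⟨j, hj⟩
  rw [← P.sg_dvd (P.oseg_uniq hm (hball y hy1 j hj))] at hj
  rw [Set.mem_ofPred_eq, seg_cr hj] at hy2
  simp at hy2

/-- At most one side of an edge is inside. -/
lemma two_sides {k : ℤ} {m : Pt} (hm : m ∈ openSegment ℝ (v k) (v (k + 1))) :
    ∃ ε > 0, ∀ z ∈ Metric.ball m ε, ∀ z' ∈ Metric.ball m ε,
      cr (v (k + 1) - v k) (z - v k) * cr (v (k + 1) - v k) (z' - v k) < 0 →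
      z ∈ reg (bd v) → z' ∈ extr (bd v) := by
  obtain ⟨ε, hε, h⟩ := P.side hm
  refine ⟨ε, hε, fun z hz z' hz' hneg hzR => ?_⟩
  have hmB : m ∈ bd v := ⟨k, openSegment_subset_segment _ _ _ hm⟩
  have hd : v (k + 1) - v k ≠ 0 := sub_ne_zero.2 (P.ne_succ k).symm
  obtain ⟨y0, hy0, hy0'⟩ := mem_closure_iff_nhds.1 (P.bd_closure hmB) _ (Metric.ball_mem_nhds _ hε)
  obtain ⟨y, ⟨hy1, hy2⟩, hne, -⟩ := perturb (Metric.isOpen_ball.inter (extr_open P.bd_closed))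
    ⟨hy0, hy0'⟩ hd hd (v k) (v k)
  set f : Pt → ℝ := fun z => cr (v (k + 1) - v k) (z - v k) with hf
  change f z * f z' < 0 at hneg
  change f y ≠ 0 at hne
  have hz0 : f z ≠ 0 := by intro h; rw [h] at hneg; simp at hneg
  rcases lt_or_gt_of_ne (mul_ne_zero hne hz0) with h1 | h1
  · refine h y hy1 z' hz' ?_ hy2
    change 0 < f y * f z'
    have hzz := mul_self_pos.2 hz0
    nlinarith [mul_pos_of_neg_of_neg h1 hneg]
  · exact absurd (h y hy1 z hz h1 hy2) hzR

/-- A segment inside the region cannot cross an edge transversally. -/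
lemma trans {p q m : Pt} {k : ℤ} (hpq : segment ℝ p q ⊆ reg (bd v))
    (hm : m ∈ openSegment ℝ p q) (hmk : m ∈ openSegment ℝ (v k) (v (k + 1))) :
    cr (v (k + 1) - v k) (q - p) = 0 := by
  by_contra hc
  obtain ⟨ε, hε, h⟩ := P.two_sides hmk
  obtain ⟨s, s0, s1, hs⟩ := mem_oseg.1 hm
  have hb := Metric.ball_mem_nhds m hε
  have e1 := (tend_zero m (q - p)).eventually hb
  have e2 := (tend_zero m (-(q - p))).eventually hb
  obtain ⟨t, ⟨⟨⟨t0, t1⟩, t2⟩, t3⟩, t4⟩ := ((((ev_Ioi.and e1).and e2).and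
    (ev_Ioi_lt s0)).and (ev_Ioi_lt (sub_pos.2 s1))).exists
  have r1 : m + t • (q - p) ∈ reg (bd v) := hpq (mem_seg'.2 ⟨s + t, by linarith, by linarith,
    by rw [hs, add_smul, add_assoc]⟩)
  have r2 : m + t • (-(q - p)) ∈ reg (bd v) := hpq (mem_seg'.2 ⟨s - t, by linarith, by linarith,
    by rw [hs, sub_smul, smul_neg]; abel⟩)
  refine r2 (h _ t1 _ t2 ?_ r1)
  have hm0 : cr (v (k + 1) - v k) (m - v k) = 0 := seg_cr (openSegment_subset_segment _ _ _ hmk)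
  rw [show m + t • (q - p) - v k = (m - v k) + t • (q - p) by abel,
    show m + t • (-(q - p)) - v k = (m - v k) + (-t) • (q - p) by rw [smul_neg, neg_smul]; abel,
    cr_add_smul, cr_add_smul, hm0]
  have := mul_self_pos.2 hc
  have := mul_pos t0 t0
  nlinarith

lemma PS_all_cyc : Cyc (PS v (Finset.range n)) := by
  intro s
  rw [PS_sum, Finset.range_eq_Ico, PS_Ico v s (Nat.zero_le n)]
  have := P.per 0
  rw [zero_add] at this
  rw [this]; exact z2_add_self _

lemma PS_all_Sup {z : Pt} : z ∈ Sup (PS v (Finset.range n)) ↔ z ∈ bd v := by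
  rw [PS_Sup, P.bd_fin]; simp

/-- Interior points have winding parity one. -/
lemma par {z : Pt} (hzB : z ∉ bd v) (hzE : z ∉ extr (bd v)) : Wd (PS v (Finset.range n)) z = 1 := by
  have hvB : ∀ j : ℤ, v j ∈ bd v := fun j => ⟨j, left_mem_segment _ _ _⟩
  obtain ⟨e0, he0, hav⟩ := avoid (extr_open P.bd_closed) P.ext_ne (Finset.range (n + 1))
    (fun j : ℕ => v j - z) (fun _ => z) (fun j _ => sub_ne_zero.2 (fun h => hzB (h ▸ hvB j)))
  set g : ℝ → Pt := fun u => z + u • (e0 - z) with hg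
  have hgc : Continuous g := by fun_prop
  have hg0 : g 0 = z := by simp [hg]
  have hg1 : g 1 = e0 := by simp [hg]
  -- first hit of the boundary
  have hT : IsCompact (Set.Icc (0:ℝ) 1 ∩ g ⁻¹' bd v) :=
    isCompact_Icc.inter_right (P.bd_closed.preimage hgc)
  have hTne : (Set.Icc (0:ℝ) 1 ∩ g ⁻¹' bd v).Nonempty := by
    by_contra hcon
    rw [Set.not_nonempty_iff_eq_empty] at hcon
    apply hzE
    refine extr_conn (K := g '' Set.Icc 0 1) (isPreconnected_Icc.image _ hgc.continuousOn) ?_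
      ⟨1, by simp, hg1⟩ ⟨0, by simp, hg0⟩ he0
    rintro _ ⟨u, hu, rfl⟩ hB
    have : u ∈ Set.Icc (0:ℝ) 1 ∩ g ⁻¹' bd v := ⟨hu, hB⟩
    rw [hcon] at this; exact this
  obtain ⟨s, ⟨⟨hs0, hs1⟩, hsB⟩, hmin⟩ := hT.exists_isLeast hTne
  have hs0' : 0 < s := by
    refine lt_of_le_of_ne hs0 ?_
    rintro rfl
    exact hzB (by rw [← hg0]; exact hsB)
  set m := g s with hm
  obtain ⟨k, hkn, hmk⟩ := P.bd_fin.1 (show m ∈ bd v from hsB)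
  have hcs : ∀ a : Pt, cr a (m - z) = s * cr a (e0 - z) := by
    intro a; simp only [hm, hg, cr, add_sub_cancel_left, Prod.smul_fst, Prod.smul_snd, smul_eq_mul]
    ring
  have hnv : ∀ j : ℕ, j ≤ n → m ≠ v j := by
    intro j hj h
    have h1 := hav j (by simp; omega)
    have h2 := hcs (v j - z)
    rw [h] at h2
    have h3 : cr (v j - z) (v j - z) = 0 := by simp only [cr]; ring
    rw [h3] at h2
    rcases mul_eq_zero.1 h2.symm with h4 | h4
    · linarith
    · exact h1 h4
  have hmo : m ∈ openSegment ℝ (v k) (v ((k : ℤ) + 1)) := by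
    rcases seg_cases hmk with h | h | h
    · exact absurd h (hnv k hkn.le)
    · exact absurd h (by have := hnv (k + 1) hkn; push_cast at this; exact this)
    · exact h
  set d := v ((k : ℤ) + 1) - v k with hd
  set f : Pt → ℝ := fun x => cr d (x - v k) with hf
  have hfm : f m = 0 := seg_cr hmk
  have hfz : f z ≠ 0 := by
    intro h0
    have h1 := hav k (by simp; omega)
    have hd0 : d ≠ 0 := sub_ne_zero.2 (P.ne_succ k).symm
    have h2 : cr d (v k - z) = 0 := by
      simp only [hf, cr, Prod.fst_sub, Prod.snd_sub] at h0 ⊢; linarith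
    have h3 : cr d (e0 - z) = 0 := by
      have h4 := hcs d
      have h5 : cr d (m - z) = f m - f z := by
        simp only [hf, cr, Prod.fst_sub, Prod.snd_sub]; ring
      rw [h5, hfm, h0, sub_zero] at h4
      rcases mul_eq_zero.1 h4.symm with h4 | h4
      · linarith
      · exact h4
    apply h1
    have h6 : d.1 * cr (v k - z) (e0 - z) = 0 := by
      simp only [cr] at h2 h3 ⊢; linear_combination (v k - z).1 * h3 - (e0 - z).1 * h2
    have h7 : d.2 * cr (v k - z) (e0 - z) = 0 := by
      simp only [cr] at h2 h3 ⊢; linear_combination (v k - z).2 * h3 - (e0 - z).2 * h2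
    rcases mul_eq_zero.1 h6 with h | h
    · rcases mul_eq_zero.1 h7 with h' | h'
      · exact absurd (Prod.ext h h') hd0
      · exact h'
    · exact h
  -- the modified cycle
  set rest := PS v ((Finset.range n).erase k) with hrest
  set S' := (v k, z) ::ₘ (z, v ((k : ℤ) + 1)) ::ₘ rest with hS'
  set T := triS (v k) (v ((k : ℤ) + 1)) z with hTd
  have hsplit : ∀ G : Pt × Pt → ZMod 2, ((PS v (Finset.range n)).map G).sum =
      G (v k, v ((k : ℤ) + 1)) + (rest.map G).sum := by
    intro G
    rw [PS_sum, hrest, PS_sum, ← Finset.add_sum_erase _ _ (Finset.mem_range.2 hkn)]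
  have hSc : Cyc S' := by
    intro σ
    have h1 := P.PS_all_cyc σ
    rw [hsplit] at h1
    simp only [hS', Multiset.map_cons, Multiset.sum_cons] at h1 ⊢
    linear_combination h1 + z2_add_self (σ z)
  have hrel : ∀ x, Wd (PS v (Finset.range n)) x = Wd S' x + Wd T x := by
    intro x
    have h1 := hsplit (fun e => chi e.1 e.2 x)
    simp only [hS', hTd, Wd, triS, Multiset.insert_eq_cons, Multiset.map_cons, Multiset.sum_cons,
      Multiset.map_singleton, Multiset.sum_singleton] at h1 ⊢
    rw [h1, chi_comm z (v k), chi_comm (v ((k : ℤ) + 1)) z]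
    linear_combination - z2_add_self (chi (v k) z x) - z2_add_self (chi z (v ((k : ℤ) + 1)) x)
  have hmS : m ∉ Sup S' := by
    rw [hS', Sup_cons, Sup_cons, hrest, PS_Sup]
    rintro (h | h | ⟨j, hj, h⟩)
    · obtain ⟨t, t0, t1, e1, e2⟩ := mem_seg.1 h
      have : f m = t * f z := by simp only [hf, cr, Prod.fst_sub, Prod.snd_sub, e1, e2]; ring
      rw [hfm] at this
      rcases mul_eq_zero.1 this.symm with h' | h'
      · exact hnv k hkn.le (Prod.ext (by rw [e1, h']; ring) (by rw [e2, h']; ring))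
      · exact hfz h'
    · obtain ⟨t, t0, t1, e1, e2⟩ := mem_seg.1 h
      have : f m = (1 - t) * f z := by
        simp only [hf, hd, cr, Prod.fst_sub, Prod.snd_sub, e1, e2]; ring
      rw [hfm] at this
      rcases mul_eq_zero.1 this.symm with h' | h'
      · have := hnv (k + 1) hkn
        push_cast at this
        have ht : t = 1 := by linarith
        exact this (Prod.ext (by rw [e1, ht]; ring) (by rw [e2, ht]; ring))
      · exact hfz h'
    · obtain ⟨hjk, hjn⟩ := Finset.mem_erase.1 hj
      have hjn := Finset.mem_range.1 hjn
      obtain ⟨c, hc⟩ := P.oseg_uniq hmo h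
      have : c = 0 := by
        by_contra hc0
        rcases lt_or_gt_of_ne hc0 with h | h <;> nlinarith
      rw [this] at hc; omega
  obtain ⟨ε, hε, htwo⟩ := P.two_sides hmo
  have hev := ((Wd_loc hSc hmS).and (Metric.ball_mem_nhds m hε))
  have ev1 := (tend_zero m (z - m)).eventually hev
  have ev2 := (tend_zero m (-(z - m))).eventually hev
  obtain ⟨η, ⟨⟨hη, hη1⟩, h1W, h1b⟩, h2W, h2b⟩ :=
    ((((ev_Ioi.and (ev_Ioi_lt one_pos)).and ev1).and ev2)).exists
  set y1 := m + η • (z - m) with hy1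
  set y2 := m + η • (-(z - m)) with hy2
  have fy1 : f y1 = η * f z := by
    have : f y1 = (1 - η) * f m + η * f z := by
      simp only [hf, hy1, cr, Prod.fst_sub, Prod.snd_sub, Prod.fst_add, Prod.snd_add,
        Prod.smul_fst, Prod.smul_snd, smul_eq_mul]; ring
    rw [this, hfm]; ring
  have fy2 : f y2 = -(η * f z) := by
    have : f y2 = (1 + η) * f m - η * f z := by
      simp only [hf, hy2, cr, Prod.fst_sub, Prod.snd_sub, Prod.fst_add, Prod.snd_add,
        Prod.smul_fst, Prod.smul_snd, smul_eq_mul, Prod.fst_neg, Prod.snd_neg]; ring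
    rw [this, hfm]; ring
  have hzz := mul_self_pos.2 hfz
  have hy1g : y1 = g (s * (1 - η)) := by
    rw [hy1, hm, hg]
    ext <;> simp <;> ring
  -- `z` and `y1` are connected off the boundary
  have hKp : IsPreconnected (g '' Set.Icc 0 (s * (1 - η))) :=
    isPreconnected_Icc.image _ hgc.continuousOn
  have hsη : 0 ≤ s * (1 - η) := mul_nonneg hs0 (by linarith)
  have hKB : ∀ x ∈ g '' Set.Icc 0 (s * (1 - η)), x ∉ bd v := by
    rintro _ ⟨u, ⟨hu0, hu1⟩, rfl⟩ hB
    have := hmin ⟨⟨hu0, by nlinarith⟩, hB⟩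
    nlinarith
  have hzK : z ∈ g '' Set.Icc 0 (s * (1 - η)) := ⟨0, ⟨le_refl _, hsη⟩, hg0⟩
  have hyK : y1 ∈ g '' Set.Icc 0 (s * (1 - η)) := ⟨_, ⟨hsη, le_refl _⟩, hy1g.symm⟩
  have hy1R : y1 ∈ reg (bd v) := fun h => hzE (extr_conn hKp hKB hyK hzK h)
  have hy2E : y2 ∈ extr (bd v) := by
    refine htwo y1 h1b y2 h2b ?_ hy1R
    change f y1 * f y2 < 0
    rw [fy1, fy2]
    have := mul_pos hη hη
    nlinarith
  have w1 : Wd T y1 = 1 := by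
    obtain ⟨t, t0, t1, ht⟩ := mem_oseg.1 hmo
    refine triS_inside (x := (1 - η) * (1 - t)) (y := (1 - η) * t) (w := η)
      (mul_pos (by linarith) (by linarith)) (mul_pos (by linarith) t0) hη (by ring) ?_ ?_ hfz
    · simp [hy1, ht]; ring
    · simp [hy1, ht]; ring
  have w2 : Wd T y2 = 0 := by
    apply triS_outside
    change f z * f y2 < 0
    rw [fy2]; nlinarith
  have w3 : Wd (PS v (Finset.range n)) y2 = 0 :=
    Wd_extr P.PS_all_cyc (fun x hx => bd_reg (P.PS_all_Sup.1 hx)) hy2E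
  rw [Wd_const P.PS_all_cyc hKp (fun x hx h => hKB x hx (P.PS_all_Sup.1 h)) hzK hyK, hrel, w1, h1W,
    ← h2W]
  rw [hrel, w2, add_zero] at w3
  rw [w3, zero_add]

end PolyZ


open Topology Filter

/-- The boundary arc from `e` on edge `k` to `f` on edge `l`. -/
def A1 (v : ℤ → Pt) (k l : ℕ) (e f : Pt) : Set Pt :=
  {z | z ∈ segment ℝ e (v ((k : ℤ) + 1)) ∨ z ∈ segment ℝ (v l) f ∨ ∃ i : ℕ, k < i ∧ i < l ∧ z ∈ sg v i}

/-- The complementary arc. -/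
def A2 (v : ℤ → Pt) (n k l : ℕ) (e f : Pt) : Set Pt :=
  {z | z ∈ segment ℝ f (v ((l : ℤ) + 1)) ∨ z ∈ segment ℝ (v k) e ∨
    ∃ i : ℕ, (l < i ∧ i < n ∨ i < k) ∧ z ∈ sg v i}

lemma seg_sub {a b c : Pt} (h : b ∈ segment ℝ a c) : segment ℝ a b ⊆ segment ℝ a c :=
  (convex_segment a c).segment_subset (left_mem_segment _ _ _) h

lemma seg_sub' {a b c : Pt} (h : b ∈ segment ℝ a c) : segment ℝ b c ⊆ segment ℝ a c :=
  (convex_segment a c).segment_subset h (right_mem_segment _ _ _)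

/-- An endpoint in a subsegment away from it. -/
lemma seg_end {a b c : Pt} (h : b ∈ segment ℝ a c) (h' : a ∈ segment ℝ b c) : b = a := by
  by_cases hac : a = c
  · subst hac; simpa using h
  obtain ⟨t, t0, t1, e1, e2⟩ := mem_seg.1 h
  obtain ⟨s, s0, s1, f1, f2⟩ := mem_seg.1 h'
  have key : (1 - (1 - s) * (1 - t)) = 0 ∧ True := by
    refine ⟨?_, trivial⟩
    have g1 : (1 - (1 - s) * (1 - t)) * (c.1 - a.1) = 0 := by
      linear_combination (-1) * f1 - (1 - s) * e1
    have g2 : (1 - (1 - s) * (1 - t)) * (c.2 - a.2) = 0 := by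
      linear_combination (-1) * f2 - (1 - s) * e2
    rcases mul_eq_zero.1 g1 with h | h
    · exact h
    rcases mul_eq_zero.1 g2 with h' | h'
    · exact h'
    exact absurd (Prod.ext (by linarith) (by linarith)) hac
  have ht : t = 0 := by nlinarith [key.1]
  exact Prod.ext (by rw [e1, ht]; ring) (by rw [e2, ht]; ring)

/-- Two halves of a segment meet in the subdivision point. -/
lemma seg_mid {a b c z : Pt} (h : b ∈ segment ℝ a c) (h1 : z ∈ segment ℝ a b)
    (h2 : z ∈ segment ℝ b c) : z = b := by
  apply seg_end (a := b) (c := c) h2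
  by_cases hac : a = c
  · subst hac
    have : b = a := by simpa using h
    subst this; exact right_mem_segment _ _ _
  obtain ⟨t, t0, t1, e1, e2⟩ := mem_seg.1 h
  obtain ⟨s, s0, s1, f1, f2⟩ := mem_seg.1 h1
  have hd : 0 ≤ 1 - s * t := by nlinarith
  rcases hd.eq_or_lt with hd | hd
  · have ht : t = 1 := by nlinarith
    have hs : s = 1 := by rw [ht] at hd; linarith
    rw [show z = b from Prod.ext (by rw [f1, hs]; ring) (by rw [f2, hs]; ring)]
    exact left_mem_segment _ _ _
  · refine mem_seg.2 ⟨(t - s * t) / (1 - s * t), div_nonneg (by nlinarith) hd.le,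
      by rw [div_le_one hd]; linarith, ?_, ?_⟩
    · have hd' : 1 - s * t ≠ 0 := hd.ne'
      have := div_mul_cancel₀ (t - s * t) hd'
      generalize (t - s * t) / (1 - s * t) = q at *
      rw [f1, e1]; linear_combination (a.1 - c.1) * this
    · have hd' : 1 - s * t ≠ 0 := hd.ne'
      have := div_mul_cancel₀ (t - s * t) hd'
      generalize (t - s * t) / (1 - s * t) = q at *
      rw [f2, e2]; linear_combination (a.2 - c.2) * this

lemma prop_re1 (a b c d x : Prop) : (a ∨ b ∨ c ∨ d ∨ x) ↔ (a ∨ b ∨ x) ∨ d ∨ c := by tauto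

lemma prop_re2 (a b c d x : Prop) : (a ∨ b ∨ c ∨ d ∨ x) ↔ (a ∨ b ∨ x) ∨ c ∨ d := by tauto

namespace PolyZ
variable {n : ℕ} {v : ℤ → Pt} (P : PolyZ n v)
include P

lemma vn : v (n : ℤ) = v 0 := by have := P.per 0; rwa [zero_add] at this

omit P in
lemma dvd_small {a : ℤ} (h : (n : ℤ) ∣ a) (h1 : -(n : ℤ) < a) (h2 : a < 2 * n) : a = 0 ∨ a = n := by
  obtain ⟨t, rfl⟩ := h
  have h3 : (0 : ℤ) < n := by omega
  have : -1 < t := by nlinarith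
  have : t < 2 := by nlinarith
  have : t = 0 ∨ t = 1 := by omega
  rcases this with rfl | rfl <;> simp

lemma vinj {i j : ℕ} (hi : i < n) (hj : j < n) (h : v i = v j) : i = j := by
  rcases dvd_small (P.inj _ _ h) (by omega) (by omega) with h | h <;> omega

lemma meetN {i j : ℕ} {z : Pt} (hin : i < n) (hjn : j < n) (hi : z ∈ sg v i) (hj : z ∈ sg v j) :
    i = j ∨ (j = i + 1 ∧ z = v j ∧ z = v ((i : ℤ) + 1)) ∨
    (i + 1 = n ∧ j = 0 ∧ z = v j ∧ z = v ((i : ℤ) + 1)) ∨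
    (i = j + 1 ∧ z = v i ∧ z = v ((j : ℤ) + 1)) ∨
    (j + 1 = n ∧ i = 0 ∧ z = v i ∧ z = v ((j : ℤ) + 1)) := by
  have h3 := P.n3
  rcases P.meet hi hj with h | ⟨h, e⟩ | ⟨h, e⟩
  · rcases dvd_small h (by omega) (by omega) with h | h <;> omega
  · have e' : z = v ((i : ℤ) + 1) := by rw [e, P.per_dvd h]
    rcases dvd_small h (by omega) (by omega) with h | h
    · exact Or.inr (Or.inl ⟨by omega, e, e'⟩)
    · exact Or.inr (Or.inr (Or.inl ⟨by omega, by omega, e, e'⟩))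
  · have e' : z = v ((j : ℤ) + 1) := by rw [e, P.per_dvd h]
    have h' : (n : ℤ) ∣ (j + 1) - i := by rw [← dvd_neg]; simpa using h
    rcases dvd_small h' (by omega) (by omega) with h | h
    · exact Or.inr (Or.inr (Or.inr (Or.inl ⟨by omega, e, e'⟩)))
    · exact Or.inr (Or.inr (Or.inr (Or.inr ⟨by omega, by omega, e, e'⟩)))

lemma arcs_meet {k l : ℕ} (hkl : k < l) (hl : l < n) {e f z : Pt} (he : e ∈ sg v k) (hf : f ∈ sg v l)
    (h1 : z ∈ A1 v k l e f) (h2 : z ∈ A2 v n k l e f) : z = e ∨ z = f := by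
  have hk : k < n := hkl.trans hl
  have he' : e ∈ segment ℝ (v ((k : ℤ) + 1)) (v k) := by rw [segment_symm]; exact he
  have hf' : f ∈ segment ℝ (v ((l : ℤ) + 1)) (v l) := by rw [segment_symm]; exact hf
  -- endpoint facts
  have a1 : z = v k → z ∈ segment ℝ e (v ((k : ℤ) + 1)) → z = e := by
    rintro hz h; rw [hz] at h; rw [hz]; exact (seg_end he h).symm
  have a2 : z = v ((k : ℤ) + 1) → z ∈ segment ℝ (v k) e → z = e := by
    rintro hz h; rw [hz, segment_symm] at h; rw [hz]; exact (seg_end he' h).symm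
  have a3 : z = v l → z ∈ segment ℝ f (v ((l : ℤ) + 1)) → z = f := by
    rintro hz h; rw [hz] at h; rw [hz]; exact (seg_end hf h).symm
  have a4 : z = v ((l : ℤ) + 1) → z ∈ segment ℝ (v l) f → z = f := by
    rintro hz h; rw [hz, segment_symm] at h; rw [hz]; exact (seg_end hf' h).symm
  have b1 : z ∈ segment ℝ e (v ((k : ℤ) + 1)) → z ∈ sg v k := fun h => seg_sub' he h
  have b2 : z ∈ segment ℝ (v k) e → z ∈ sg v k := fun h => seg_sub he h
  have b3 : z ∈ segment ℝ f (v ((l : ℤ) + 1)) → z ∈ sg v l := fun h => seg_sub' hf h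
  have b4 : z ∈ segment ℝ (v l) f → z ∈ sg v l := fun h => seg_sub hf h
  rcases h1 with h1 | h1 | ⟨i, hi1, hi2, h1⟩ <;> rcases h2 with h2 | h2 | ⟨j, hj, h2⟩
  · rcases P.meetN hk hl (b1 h1) (b3 h2) with h | ⟨h, h', h''⟩ | ⟨h, h0, h', h''⟩ | ⟨h, h', h''⟩ |
      ⟨h, h0, h', h''⟩
    · omega
    · exact Or.inr (a3 h' h2)
    · omega
    · omega
    · exact Or.inl (a1 h' h1)
  · exact Or.inl (seg_mid he h2 h1)
  · rcases P.meetN hk (by omega) (b1 h1) h2 with h | ⟨h, h', h''⟩ | ⟨h, h0, h', h''⟩ | ⟨h, h', h''⟩ |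
      ⟨h, h0, h', h''⟩
    · omega
    · omega
    · omega
    · exact Or.inl (a1 h' h1)
    · exact Or.inl (a1 h' h1)
  · exact Or.inr (seg_mid hf h1 h2)
  · rcases P.meetN hl hk (b4 h1) (b2 h2) with h | ⟨h, h', h''⟩ | ⟨h, h0, h', h''⟩ | ⟨h, h', h''⟩ |
      ⟨h, h0, h', h''⟩
    · omega
    · omega
    · exact Or.inr (a4 h'' h1)
    · exact Or.inl (a2 h'' h2)
    · omega
  · rcases P.meetN hl (by omega) (b4 h1) h2 with h | ⟨h, h', h''⟩ | ⟨h, h0, h', h''⟩ | ⟨h, h', h''⟩ |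
      ⟨h, h0, h', h''⟩
    · omega
    · exact Or.inr (a4 h'' h1)
    · exact Or.inr (a4 h'' h1)
    · omega
    · omega
  · rcases P.meetN (by omega) hl h1 (b3 h2) with h | ⟨h, h', h''⟩ | ⟨h, h0, h', h''⟩ | ⟨h, h', h''⟩ |
      ⟨h, h0, h', h''⟩
    · omega
    · exact Or.inr (a3 h' h2)
    · omega
    · omega
    · omega
  · rcases P.meetN (by omega) hk h1 (b2 h2) with h | ⟨h, h', h''⟩ | ⟨h, h0, h', h''⟩ | ⟨h, h', h''⟩ |
      ⟨h, h0, h', h''⟩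
    · omega
    · omega
    · omega
    · exact Or.inl (a2 h'' h2)
    · omega
  · rcases P.meetN (by omega) (by omega) h1 h2 with h | ⟨h, h', h''⟩ | ⟨h, h0, h', h''⟩ | ⟨h, h', h''⟩ |
      ⟨h, h0, h', h''⟩ <;> omega

omit P in
lemma seg_split {a b c z : Pt} (h : b ∈ segment ℝ a c) (hz : z ∈ segment ℝ a c) :
    z ∈ segment ℝ a b ∨ z ∈ segment ℝ b c := by
  obtain ⟨t, t0, t1, e1, e2⟩ := mem_seg.1 h
  obtain ⟨s, s0, s1, f1, f2⟩ := mem_seg.1 hz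
  rcases lt_or_ge t s with hst | hst
  · right
    have : 0 < 1 - t := by linarith
    refine mem_seg.2 ⟨(s - t) / (1 - t), div_nonneg (by linarith) this.le,
      by rw [div_le_one this]; linarith, ?_, ?_⟩
    · rw [f1, e1]; field_simp; ring
    · rw [f2, e2]; field_simp; ring
  · left
    rcases t0.eq_or_lt with h0 | h0
    · have : s = 0 := by linarith
      rw [show z = a from Prod.ext (by rw [f1, this]; ring) (by rw [f2, this]; ring)]
      exact left_mem_segment _ _ _
    · refine mem_seg.2 ⟨s / t, div_nonneg s0 t0, by rw [div_le_one h0]; linarith, ?_, ?_⟩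
      · rw [f1, e1]; field_simp; ring
      · rw [f2, e2]; field_simp; ring

lemma arcs_cover {k l : ℕ} {e f z : Pt} (he : e ∈ sg v k) (hf : f ∈ sg v l)
    (hz : z ∈ bd v) : z ∈ A1 v k l e f ∨ z ∈ A2 v n k l e f := by
  obtain ⟨i, hi, hzi⟩ := P.bd_fin.1 hz
  by_cases h1 : i = k
  · subst h1
    rcases seg_split he hzi with h | h
    · exact Or.inr (Or.inr (Or.inl h))
    · exact Or.inl (Or.inl h)
  by_cases h2 : i = l
  · subst h2
    rcases seg_split hf hzi with h | h
    · exact Or.inl (Or.inr (Or.inl h))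
    · exact Or.inr (Or.inl h)
  by_cases h3 : k < i ∧ i < l
  · exact Or.inl (Or.inr (Or.inr ⟨i, h3.1, h3.2, hzi⟩))
  · exact Or.inr (Or.inr (Or.inr ⟨i, by omega, hzi⟩))

lemma A1_bd {k l : ℕ} {e f z : Pt} (he : e ∈ sg v k) (hf : f ∈ sg v l) (h : z ∈ A1 v k l e f) :
    z ∈ bd v := by
  rcases h with h | h | ⟨i, -, -, h⟩
  · exact ⟨k, seg_sub' he h⟩
  · exact ⟨l, seg_sub hf h⟩
  · exact ⟨i, h⟩

lemma A2_bd {k l : ℕ} {e f z : Pt} (he : e ∈ sg v k) (hf : f ∈ sg v l) (h : z ∈ A2 v n k l e f) :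
    z ∈ bd v := by
  rcases h with h | h | ⟨i, -, h⟩
  · exact ⟨l, seg_sub' hf h⟩
  · exact ⟨k, seg_sub he h⟩
  · exact ⟨i, h⟩

/-- Separation: a crosscut separates the two boundary arcs. -/
theorem sep {k l : ℕ} (hkl : k < l) (hl : l < n) {e f m : Pt} (he : e ∈ sg v k) (hf : f ∈ sg v l)
    (hem : segment ℝ e m ⊆ reg (bd v)) (hmf : segment ℝ m f ⊆ reg (bd v)) {K : Set Pt}
    (hK : IsPreconnected K) (hKR : K ⊆ reg (bd v))
    (hKσ : ∀ z ∈ K, z ∉ segment ℝ e m ∧ z ∉ segment ℝ m f) {x y : Pt} (hx : x ∈ K) (hy : y ∈ K)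
    (hx1 : x ∈ A1 v k l e f) (hy2 : y ∈ A2 v n k l e f) : False := by
  set G1 : Multiset (Pt × Pt) := (e, v ((k : ℤ) + 1)) ::ₘ (v l, f) ::ₘ (f, m) ::ₘ (m, e) ::ₘ
    PS v (Finset.Ico (k + 1) l) with hG1
  set G2 : Multiset (Pt × Pt) := (f, v ((l : ℤ) + 1)) ::ₘ (v k, e) ::ₘ (e, m) ::ₘ (m, f) ::ₘ
    (PS v (Finset.Ico (l + 1) n ∪ Finset.Ico 0 k)) with hG2
  have hdis : Disjoint (Finset.Ico (l + 1) n) (Finset.Ico 0 k) := by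
    rw [Finset.disjoint_left]; intro i; simp; omega
  have c1 : Cyc G1 := by
    intro s
    simp only [hG1, Multiset.map_cons, Multiset.sum_cons]
    rw [PS_sum, PS_Ico v s (by omega)]
    push_cast
    linear_combination z2_add_self (s e) + z2_add_self (s f) + z2_add_self (s m) +
      z2_add_self (s (v ((k : ℤ) + 1))) + z2_add_self (s (v l))
  have c2 : Cyc G2 := by
    intro s
    simp only [hG2, Multiset.map_cons, Multiset.sum_cons]
    rw [PS_sum, Finset.sum_union hdis, PS_Ico v s (by omega), PS_Ico v s (by omega), P.vn]
    push_cast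
    linear_combination z2_add_self (s e) + z2_add_self (s f) + z2_add_self (s m) +
      z2_add_self (s (v ((l : ℤ) + 1))) + z2_add_self (s (v k)) + z2_add_self (s (v 0))
  have hS1 : ∀ z, z ∈ Sup G1 ↔ z ∈ A1 v k l e f ∨ z ∈ segment ℝ e m ∨ z ∈ segment ℝ m f := by
    intro z
    rw [hG1]
    have : (∃ i ∈ Finset.Ico (k + 1) l, z ∈ sg v i) ↔ ∃ i : ℕ, k < i ∧ i < l ∧ z ∈ sg v i := by
      simp [Nat.succ_le_iff, and_assoc]
    simp only [Sup_cons, PS_Sup, A1, Set.mem_ofPred_eq, this, segment_symm ℝ f m,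
      segment_symm ℝ m e]
    exact prop_re1 _ _ _ _ _
  have hS2 : ∀ z, z ∈ Sup G2 ↔ z ∈ A2 v n k l e f ∨ z ∈ segment ℝ e m ∨ z ∈ segment ℝ m f := by
    intro z
    rw [hG2]
    have : (∃ i ∈ Finset.Ico (l + 1) n ∪ Finset.Ico 0 k, z ∈ sg v i) ↔
        ∃ i : ℕ, (l < i ∧ i < n ∨ i < k) ∧ z ∈ sg v i := by
      simp [Nat.succ_le_iff]
    simp only [Sup_cons, PS_Sup, A2, Set.mem_ofPred_eq, this]
    exact prop_re2 _ _ _ _ _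
  have hsum : ∀ z, Wd G1 z + Wd G2 z = Wd (PS v (Finset.range n)) z := by
    intro z
    have hr : Finset.range n = insert k (insert l (Finset.Ico (k + 1) l ∪
        (Finset.Ico (l + 1) n ∪ Finset.Ico 0 k))) := by
      ext i; simp; omega
    have hd2 : Disjoint (Finset.Ico (k + 1) l) (Finset.Ico (l + 1) n ∪ Finset.Ico 0 k) := by
      rw [Finset.disjoint_left]; intro i; simp; omega
    have h0 : Wd (PS v (Finset.range n)) z = chi (v k) (v ((k : ℤ) + 1)) z +
        (chi (v l) (v ((l : ℤ) + 1)) z + (Wd (PS v (Finset.Ico (k + 1) l)) z +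
        Wd (PS v (Finset.Ico (l + 1) n ∪ Finset.Ico 0 k)) z)) := by
      unfold Wd
      rw [PS_sum, PS_sum, PS_sum, hr, Finset.sum_insert (by simp; omega),
        Finset.sum_insert (by simp; omega), Finset.sum_union hd2]
    rw [h0, hG1, hG2]
    simp only [Wd_cons]
    rw [chi_sub (a := v k) (b := e) (c := v ((k : ℤ) + 1)) he,
      chi_sub (a := v l) (b := f) (c := v ((l : ℤ) + 1)) hf, chi_comm f m, chi_comm m e]
    linear_combination z2_add_self (chi m f z) + z2_add_self (chi e m z)
  have hR1 : Sup G1 ⊆ reg (bd v) := by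
    intro z hz
    rcases (hS1 z).1 hz with h | h | h
    · exact bd_reg (P.A1_bd he hf h)
    · exact hem h
    · exact hmf h
  have hR2 : Sup G2 ⊆ reg (bd v) := by
    intro z hz
    rcases (hS2 z).1 hz with h | h | h
    · exact bd_reg (P.A2_bd he hf h)
    · exact hem h
    · exact hmf h
  have hzero : ∀ {S : Multiset (Pt × Pt)}, Cyc S → Sup S ⊆ reg (bd v) → ∀ z ∈ bd v, z ∉ Sup S →
      Wd S z = 0 := by
    intro S hS hSR z hzB hzS
    obtain ⟨y, hy1, hy2⟩ := mem_closure_iff_nhds.1 (P.bd_closure hzB) _ (Wd_loc hS hzS)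
    rw [← hy1]; exact Wd_extr hS hSR hy2
  have hns : ∀ z ∈ K, z ≠ e ∧ z ≠ f := by
    intro z hz
    refine ⟨?_, ?_⟩
    · rintro rfl; exact (hKσ _ hz).1 (left_mem_segment _ _ _)
    · rintro rfl; exact (hKσ _ hz).2 (right_mem_segment _ _ _)
  have hA1 : ∀ z ∈ K, z ∈ A1 v k l e f → z ∉ Sup G2 := by
    intro z hz h1 h2
    rcases (hS2 z).1 h2 with h | h | h
    · rcases P.arcs_meet hkl hl he hf h1 h with h | h
      · exact (hns z hz).1 h
      · exact (hns z hz).2 h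
    · exact (hKσ z hz).1 h
    · exact (hKσ z hz).2 h
  have hA2 : ∀ z ∈ K, z ∈ A2 v n k l e f → z ∉ Sup G1 := by
    intro z hz h1 h2
    rcases (hS1 z).1 h2 with h | h | h
    · rcases P.arcs_meet hkl hl he hf h h1 with h | h
      · exact (hns z hz).1 h
      · exact (hns z hz).2 h
    · exact (hKσ z hz).1 h
    · exact (hKσ z hz).2 h
  have hop : ∀ {S : Multiset (Pt × Pt)}, Cyc S → IsOpen {z | z ∉ Sup S ∧ Wd S z = 0} := by
    intro S hS
    rw [isOpen_iff_mem_nhds]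
    rintro z ⟨h1, h2⟩
    filter_upwards [(Sup_closed S).isOpen_compl.mem_nhds h1, Wd_loc hS h1] with y hy1 hy2
    exact ⟨hy1, hy2.trans h2⟩
  have hxS : x ∈ {z | z ∉ Sup G2 ∧ Wd G2 z = 0} :=
    ⟨hA1 x hx hx1, hzero c2 hR2 x (P.A1_bd he hf hx1) (hA1 x hx hx1)⟩
  have hyS : y ∈ {z | z ∉ Sup G1 ∧ Wd G1 z = 0} :=
    ⟨hA2 y hy hy2, hzero c1 hR1 y (P.A2_bd he hf hy2) (hA2 y hy hy2)⟩
  have z2 : ∀ a b : ZMod 2, a + b = 1 → a = 0 ∨ b = 0 := by decide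
  obtain ⟨z, hz, ⟨h2, h2'⟩, ⟨h1, h1'⟩⟩ := hK _ _ (hop c2) (hop c1) (by
    intro z hz
    by_cases hzB : z ∈ bd v
    · rcases P.arcs_cover he hf hzB with h | h
      · exact Or.inl ⟨hA1 z hz h, hzero c2 hR2 z hzB (hA1 z hz h)⟩
      · exact Or.inr ⟨hA2 z hz h, hzero c1 hR1 z hzB (hA2 z hz h)⟩
    · have hp := P.par hzB (hKR hz)
      rw [← hsum] at hp
      have g1 : z ∉ Sup G1 := by
        intro h
        rcases (hS1 z).1 h with h | h | h
        · exact hzB (P.A1_bd he hf h)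
        · exact (hKσ z hz).1 h
        · exact (hKσ z hz).2 h
      have g2 : z ∉ Sup G2 := by
        intro h
        rcases (hS2 z).1 h with h | h | h
        · exact hzB (P.A2_bd he hf h)
        · exact (hKσ z hz).1 h
        · exact (hKσ z hz).2 h
      rcases z2 _ _ hp with h | h
      · exact Or.inr ⟨g1, h⟩
      · exact Or.inl ⟨g2, h⟩) ⟨x, hx, hxS⟩ ⟨y, hy, hyS⟩
  have hzB : z ∉ bd v := by
    intro h
    rcases P.arcs_cover he hf h with h | h
    · exact h1 ((hS1 z).2 (Or.inl h))
    · exact h2 ((hS2 z).2 (Or.inl h))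
  have hp := P.par hzB (hKR hz)
  rw [← hsum, h1', h2'] at hp
  exact absurd hp (by decide)

end PolyZ


open Topology Filter

/-- Reversed polygon. -/
def rv (N : ℕ) (v : ℤ → Pt) : ℤ → Pt := fun k => v (N - k)

/-- Base points. -/
def bs (v : ℤ → Pt) (N : ℕ) (t : ℝ) : Pt := v N + t • (v 0 - v N)

/-- Visibility. -/
def Se (v : ℤ → Pt) (p q : Pt) : Prop := segment ℝ p q ⊆ reg (bd v)

lemma Se_symm {v : ℤ → Pt} {p q : Pt} (h : Se v p q) : Se v q p := by
  unfold Se at *; rwa [segment_symm]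

lemma sg_rv (N : ℕ) (v : ℤ → Pt) (k : ℤ) : sg (rv N v) k = sg v (N - k - 1) := by
  unfold sg rv
  rw [segment_symm, show (N : ℤ) - (k + 1) = N - k - 1 by ring, show (N : ℤ) - k - 1 + 1 = N - k by ring]

lemma bd_rv (N : ℕ) (v : ℤ → Pt) : bd (rv N v) = bd v := by
  ext z
  constructor
  · rintro ⟨k, hk⟩; exact ⟨N - k - 1, by rwa [sg_rv] at hk⟩
  · rintro ⟨k, hk⟩; exact ⟨N - k - 1, by
      rw [sg_rv, show (N : ℤ) - (N - k - 1) - 1 = k by ring]; exact hk⟩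

lemma Se_rv {N : ℕ} {v : ℤ → Pt} {p q : Pt} : Se (rv N v) p q ↔ Se v p q := by
  unfold Se; rw [bd_rv]

lemma bs_rv (N : ℕ) (v : ℤ → Pt) (t : ℝ) : bs (rv N v) N t = bs v N (1 - t) := by
  unfold bs rv
  ext <;> simp <;> ring

lemma rv_nat {N : ℕ} {v : ℤ → Pt} {k : ℕ} (h : k ≤ N) : rv N v k = v ((N - k : ℕ) : ℤ) := by
  unfold rv; congr 1; omega

namespace PolyZ
variable {N : ℕ} {v : ℤ → Pt} (P : PolyZ (N + 1) v)
include P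

lemma rev : PolyZ (N + 1) (rv N v) where
  n3 := P.n3
  per k := by
    unfold rv
    rw [← P.per]; congr 1; push_cast; ring
  inj i j h := by
    have := P.inj _ _ h
    rw [← dvd_neg, show -(i - j) = (N : ℤ) - i - (N - j) by ring]; exact this
  cons k z h1 h2 := by
    rw [sg_rv] at h1 h2
    have := P.cons _ z h2 (by rw [show (N : ℤ) - (k + 1) - 1 + 1 = N - k - 1 by ring]; exact h1)
    rw [this]; unfold rv; congr 1; ring
  disj i j z h1 h2 h3 hi := by
    rw [sg_rv] at hi ⊢
    refine P.disj _ _ z ?_ ?_ ?_ hi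
    · intro h; apply h1
      rw [← dvd_neg, show -(i - j) = (N : ℤ) - i - 1 - (N - j - 1) by ring]; exact h
    · intro h; apply h3
      rw [← dvd_neg, show -(i - (j + 1)) = (N : ℤ) - i - 1 + 1 - (N - j - 1) by ring]; exact h
    · intro h; apply h2
      rw [← dvd_neg, show -(i + 1 - j) = (N : ℤ) - i - 1 - (N - j - 1 + 1) by ring]; exact h

lemma vN1 : v ((N : ℤ) + 1) = v 0 := by have := P.per 0; push_cast at this; rwa [zero_add] at this

lemma sgN : sg v N = segment ℝ (v N) (v 0) := by unfold sg; rw [P.vN1]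

lemma N2 : 2 ≤ N := by have := P.n3; omega

lemma base_ne : v N ≠ v 0 := by rw [← P.vN1]; exact P.ne_succ N

lemma D_ne : v 0 - v N ≠ 0 := sub_ne_zero.2 P.base_ne.symm

lemma bs_mem {t : ℝ} (h0 : 0 ≤ t) (h1 : t ≤ 1) : bs v N t ∈ sg v N := by
  rw [P.sgN]; exact mem_seg'.2 ⟨t, h0, h1, rfl⟩

lemma bs_omem {t : ℝ} (h0 : 0 < t) (h1 : t < 1) : bs v N t ∈ openSegment ℝ (v N) (v ((N : ℤ) + 1)) := by
  rw [P.vN1]; exact mem_oseg.2 ⟨t, h0, h1, rfl⟩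

omit P in
lemma bs_seg {t s u : ℝ} (h1 : s ≤ t) (h2 : t ≤ u) : bs v N t ∈ segment ℝ (bs v N s) (bs v N u) := by
  rcases h1.eq_or_lt with h | h
  · subst h; exact left_mem_segment _ _ _
  · have hd : u - s ≠ 0 := by intro h; linarith
    refine mem_seg'.2 ⟨(t - s) / (u - s), div_nonneg (by linarith) (by linarith),
      by rw [div_le_one (by linarith)]; linarith, ?_⟩
    have := div_mul_cancel₀ (t - s) hd
    generalize (t - s) / (u - s) = q at *
    unfold bs
    ext
    · simp; linear_combination (-1) * this * ((v 0).1 - (v N).1)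
    · simp; linear_combination (-1) * this * ((v 0).2 - (v N).2)

lemma bs_reg {t s : ℝ} (h0 : 0 ≤ t) (h1 : t ≤ 1) (h2 : 0 ≤ s) (h3 : s ≤ 1) :
    Se v (bs v N t) (bs v N s) := by
  intro z hz
  refine bd_reg ⟨N, ?_⟩
  rw [P.sgN]
  refine (convex_segment _ _).segment_subset ?_ ?_ hz
  · rw [← P.sgN]; exact P.bs_mem h0 h1
  · rw [← P.sgN]; exact P.bs_mem h2 h3

omit P in
lemma bs_0 : bs v N 0 = v N := by simp [bs]
omit P in
lemma bs_1 : bs v N 1 = v 0 := by simp [bs]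

omit P in
lemma bs_v {q : Pt} (h : q ∈ segment ℝ (v N) (v 0)) : ∃ t : ℝ, 0 ≤ t ∧ t ≤ 1 ∧ q = bs v N t := by
  exact mem_seg'.1 h

/-- The height function over the base line. -/
noncomputable def ht (v : ℤ → Pt) (N : ℕ) (p : Pt) : ℝ := cr (v 0 - v N) (p - v N)

omit P in
lemma ht_line (p q : Pt) (t : ℝ) : ht v N (p + t • (q - p)) = (1 - t) * ht v N p + t * ht v N q := by
  simp only [ht, cr, Prod.fst_add, Prod.snd_add, Prod.fst_sub, Prod.snd_sub, Prod.smul_fst,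
    Prod.smul_snd, smul_eq_mul]; ring

omit P in
lemma ht_bs (t : ℝ) : ht v N (bs v N t) = 0 := by
  simp only [ht, bs, cr, Prod.fst_add, Prod.snd_add, Prod.fst_sub, Prod.snd_sub, Prod.smul_fst,
    Prod.smul_snd, smul_eq_mul]; ring

lemma ht_sgN {z : Pt} (h : z ∈ sg v N) : ht v N z = 0 := by
  rw [P.sgN] at h; exact seg_cr h

omit P in
lemma cr_bs (p : Pt) (c t : ℝ) : cr (bs v N c - p) (bs v N t - p) = (t - c) * ht v N p := by
  simp only [ht, bs, cr, Prod.fst_add, Prod.snd_add, Prod.fst_sub, Prod.snd_sub, Prod.smul_fst,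
    Prod.smul_snd, smul_eq_mul]; ring

omit P in
lemma Se_sub {p q r s : Pt} (h : Se v p q) (hr : r ∈ segment ℝ p q) (hs : s ∈ segment ℝ p q) :
    Se v r s := ((convex_segment p q).segment_subset hr hs).trans h

/-- A point seeing the base but not its endpoints is off the base line. -/
lemma ht_ne {p : Pt} {t : ℝ} (h0 : 0 ≤ t) (h1 : t ≤ 1) (hs : Se v p (bs v N t))
    (hp0 : ¬ Se v p (v 0)) (hpN : ¬ Se v p (v N)) : ht v N p ≠ 0 := by
  intro hp
  have hD := P.D_ne
  -- p = bs u
  obtain ⟨u, rfl⟩ : ∃ u, p = bs v N u := by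
    have hcr : (v 0 - v N).1 * (p - v N).2 = (v 0 - v N).2 * (p - v N).1 := by
      unfold ht cr at hp; linarith
    by_cases h : (v 0 - v N).1 = 0
    · have h' : (v 0 - v N).2 ≠ 0 := by
        intro h2; exact hD (Prod.ext h h2)
      refine ⟨(p - v N).2 / (v 0 - v N).2, ?_⟩
      unfold bs
      have hp1 : (p - v N).1 = 0 := by
        rw [h, zero_mul] at hcr
        exact (mul_eq_zero.1 hcr.symm).resolve_left h'
      ext
      · have : p.1 - (v N).1 = 0 := hp1
        rw [Prod.fst_add, Prod.smul_fst, h]; simp; linarith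
      · rw [Prod.snd_add, Prod.smul_snd, smul_eq_mul, div_mul_cancel₀ _ h']; simp
    · refine ⟨(p - v N).1 / (v 0 - v N).1, ?_⟩
      unfold bs
      ext
      · rw [Prod.fst_add, Prod.smul_fst, smul_eq_mul, div_mul_cancel₀ _ h]; simp
      · rw [Prod.snd_add, Prod.smul_snd, smul_eq_mul, div_mul_eq_mul_div, mul_comm, ← hcr,
          mul_div_cancel_left₀ _ h]; simp
  rcases lt_or_ge u t with hu | hu
  · rcases lt_or_ge u 0 with hu0 | hu0
    · apply hpN
      refine Se_sub hs (left_mem_segment _ _ _) ?_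
      rw [← bs_0 (v := v)]; exact bs_seg hu0.le h0
    · apply hp0
      rw [← bs_1 (v := v) (N := N)]; exact P.bs_reg hu0 (by linarith) (by norm_num) le_rfl
  · rcases le_or_gt u 1 with hu0 | hu0
    · apply hp0
      rw [← bs_1 (v := v) (N := N)]; exact P.bs_reg (by linarith) hu0 (by norm_num) le_rfl
    · apply hp0
      refine Se_sub hs (left_mem_segment _ _ _) ?_
      rw [segment_symm]
      rw [← bs_1 (v := v) (N := N)]; exact bs_seg h1 hu0.le

/-- The set of base parameters seen is compact. -/
lemma I_compact (p : Pt) : IsCompact {t : ℝ | 0 ≤ t ∧ t ≤ 1 ∧ Se v p (bs v N t)} := by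
  have : {t : ℝ | 0 ≤ t ∧ t ≤ 1 ∧ Se v p (bs v N t)} = Set.Icc 0 1 ∩
      ⋂ s ∈ Set.Icc (0:ℝ) 1, (fun t => p + s • (bs v N t - p)) ⁻¹' reg (bd v) := by
    ext t
    simp only [Set.mem_ofPred_eq, Set.mem_inter_iff, Set.mem_Icc, Set.mem_iInter, Set.mem_preimage]
    constructor
    · rintro ⟨h0, h1, h⟩
      exact ⟨⟨h0, h1⟩, fun s hs => h (mem_seg'.2 ⟨s, hs.1, hs.2, rfl⟩)⟩
    · rintro ⟨⟨h0, h1⟩, h⟩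
      refine ⟨h0, h1, ?_⟩
      intro z hz
      obtain ⟨s, s0, s1, rfl⟩ := mem_seg'.1 hz
      exact h s ⟨s0, s1⟩
  rw [this]
  refine isCompact_Icc.inter_right ?_
  refine isClosed_biInter fun s _ => (reg_closed P.bd_closed).preimage ?_
  unfold bs; fun_prop

/-- Extension of a visibility ray to the boundary. -/
lemma extend {p b : Pt} (hpb : p ≠ b) (hp : p ∈ reg (bd v)) : ∃ σ : ℝ, 0 ≤ σ ∧
    p + σ • (p - b) ∈ bd v ∧ Se v p (p + σ • (p - b)) := by
  obtain ⟨M, hM⟩ := P.bd_compact.isBounded.exists_norm_le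
  have h0 : 0 ≤ M := (norm_nonneg _).trans (hM (v 0) ⟨0, left_mem_segment _ _ _⟩)
  have hn : 0 < ‖p - b‖ := norm_pos_iff.2 (sub_ne_zero.2 hpb)
  set T := (M + 1 + ‖p‖) / ‖p - b‖ with hT
  have hT0 : 0 ≤ T := by positivity
  have hTn : T * ‖p - b‖ = M + 1 + ‖p‖ := div_mul_cancel₀ _ hn.ne'
  have hfar : p + T • (p - b) ∉ reg (bd v) := by
    rw [not_reg]
    refine extr_far hM h0 ?_
    have h1 : ‖T • (p - b)‖ ≤ ‖p + T • (p - b)‖ + ‖p‖ := by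
      have := norm_sub_le (p + T • (p - b)) p
      simpa using this
    rw [norm_smul, Real.norm_eq_abs, abs_of_nonneg hT0, hTn] at h1
    linarith
  obtain ⟨s, s0, s1, hs, hsB, -⟩ := exit_pt P.bd_closed hp hfar
  have e : ∀ u : ℝ, p + u • (p + T • (p - b) - p) = p + (u * T) • (p - b) := by
    intro u; rw [add_sub_cancel_left, smul_smul]
  refine ⟨s * T, by positivity, by rw [← e]; exact hsB, ?_⟩
  intro z hz
  rw [← e] at hz
  obtain ⟨u, u0, u1, rfl⟩ := mem_seg'.1 hz
  have := hs (u * s) (by positivity) (by nlinarith)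
  rw [add_sub_cancel_left, smul_smul]
  exact this

end PolyZ


open Topology Filter

lemma par_exists {u y : Pt} (hu : u ≠ 0) (h : cr u y = 0) : ∃ γ : ℝ, y = γ • u := by
  have hcr : u.1 * y.2 = u.2 * y.1 := by unfold cr at h; linarith
  by_cases h1 : u.1 = 0
  · have h' : u.2 ≠ 0 := fun h2 => hu (Prod.ext h1 h2)
    have hy : y.1 = 0 := by
      rw [h1, zero_mul] at hcr
      exact (mul_eq_zero.1 hcr.symm).resolve_left h'
    refine ⟨y.2 / u.2, Prod.ext ?_ ?_⟩
    · rw [Prod.smul_fst, h1, hy]; simp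
    · rw [Prod.smul_snd, smul_eq_mul, div_mul_cancel₀ _ h']
  · refine ⟨y.1 / u.1, Prod.ext ?_ ?_⟩
    · rw [Prod.smul_fst, smul_eq_mul, div_mul_cancel₀ _ h1]
    · rw [Prod.smul_snd, smul_eq_mul, div_mul_eq_mul_div, mul_comm, ← hcr,
        mul_div_cancel_left₀ _ h1]

lemma cr_smul_left (γ : ℝ) (u y : Pt) : cr (γ • u) y = γ * cr u y := by
  simp only [cr, Prod.smul_fst, Prod.smul_snd, smul_eq_mul]; ring

lemma cr_smul_right (γ : ℝ) (u y : Pt) : cr u (γ • y) = γ * cr u y := by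
  simp only [cr, Prod.smul_fst, Prod.smul_snd, smul_eq_mul]; ring

lemma cr_self (u : Pt) : cr u u = 0 := by unfold cr; ring

lemma cr_swap (u w : Pt) : cr u w = - cr w u := by unfold cr; ring

lemma par_par {w x y : Pt} (hw : w ≠ 0) (hx : cr w x = 0) (hy : cr w y = 0) : cr x y = 0 := by
  obtain ⟨γ, rfl⟩ := par_exists hw hx
  rw [cr_smul_left, hy, mul_zero]

lemma seg_closed (a b : Pt) : IsClosed (segment ℝ a b) := by
  rw [segment_eq_image']
  exact (isCompact_Icc.image (by fun_prop)).isClosed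

namespace PolyZ
variable {N : ℕ} {v : ℤ → Pt}

lemma bs_cont : Continuous (bs v N) := by unfold bs; fun_prop

lemma tube {p : Pt} {tb : ℝ} {C : Set Pt} (hC : IsClosed C)
    (h : ∀ z ∈ segment ℝ p (bs v N tb), z ∉ C) :
    ∀ᶠ t in 𝓝 tb, ∀ z ∈ segment ℝ p (bs v N t), z ∉ C := by
  have hb := bs_cont (v := v) (N := N)
  have key : ∀ᶠ t in 𝓝 tb, ∀ s ∈ Set.Icc (0:ℝ) 1, p + s • (bs v N t - p) ∉ C := by
    refine isCompact_Icc.eventually_forall_of_forall_eventually fun s hs => ?_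
    have hcont : Continuous fun q : ℝ × ℝ => p + q.2 • (bs v N q.1 - p) := by fun_prop
    exact (hcont.isOpen_preimage _ hC.isOpen_compl).mem_nhds
      (h _ (mem_seg'.2 ⟨s, hs.1, hs.2, rfl⟩))
  filter_upwards [key] with t ht z hz
  obtain ⟨s, s0, s1, rfl⟩ := mem_seg'.1 hz
  exact ht s ⟨s0, s1⟩

lemma piece_p {p : Pt} {tb : ℝ} {c d : Pt} (hp : p ∈ segment ℝ c d) (hht : ht v N p ≠ 0) :
    ∀ᶠ t in 𝓝[<] tb, ∀ z ∈ segment ℝ p (bs v N t), z ∈ segment ℝ c d → z = p := by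
  by_cases hcd : c = d
  · subst hcd
    refine Eventually.of_forall fun t z _ hz => ?_
    simp at hz hp; rw [hz, hp]
  have hw : d - c ≠ 0 := sub_ne_zero.2 (Ne.symm hcd)
  have haff : ∀ t, cr (d - c) (bs v N t - p) = cr (d - c) (bs v N tb - p) +
      (t - tb) * cr (d - c) (v 0 - v N) := by
    intro t
    simp only [bs, cr, Prod.fst_add, Prod.snd_add, Prod.fst_sub, Prod.snd_sub, Prod.smul_fst,
      Prod.smul_snd, smul_eq_mul]; ring
  have hne : ∀ᶠ t in 𝓝[<] tb, cr (d - c) (bs v N t - p) ≠ 0 := by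
    by_cases h : cr (d - c) (bs v N tb - p) = 0
    · have h2 : cr (d - c) (v 0 - v N) ≠ 0 := by
        intro h2
        have h3 := par_par hw h2 h
        apply hht
        have h4 : ht v N p = - cr (v 0 - v N) (bs v N tb - p) := by
          simp only [ht, bs, cr, Prod.fst_add, Prod.snd_add, Prod.fst_sub, Prod.snd_sub,
            Prod.smul_fst, Prod.smul_snd, smul_eq_mul]; ring
        rw [h4, h3, neg_zero]
      filter_upwards [self_mem_nhdsWithin] with t ht
      rw [haff, h, zero_add]
      exact mul_ne_zero (sub_ne_zero.2 (ne_of_lt ht)) h2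
    · apply nhdsWithin_le_nhds
      have hcont : Continuous fun t : ℝ => cr (d - c) (bs v N tb - p) +
          (t - tb) * cr (d - c) (v 0 - v N) := by fun_prop
      have := hcont.continuousAt.eventually_ne (x := tb) (y := 0) (by simpa using h)
      filter_upwards [this] with t ht
      rw [haff]; exact ht
  filter_upwards [hne] with t ht z hz hzc
  obtain ⟨s, s0, s1, rfl⟩ := mem_seg'.1 hz
  have e1 := seg_cr hzc
  have e2 := seg_cr hp
  have e3 : cr (d - c) (p + s • (bs v N t - p) - c) = cr (d - c) (p - c) +
      s * cr (d - c) (bs v N t - p) := by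
    rw [← cr_add_smul]; congr 1; abel
  rw [e1, e2, zero_add] at e3
  have : s = 0 := (mul_eq_zero.1 e3.symm).resolve_right ht
  simp [this]

lemma piece_t {p : Pt} {tb : ℝ} {c d : Pt} (hht : ht v N p ≠ 0)
    (ho : ∀ z ∈ openSegment ℝ p (bs v N tb), z ∉ segment ℝ c d) (hb : bs v N tb ∉ segment ℝ c d) :
    ∀ᶠ t in 𝓝[<] tb, ∀ z ∈ segment ℝ p (bs v N t), z ∈ segment ℝ c d → z = p := by
  by_cases hp : p ∈ segment ℝ c d
  · exact piece_p hp hht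
  · have : ∀ᶠ t in 𝓝 tb, ∀ z ∈ segment ℝ p (bs v N t), z ∉ segment ℝ c d := by
      refine tube (seg_closed c d) fun z hz => ?_
      rcases seg_cases hz with rfl | rfl | h
      · exact hp
      · exact hb
      · exact ho z h
    filter_upwards [nhdsWithin_le_nhds this] with t ht z hz hz'
    exact absurd hz' (ht z hz)

variable (P : PolyZ (N + 1) v)
include P

lemma b_notin {t : ℝ} (h0 : 0 < t) (h1 : t < 1) {i : ℕ} (hi : i < N) : bs v N t ∉ sg v i := by
  intro h
  have := P.oseg_uniq (P.bs_omem h0 h1) h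
  have := Int.le_of_dvd (by omega) this
  push_cast at this; omega

lemma piece_miss {p b c d : Pt} {i : ℕ} (hpb : Se v p b) (hne : p ≠ b)
    (hb : b ∉ segment ℝ c d)
    (hcd : openSegment ℝ c d ⊆ openSegment ℝ (v i) (v ((i : ℤ) + 1)))
    (hcs : c ∈ sg v i) (hc : c ∉ openSegment ℝ p b) (hd : d ∉ openSegment ℝ p b) :
    ∀ z ∈ openSegment ℝ p b, z ∉ segment ℝ c d := by
  intro z hz hz'
  rcases seg_cases hz' with rfl | rfl | ho
  · exact hc hz
  · exact hd hz
  have htr := P.trans hpb hz (hcd ho)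
  have hw : v ((i : ℤ) + 1) - v i ≠ 0 := sub_ne_zero.2 (P.ne_succ i).symm
  have h1 := seg_cr (openSegment_subset_segment _ _ _ (hcd ho))
  have h2 := seg_cr hcs
  have hu : b - p ≠ 0 := sub_ne_zero.2 hne.symm
  have hcz : cr (v ((i : ℤ) + 1) - v i) (c - z) = 0 := by
    have : cr (v ((i : ℤ) + 1) - v i) (c - z) = cr (v ((i : ℤ) + 1) - v i) (c - v i) -
      cr (v ((i : ℤ) + 1) - v i) (z - v i) := by
      simp only [cr, Prod.fst_sub, Prod.snd_sub]; ring
    rw [this, h1, h2, sub_zero]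
  obtain ⟨γ, hγ⟩ := par_exists hu (par_par hw htr hcz)
  obtain ⟨τ, τ0, τ1, hτ⟩ := mem_oseg.1 ho
  obtain ⟨s, s0, s1, hs⟩ := mem_oseg.1 hz
  -- d
  have hc' : c = p + (s + γ) • (b - p) := by
    have : c = z + γ • (b - p) := by rw [← hγ]; abel
    rw [this, hs]; module
  have hd' : d = p + (s + γ - γ / τ) • (b - p) := by
    have h5 : τ • (d - c) = -(γ • (b - p)) := by
      rw [← hγ, hτ]; module
    have : d = c + τ⁻¹ • (τ • (d - c)) := by
      rw [smul_smul, inv_mul_cancel₀ τ0.ne', one_smul]; abel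
    rw [this, h5, hc', div_eq_mul_inv]; module
  have hc2 : ¬ (0 < s + γ ∧ s + γ < 1) := fun h => hc (mem_oseg.2 ⟨_, h.1, h.2, hc'⟩)
  have hd2 : ¬ (0 < s + γ - γ / τ ∧ s + γ - γ / τ < 1) := fun h => hd (mem_oseg.2 ⟨_, h.1, h.2, hd'⟩)
  have hg : γ / τ * τ = γ := div_mul_cancel₀ _ τ0.ne'
  generalize γ / τ = q at *
  have hq0 : q ≠ 0 := by
    rintro rfl
    rw [zero_mul] at hg
    apply hc2
    rw [← hg]; constructor <;> linarith
  apply hb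
  refine mem_seg'.2 ⟨(s + γ - 1) / q, ?_, ?_, ?_⟩
  · rcases lt_or_gt_of_ne hq0 with h | h
    · apply div_nonneg_of_nonpos _ h.le
      have : γ < 0 := by nlinarith
      linarith
    · apply div_nonneg _ h.le
      have : 0 < γ := by nlinarith
      by_contra hcon
      exact hc2 ⟨by linarith, by linarith⟩
  · rcases lt_or_gt_of_ne hq0 with h | h
    · rw [div_le_one_of_neg h]
      have : q < γ := by nlinarith
      by_contra hcon
      exact hd2 ⟨by linarith, by linarith⟩
    · rw [div_le_one h]
      have : γ < q := by nlinarith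
      linarith
  · have e : d - c = (-q) • (b - p) := by rw [hd', hc']; module
    rw [e, hc', smul_smul, mul_neg, div_mul_cancel₀ _ hq0]
    module

end PolyZ


open Topology Filter

namespace PolyZ
variable {N : ℕ} {v : ℤ → Pt} (P : PolyZ (N + 1) v)
include P

/-- Points near an interior base point on the side of `p` lie in the region. -/
lemma near_base {p : Pt} {tb : ℝ} (h0 : 0 < tb) (h1 : tb < 1) (hs : Se v p (bs v N tb)) :
    ∃ ε > 0, ∀ z ∈ Metric.ball (bs v N tb) ε, 0 < ht v N z * ht v N p →
      z ∈ reg (bd v) := by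
  obtain ⟨ε, hε, h⟩ := P.side (P.bs_omem h0 h1)
  refine ⟨ε, hε, fun z hz hzp => ?_⟩
  rw [P.vN1] at h
  by_contra hcon
  have h2 := (tend_zero (bs v N tb) (p - bs v N tb)).eventually (Metric.ball_mem_nhds _ hε)
  obtain ⟨u, hu, hu0, hu1⟩ := (h2.and (ev_Ioi.and (ev_Ioi_lt one_pos))).exists
  have hin : bs v N tb + u • (p - bs v N tb) ∈ reg (bd v) := by
    apply Se_symm hs
    exact mem_seg'.2 ⟨u, hu0.le, hu1.le, rfl⟩
  refine hin (h z hz _ hu ?_ (not_reg.1 hcon))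
  have : cr (v 0 - v N) (bs v N tb + u • (p - bs v N tb) - v N) = u * ht v N p := by
    have := ht_line (v := v) (N := N) (bs v N tb) p u
    rw [ht_bs, mul_zero, zero_add] at this
    exact this
  rw [this]
  have e : cr (v 0 - v N) (z - v N) = ht v N z := rfl
  rw [e]
  have := mul_pos hu0 hzp
  linarith

/-- The obstruction to rotating the visibility segment. -/
lemma rot {p : Pt} {tb : ℝ} (h0 : 0 < tb) (h1 : tb < 1) (hs : Se v p (bs v N tb))
    (hmin : ∀ t, 0 ≤ t → t ≤ 1 → Se v p (bs v N t) → tb ≤ t) (hht : ht v N p ≠ 0) {σ : ℝ}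
    (hσ : 0 ≤ σ) {e : Pt} (he : e = p + σ • (p - bs v N tb)) {k : ℕ} (hk : k < N)
    (hek : e ∈ sg v k) (hpe : Se v p e) :
    ∃ g : ℕ, k < g ∧ g ≤ N ∧ v g ∈ openSegment ℝ p (bs v N tb) := by
  by_contra! hno
  have hpb : p ≠ bs v N tb := by
    intro h; apply hht; rw [h, ht_bs]
  have hpR : p ∈ reg (bd v) := hs (left_mem_segment _ _ _)
  have hbR : bs v N tb ∈ reg (bd v) := hs (right_mem_segment _ _ _)
  have hu0 : bs v N tb - p ≠ 0 := sub_ne_zero.2 hpb.symm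
  have eo : e ∉ openSegment ℝ p (bs v N tb) := by
    intro h
    obtain ⟨s, s0, s1, hs'⟩ := mem_oseg.1 h
    have : (s + σ) • (bs v N tb - p) = 0 := by
      have : s • (bs v N tb - p) = σ • (p - bs v N tb) := by
        have := he.symm.trans hs'
        exact (add_left_cancel this).symm
      rw [add_smul, this]; module
    rcases smul_eq_zero.1 this with h | h
    · linarith
    · exact hu0 h
  -- the pieces
  have hek' : segment ℝ e (v ((k : ℤ) + 1)) ⊆ sg v k := seg_sub' hek
  have t1 : ∀ᶠ t in 𝓝[<] tb, ∀ z ∈ segment ℝ p (bs v N t),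
      z ∈ segment ℝ e (v ((k : ℤ) + 1)) → z = p := by
    have hb' : bs v N tb ∉ segment ℝ e (v ((k : ℤ) + 1)) := fun h => P.b_notin h0 h1 hk (hek' h)
    have hg := hno (k + 1) (by omega) (by omega)
    push_cast at hg
    refine piece_t hht ?_ hb'
    by_cases hee : e = v ((k : ℤ) + 1)
    · intro z hz hz'
      rw [hee, segment_same] at hz'
      rw [hz'] at hz; exact hg hz
    refine P.piece_miss (i := k) hs hpb hb' ?_ hek eo hg
    intro z hz
    obtain ⟨τ, τ0, τ1, hτ⟩ := mem_oseg.1 hz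
    obtain ⟨a, a0, a1, ha⟩ := mem_seg'.1 hek
    have a1' : a < 1 := by
      rcases a1.eq_or_lt with h | h
      · exact absurd (by rw [ha, h]; module) hee
      · exact h
    refine mem_oseg.2 ⟨a + τ * (1 - a), by nlinarith, by nlinarith, ?_⟩
    rw [hτ, ha]; module
  have t2 : ∀ᶠ t in 𝓝[<] tb, ∀ i ∈ Finset.Ioo k N, ∀ z ∈ segment ℝ p (bs v N t),
      z ∈ sg v (i : ℤ) → z = p := by
    rw [Filter.eventually_all_finset]
    intro i hi
    rw [Finset.mem_Ioo] at hi
    have hg := hno i hi.1 hi.2.le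
    have hg' := hno (i + 1) (by omega) (by omega)
    push_cast at hg'
    have hb' : bs v N tb ∉ segment ℝ (v i) (v ((i : ℤ) + 1)) := P.b_notin h0 h1 hi.2
    exact piece_t hht (P.piece_miss hs hpb hb' subset_rfl (left_mem_segment _ _ _) hg hg') hb'
  obtain ⟨ε, hε, hnear⟩ := P.near_base h0 h1 hs
  have t3 : ∀ᶠ t in 𝓝[<] tb, bs v N t ∈ Metric.ball (bs v N tb) ε :=
    nhdsWithin_le_nhds (bs_cont.continuousAt.eventually (Metric.ball_mem_nhds _ hε))
  have t4 : ∀ᶠ t in 𝓝[<] tb, 0 < t := nhdsWithin_le_nhds (lt_mem_nhds h0)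
  have t5 : ∀ᶠ t in 𝓝[<] tb, t < tb := self_mem_nhdsWithin
  obtain ⟨t, ht1, ht2, ht3, ht4, ht5⟩ := (t1.and (t2.and (t3.and (t4.and t5)))).exists
  have hnot : ¬ Se v p (bs v N t) := fun h => not_le.2 ht5 (hmin t ht4.le (by linarith) h)
  set x := bs v N t with hx
  have hxR : x ∈ reg (bd v) := bd_reg ⟨N, P.bs_mem ht4.le (by linarith)⟩
  obtain ⟨y, hyS, hyR⟩ := Set.not_subset.1 hnot
  rw [segment_symm] at hyS
  obtain ⟨τ, τ0, τ1, hy⟩ := mem_seg'.1 hyS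
  have τ1' : τ < 1 := by
    rcases τ1.eq_or_lt with h | h
    · exfalso; apply hyR; rw [hy, h, one_smul, add_sub_cancel]; exact hpR
    · exact h
  have τ0' : 0 < τ := by
    rcases τ0.eq_or_lt with h | h
    · exfalso; apply hyR; rw [hy, ← h, zero_smul, add_zero]; exact hxR
    · exact h
  obtain ⟨s, s0, s1, hsR, hsB, hsN⟩ := exit_pt P.bd_closed hxR hyR
  have hyx : ∀ u : ℝ, x + u • (y - x) = x + (u * τ) • (p - x) := by
    intro u; rw [hy, add_sub_cancel_left, smul_smul]
  have hcr : ∀ w : ℝ, w < 1 → cr (bs v N tb - p) (x + w • (p - x) - p) ≠ 0 := by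
    intro w hw
    have : x + w • (p - x) - p = (1 - w) • (x - p) := by module
    rw [this, cr_smul_right, hx, cr_bs]
    refine mul_ne_zero (by linarith) (mul_ne_zero (by linarith) hht)
  set m := x + s • (y - x) with hm
  have hmm : m = x + (s * τ) • (p - x) := hyx s
  have hsτ : s * τ < 1 := by nlinarith
  have hmp : m ≠ p := by
    intro h
    apply hcr (s * τ) hsτ
    rw [← hmm, h, sub_self]; simp [cr]
  have hmS : m ∈ segment ℝ p x := by
    rw [segment_symm]; exact mem_seg'.2 ⟨s * τ, by positivity, hsτ.le, hmm⟩
  have hK : ∀ z ∈ segment ℝ x m, ∃ u, 0 ≤ u ∧ u ≤ s ∧ z = x + u • (y - x) := by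
    intro z hz
    obtain ⟨a, a0, a1, ha⟩ := mem_seg'.1 hz
    refine ⟨a * s, by positivity, by nlinarith, ?_⟩
    rw [ha, hm, add_sub_cancel_left, smul_smul]
  have hmA : m ∈ A1 v k N e (bs v N tb) := by
    rcases P.arcs_cover hek (P.bs_mem h0.le h1.le) hsB with h | h
    · exact h
    exfalso
    refine P.sep hk (by omega) hek (P.bs_mem h0.le h1.le) (Se_symm hpe) hs
      (convex_segment x m).isPreconnected ?_ ?_ (left_mem_segment ℝ x m) (right_mem_segment ℝ x m) ?_ h
    · intro z hz
      obtain ⟨u, u0, u1, rfl⟩ := hK z hz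
      exact hsR u u0 u1
    · intro z hz
      obtain ⟨u, u0, u1, rfl⟩ := hK z hz
      have hc := hcr (u * τ) (by nlinarith)
      rw [← hyx] at hc
      constructor
      · intro h
        apply hc
        rw [segment_symm] at h
        obtain ⟨q, -, -, hq⟩ := mem_seg'.1 h
        have : x + u • (y - x) - p = (-(q * σ)) • (bs v N tb - p) := by rw [hq, he]; module
        rw [this, cr_smul_right, cr_self, mul_zero]
      · intro h
        exact hc (seg_cr h)
    · refine Or.inr (Or.inl ?_)
      rw [← bs_0 (v := v) (N := N)]
      exact bs_seg ht4.le ht5.le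
  rcases hmA with h | h | ⟨i, hi1, hi2, h⟩
  · exact hmp (ht1 m hmS h)
  · have hm0 : ht v N m = 0 := by
      apply P.ht_sgN
      exact seg_sub (P.bs_mem h0.le h1.le) h
    rw [hmm, ht_line, hx, ht_bs, mul_zero, zero_add] at hm0
    have hs0 : s = 0 := by
      rcases mul_eq_zero.1 hm0 with h | h
      · exact (mul_eq_zero.1 h).resolve_right τ0'.ne'
      · exact absurd h hht
    have hcont : Continuous fun u : ℝ => x + u • (y - x) := by fun_prop
    have : ∀ᶠ u in 𝓝 (0:ℝ), x + u • (y - x) ∈ Metric.ball (bs v N tb) ε :=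
      hcont.continuousAt.eventually (Metric.isOpen_ball.mem_nhds (by simpa using ht3))
    obtain ⟨δ, hδ, hball⟩ := Metric.eventually_nhds_iff_ball.1 this
    obtain ⟨u, hu0, hu1, -, huE⟩ := hsN δ hδ
    rw [hs0] at hu0
    rw [hs0, zero_add] at hu1
    refine hnear _ (hball u (by rw [Metric.mem_ball, Real.dist_eq, sub_zero, abs_of_pos hu0]; exact hu1)) ?_ huE
    rw [hyx, ht_line, hx, ht_bs, mul_zero, zero_add]
    have : 0 < ht v N p * ht v N p := mul_self_pos.2 hht
    have := mul_pos (mul_pos hu0 τ0') this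
    linarith
  · exact hmp (ht2 i (Finset.mem_Ioo.2 ⟨hi1, hi2⟩) m hmS h)

end PolyZ


open Topology Filter

namespace PolyZ
variable {N : ℕ} {v : ℤ → Pt} (P : PolyZ (N + 1) v)
include P

lemma v_bd (k : ℤ) : v k ∈ bd v := ⟨k, left_mem_segment _ _ _⟩

omit P in
lemma path_conn (a b c : Pt) : IsPreconnected (segment ℝ a b ∪ segment ℝ b c) :=
  (convex_segment a b).isPreconnected.union b (right_mem_segment _ _ _) (left_mem_segment _ _ _)
    (convex_segment b c).isPreconnected

/-- The extremal visible vertex. -/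
lemma rot_max {p : Pt} {tb : ℝ} (h0 : 0 < tb) (h1 : tb < 1) (hs : Se v p (bs v N tb))
    (hmin : ∀ t, 0 ≤ t → t ≤ 1 → Se v p (bs v N t) → tb ≤ t) (hht : ht v N p ≠ 0)
    (hpN : ¬ Se v p (v N)) {σ : ℝ}
    (hσ : 0 ≤ σ) {e : Pt} (he : e = p + σ • (p - bs v N tb)) {k : ℕ} (hk : k < N)
    (hek : e ∈ sg v k) (hpe : Se v p e) :
    ∃ r : ℕ, k < r ∧ r < N ∧ v r ∈ openSegment ℝ p (bs v N tb) ∧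
      ∀ w : ℕ, w < N → Se v p (v w) → w ≤ r := by
  classical
  obtain ⟨g0, hg1, hg2, hg3⟩ := P.rot h0 h1 hs hmin hht hσ he hk hek hpe
  have hlt : ∀ g : ℕ, g ≤ N → v g ∈ openSegment ℝ p (bs v N tb) → g < N := by
    intro g hg hgo
    rcases hg.eq_or_lt with h | h
    · subst h
      exact absurd (Se_sub hs (left_mem_segment _ _ _) (openSegment_subset_segment _ _ _ hgo)) hpN
    · exact h
  set F := (Finset.range N).filter fun g : ℕ => v g ∈ openSegment ℝ p (bs v N tb) with hF
  have hne : F.Nonempty := ⟨g0, by simp [hF, hlt g0 hg2 hg3, hg3]⟩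
  set r := F.max' hne with hr
  have hrF : r ∈ F := F.max'_mem hne
  have hrmax : ∀ g ∈ F, g ≤ r := fun g hg => F.le_max' g hg
  rw [hF, Finset.mem_filter, Finset.mem_range] at hrF
  obtain ⟨hrN, hro⟩ := hrF
  have hkr : k < r := lt_of_lt_of_le hg1 (hrmax g0 (by simp [hF, hlt g0 hg2 hg3, hg3]))
  refine ⟨r, hkr, hrN, hro, fun w hw hpw => ?_⟩
  by_contra! hrw
  have hpb : p ≠ bs v N tb := by
    intro h; apply hht; rw [h, ht_bs]
  have hu0 : bs v N tb - p ≠ 0 := sub_ne_zero.2 hpb.symm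
  obtain ⟨ρ, ρ0, ρ1, hρ⟩ := mem_oseg.1 hro
  have hsσ : ∀ z ∈ segment ℝ (v r) (bs v N tb), ∃ q, ρ ≤ q ∧ q ≤ 1 ∧ z = p + q • (bs v N tb - p) := by
    intro z hz
    obtain ⟨q, q0, q1, rfl⟩ := mem_seg'.1 hz
    refine ⟨ρ + q * (1 - ρ), by nlinarith, by nlinarith, ?_⟩
    rw [hρ]; module
  have hrb : Se v (v r) (bs v N tb) :=
    Se_sub hs (openSegment_subset_segment _ _ _ hro) (right_mem_segment _ _ _)
  refine P.sep (k := r) (l := N) hrN (by omega) (e := v r) (f := bs v N tb) (m := bs v N tb)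
    (left_mem_segment _ _ _) (P.bs_mem h0.le h1.le) hrb
    (by rw [segment_same]; rintro z rfl; exact hs (right_mem_segment _ _ _))
    (path_conn (v w) p e) ?_ ?_ (Or.inl (left_mem_segment _ _ _)) (Or.inr (right_mem_segment _ _ _))
    (Or.inr (Or.inr ⟨w, hrw, hw, left_mem_segment _ _ _⟩))
    (Or.inr (Or.inr ⟨k, Or.inr hkr, hek⟩))
  · rintro z (hz | hz)
    · exact Se_symm hpw hz
    · exact hpe hz
  · intro z hz
    have key : z ∉ segment ℝ (v r) (bs v N tb) := by
      intro hzs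
      obtain ⟨q, q0, q1, hq⟩ := hsσ z hzs
      rcases hz with hz | hz
      · rw [segment_symm] at hz
        obtain ⟨a, a0, a1, ha⟩ := mem_seg'.1 hz
        have hq' : a • (v w - p) = q • (bs v N tb - p) := by
          have := ha.symm.trans hq
          exact add_left_cancel this
        have ha0 : 0 < a := by
          rcases a0.eq_or_lt with h | h
          · rw [← h, zero_smul] at hq'
            rcases smul_eq_zero.1 hq'.symm with h | h
            · linarith
            · exact absurd h hu0
          · exact h
        have hw' : v w = p + (q / a) • (bs v N tb - p) := by
          rw [div_eq_inv_mul, ← smul_smul, ← hq', smul_smul, inv_mul_cancel₀ ha0.ne', one_smul]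
          abel
        have hqa : 0 < q / a := div_pos (by linarith) ha0
        rcases lt_trichotomy (q / a) 1 with h | h | h
        · have : w ∈ F := by
            rw [hF, Finset.mem_filter, Finset.mem_range]
            exact ⟨hw, mem_oseg.2 ⟨_, hqa, h, hw'⟩⟩
          exact absurd (hrmax w this) (by omega)
        · rw [h, one_smul, add_sub_cancel] at hw'
          exact P.b_notin h0 h1 hw (hw' ▸ left_mem_segment _ _ _)
        · -- beyond the base
          have hbo : bs v N tb ∈ openSegment ℝ p (v w) := by
            refine mem_oseg.2 ⟨(q / a)⁻¹, inv_pos.2 hqa, inv_lt_one_of_one_lt₀ h, ?_⟩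
            rw [hw', add_sub_cancel_left, smul_smul, inv_mul_cancel₀ hqa.ne', one_smul]
            abel
          have := P.trans hpw hbo (P.bs_omem h0 h1)
          rw [P.vN1, hw', add_sub_cancel_left, cr_smul_right] at this
          rcases mul_eq_zero.1 this with h' | h'
          · linarith
          · apply hht
            have h4 : ht v N p = - cr (v 0 - v N) (bs v N tb - p) := by
              simp only [ht, bs, cr, Prod.fst_add, Prod.snd_add, Prod.fst_sub, Prod.snd_sub,
                Prod.smul_fst, Prod.smul_snd, smul_eq_mul]; ring
            rw [h4, h', neg_zero]
      · obtain ⟨a, a0, a1, ha⟩ := mem_seg'.1 hz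
        have : (q + a * σ) • (bs v N tb - p) = 0 := by
          have h5 := hq.symm.trans ha
          rw [he] at h5
          have h6 : q • (bs v N tb - p) = a • (p + σ • (p - bs v N tb) - p) := add_left_cancel h5
          rw [add_smul, h6]; module
        rcases smul_eq_zero.1 this with h | h
        · have : 0 ≤ a * σ := by positivity
          linarith
        · exact hu0 h
    refine ⟨key, ?_⟩
    rw [segment_same]
    rintro rfl
    exact key (right_mem_segment _ _ _)

/-- Mirror image of `rot_max`. -/
lemma rot_min {p : Pt} {ta : ℝ} (h0 : 0 < ta) (h1 : ta < 1) (hs : Se v p (bs v N ta))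
    (hmax : ∀ t, 0 ≤ t → t ≤ 1 → Se v p (bs v N t) → t ≤ ta) (hht : ht v N p ≠ 0)
    (hp0 : ¬ Se v p (v 0)) {σ : ℝ}
    (hσ : 0 ≤ σ) {e : Pt} (he : e = p + σ • (p - bs v N ta)) {k : ℕ} (hk : k < N)
    (hek : e ∈ sg v k) (hpe : Se v p e) :
    ∃ l : ℕ, 0 < l ∧ l ≤ k ∧ v l ∈ openSegment ℝ p (bs v N ta) ∧
      ∀ w : ℕ, 0 < w → w ≤ N → Se v p (v w) → l ≤ w := by
  have eb : bs (rv N v) N (1 - ta) = bs v N ta := by rw [bs_rv]; congr 1; ring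
  obtain ⟨r, hr1, hr2, hr3, hr4⟩ := P.rev.rot_max (p := p) (tb := 1 - ta) (by linarith) (by linarith)
    (by rw [Se_rv, eb]; exact hs)
    (by
      intro t t0 t1 ht
      rw [Se_rv, bs_rv] at ht
      have := hmax (1 - t) (by linarith) (by linarith) ht
      linarith)
    (by
      have : ht (rv N v) N p = - ht v N p := by
        have e1 : rv N v 0 = v N := by simp [rv]
        have e2 : rv N v N = v 0 := by simp [rv]
        simp only [ht, e1, e2, cr, Prod.fst_sub, Prod.snd_sub]; ring
      rw [this]; exact neg_ne_zero.2 hht)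
    (by
      rw [Se_rv]
      have e2 : rv N v N = v 0 := by simp [rv]
      rw [e2]; exact hp0)
    hσ (by rw [eb]; exact he) (k := N - 1 - k) (by omega)
    (by
      rw [sg_rv]
      have : (N : ℤ) - ((N - 1 - k : ℕ) : ℤ) - 1 = k := by omega
      rw [this]; exact hek)
    (Se_rv.2 hpe)
  refine ⟨N - r, by omega, by omega, ?_, ?_⟩
  · rw [eb, rv_nat hr2.le] at hr3; exact hr3
  · intro w w0 wN hw
    have := hr4 (N - w) (by omega) (by
      rw [Se_rv, rv_nat (by omega), show N - (N - w) = w by omega]; exact hw)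
    omega

end PolyZ


open Topology Filter

lemma avoidK {p a b e x n : Pt} {σ : ℝ} (hσ : 0 ≤ σ) (he : e = p + σ • (p - b))
    (hind : cr (b - p) (a - p) ≠ 0) (hn : n ∈ segment ℝ p b) (hpx : p ∉ segment ℝ x n)
    (hna : ∀ z ∈ segment ℝ x n, z ∉ segment ℝ p a) :
    ∀ z ∈ segment ℝ x n ∪ segment ℝ n b, z ∉ segment ℝ e p ∧ z ∉ segment ℝ p a := by
  obtain ⟨q, q0, q1, hq⟩ := mem_seg'.1 hn
  have hb0 : b - p ≠ 0 := by
    intro h; rw [h] at hind; exact hind (by simp [cr])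
  have hq0 : 0 < q := by
    rcases q0.eq_or_lt with h | h
    · exfalso; apply hpx
      rw [← h, zero_smul, add_zero] at hq
      rw [← hq]; exact right_mem_segment _ _ _
    · exact h
  have hep : ∀ z ∈ segment ℝ e p, ∃ s : ℝ, 0 ≤ s ∧ z = p + (-s) • (b - p) := by
    intro z hz
    rw [segment_symm] at hz
    obtain ⟨u, u0, u1, rfl⟩ := mem_seg'.1 hz
    exact ⟨u * σ, by positivity, by rw [he]; module⟩
  rintro z (hz | hz)
  · refine ⟨fun hz' => ?_, hna z hz⟩
    obtain ⟨s, s0, hs⟩ := hep z hz'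
    apply hpx
    refine (convex_segment x n).segment_subset hz (right_mem_segment _ _ _) ?_
    have hsq : s + q ≠ 0 := by intro h; linarith
    refine mem_seg'.2 ⟨s / (s + q), by positivity, by rw [div_le_one (by linarith)]; linarith, ?_⟩
    have hnz : n - z = (s + q) • (b - p) := by rw [hq, hs]; module
    rw [hnz, smul_smul, div_mul_cancel₀ _ hsq, hs]; module
  · obtain ⟨u, u0, u1, hu⟩ := mem_seg'.1 hz
    have hz2 : z = p + (q + u * (1 - q)) • (b - p) := by rw [hu, hq]; module
    have hpos : 0 < q + u * (1 - q) := by nlinarith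
    generalize q + u * (1 - q) = w at *
    refine ⟨fun hz' => ?_, fun hz' => ?_⟩
    · obtain ⟨s, s0, hs⟩ := hep z hz'
      have h1 : (w + s) • (b - p) = 0 := by
        have h5 := add_left_cancel (hz2.symm.trans hs)
        rw [add_smul, h5]; module
      rcases smul_eq_zero.1 h1 with h | h
      · linarith
      · exact hb0 h
    · have h1 := seg_cr hz'
      rw [hz2, add_sub_cancel_left, cr_smul_right, cr_swap] at h1
      rcases mul_eq_zero.1 h1 with h | h
      · linarith
      · exact hind (by linarith)

/-- Two segments from `p` in independent directions meet only in `p`. -/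
lemma two_rays {p a b z : Pt} (hind : cr (b - p) (a - p) ≠ 0) (h1 : z ∈ segment ℝ p a)
    (h2 : z ∈ segment ℝ p b) : z = p := by
  obtain ⟨q, q0, q1, hq⟩ := mem_seg'.1 h2
  have h1 := seg_cr h1
  rw [hq, add_sub_cancel_left, cr_smul_right, cr_swap] at h1
  rcases mul_eq_zero.1 h1 with h | h
  · rw [hq, h]; module
  · exact absurd (by linarith) hind

namespace PolyZ
variable {N : ℕ} {v : ℤ → Pt} (P : PolyZ (N + 1) v)

lemma Se_ext {p a e' : Pt} {σ : ℝ} (hσ : 0 ≤ σ) (he : e' = p + σ • (p - a)) (h1 : Se v p a)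
    (h2 : Se v p e') : p ∈ segment ℝ e' a ∧ Se v e' a := by
  have hp : p ∈ segment ℝ e' a := by
    have : 1 + σ ≠ 0 := by intro h; linarith
    refine mem_seg'.2 ⟨σ / (1 + σ), by positivity, by rw [div_le_one (by linarith)]; linarith, ?_⟩
    have e1 : a - e' = (-(1 + σ)) • (p - a) := by rw [he]; module
    rw [e1, smul_smul, mul_neg, div_mul_cancel₀ _ this, he]; module
  refine ⟨hp, fun z hz => ?_⟩
  rcases seg_split hp hz with h | h
  · exact Se_symm h2 h
  · exact h1 h

include P

lemma core_B {p x : Pt} {ta tc : ℝ} {e' : Pt} {σ' : ℝ} (hσ' : 0 ≤ σ') (a0 : 0 ≤ ta) (a1 : ta ≤ 1)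
    (c0 : 0 ≤ tc) (c1 : tc ≤ 1) (he' : e' = p + σ' • (p - bs v N ta)) (hsa : Se v p (bs v N ta))
    (hpe' : Se v p e') (hxc : Se v x (bs v N tc)) {n' : Pt} (hn : n' ∈ segment ℝ x (bs v N tc))
    (hn' : n' ∈ segment ℝ e' p) : Se v p (bs v N tc) := by
  obtain ⟨hp, hea⟩ := Se_ext hσ' he' hsa hpe'
  have hne : n' ∈ segment ℝ e' (bs v N ta) := seg_sub hp hn'
  apply Se_symm
  refine tri_see (p := bs v N tc) (m := n') (m' := bs v N ta) ?_ (P.bs_reg c0 c1 a0 a1)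
    (Se_sub hea hne (right_mem_segment _ _ _)) ?_
  · exact Se_sub hxc (right_mem_segment _ _ _) hn
  · rcases seg_split hne hp with h | h
    · have : n' = p := by
        apply seg_end (a := p) (b := n') (c := e')
        · rw [segment_symm]; exact hn'
        · rw [segment_symm]; exact h
      rw [this]; exact left_mem_segment _ _ _
    · exact h

lemma core {p : Pt} {ta tb tc : ℝ} (hab : tb < ta) (b0 : 0 < tb) (a1 : ta < 1)
    (c0 : 0 ≤ tc) (c1 : tc ≤ 1) (hsb : Se v p (bs v N tb)) (hsa : Se v p (bs v N ta))
    (hmin : ∀ t, 0 ≤ t → t ≤ 1 → Se v p (bs v N t) → tb ≤ t)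
    (hmax : ∀ t, 0 ≤ t → t ≤ 1 → Se v p (bs v N t) → t ≤ ta) (hht : ht v N p ≠ 0)
    {σ : ℝ} (hσ : 0 ≤ σ) {e : Pt} (he : e = p + σ • (p - bs v N tb)) {k : ℕ} (hk : k < N)
    (hek : e ∈ sg v k) (hpe : Se v p e)
    {σ' : ℝ} (hσ' : 0 ≤ σ') {e' : Pt} (he' : e' = p + σ' • (p - bs v N ta)) {k' : ℕ} (hk' : k' < N)
    (hek' : e' ∈ sg v k') (hpe' : Se v p e')
    {x : ℕ} (hx1 : k' < x) (hx2 : x ≤ k) (hxc : Se v (v x) (bs v N tc)) : Se v p (v x) := by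
  by_contra hnot
  set a := bs v N ta with ha
  set b := bs v N tb with hb
  set c := bs v N tc with hc
  have hind : cr (b - p) (a - p) ≠ 0 := by
    rw [hb, ha, cr_bs]; exact mul_ne_zero (by linarith) hht
  have hind' : cr (a - p) (b - p) ≠ 0 := by
    rw [cr_swap]; exact neg_ne_zero.2 hind
  have hpxc : p ∉ segment ℝ (v x) c := fun h => hnot (Se_sub hxc h (left_mem_segment _ _ _))
  have haN : a ∈ sg v N := P.bs_mem (by linarith) a1.le
  have hbN : b ∈ sg v N := P.bs_mem b0.le (by linarith)
  -- arcs
  have xA2 : v x ∈ A2 v (N + 1) k N e a := by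
    rcases hx2.eq_or_lt with h | h
    · exact Or.inr (Or.inl (by rw [h]; exact left_mem_segment _ _ _))
    · exact Or.inr (Or.inr ⟨x, Or.inr h, left_mem_segment _ _ _⟩)
  have xA1 : v x ∈ A1 v k' N e' b := by
    rcases (Nat.succ_le_of_lt hx1).eq_or_lt with h | h
    · refine Or.inl ?_
      rw [← h]; push_cast; exact right_mem_segment _ _ _
    · exact Or.inr (Or.inr ⟨x, hx1, by omega, left_mem_segment _ _ _⟩)
  have bA1 : ∀ t, 0 ≤ t → t ≤ ta → bs v N t ∈ A1 v k N e a := by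
    intro t t0 t1
    refine Or.inr (Or.inl ?_)
    rw [← bs_0 (v := v) (N := N)]; exact bs_seg t0 t1
  have aA2 : ∀ t, tb ≤ t → t ≤ 1 → bs v N t ∈ A2 v (N + 1) k' N e' b := by
    intro t t0 t1
    refine Or.inl ?_
    rw [P.vN1, ← bs_1 (v := v) (N := N)]; exact bs_seg t0 t1
  -- crossing lemmas
  have QB : ∀ n ∈ segment ℝ (v x) c, n ∈ segment ℝ p b → ∃ n2 ∈ segment ℝ (v x) n, n2 ∈ segment ℝ p a := by
    intro n hn hnb
    by_contra! hcon
    have hpx : p ∉ segment ℝ (v x) n := fun h => hpxc (seg_sub hn h)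
    refine P.sep (k := k) (l := N) hk (by omega) hek haN (Se_symm hpe) hsa (path_conn (v x) n b) ?_
      (avoidK hσ he hind hnb hpx hcon) (Or.inr (right_mem_segment _ _ _))
      (Or.inl (left_mem_segment _ _ _)) (bA1 tb b0.le hab.le) xA2
    rintro z (hz | hz)
    · exact hxc (seg_sub hn hz)
    · exact hsb (seg_sub' hnb hz)
  have QA : ∀ n ∈ segment ℝ (v x) c, n ∈ segment ℝ p a → ∃ n2 ∈ segment ℝ (v x) n, n2 ∈ segment ℝ p b := by
    intro n hn hnb
    by_contra! hcon
    have hpx : p ∉ segment ℝ (v x) n := fun h => hpxc (seg_sub hn h)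
    refine P.sep (k := k') (l := N) hk' (by omega) hek' hbN (Se_symm hpe') hsb (path_conn (v x) n a) ?_
      (avoidK hσ' he' hind' hnb hpx hcon) (Or.inl (left_mem_segment _ _ _))
      (Or.inr (right_mem_segment _ _ _)) xA1 (aA2 ta hab.le a1.le)
    rintro z (hz | hz)
    · exact hxc (seg_sub hn hz)
    · exact hsa (seg_sub' hnb hz)
  have order : ∀ n n2 n3 : Pt, n2 ∈ segment ℝ (v x) n → n3 ∈ segment ℝ (v x) n2 →
      n2 ∈ segment ℝ n3 n := by
    intro n n2 n3 h2 h3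
    rcases seg_split (seg_sub h2 h3) h2 with h | h
    · have : n3 = n2 := by
        apply seg_end (a := n2) (b := n3) (c := v x)
        · rw [segment_symm]; exact h3
        · rw [segment_symm]; exact h
      rw [this]; exact left_mem_segment _ _ _
    · exact h
  have missB : ∀ n ∈ segment ℝ (v x) c, n ∉ segment ℝ p b := by
    intro n hn hnb
    obtain ⟨n2, h2, h2'⟩ := QB n hn hnb
    obtain ⟨n3, h3, h3'⟩ := QA n2 (seg_sub hn h2) h2'
    have h4 := (convex_segment p b).segment_subset h3' hnb (order n n2 n3 h2 h3)
    exact hpxc (two_rays hind h2' h4 ▸ seg_sub hn h2)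
  have missA : ∀ n ∈ segment ℝ (v x) c, n ∉ segment ℝ p a := by
    intro n hn hna
    obtain ⟨n2, h2, h2'⟩ := QA n hn hna
    exact missB n2 (seg_sub hn h2) h2'
  have B1 : tb ≤ tc → ∃ n' ∈ segment ℝ (v x) c, n' ∈ segment ℝ e' p := by
    intro htc
    by_contra! hcon
    exact P.sep (k := k') (l := N) hk' (by omega) hek' hbN (Se_symm hpe') hsb
      (convex_segment (v x) c).isPreconnected hxc (fun z hz => ⟨hcon z hz, missB z hz⟩)
      (left_mem_segment _ _ _) (right_mem_segment _ _ _) xA1 (aA2 tc htc c1)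
  have B2 : tc ≤ ta → ∃ n' ∈ segment ℝ (v x) c, n' ∈ segment ℝ e p := by
    intro htc
    by_contra! hcon
    exact P.sep (k := k) (l := N) hk (by omega) hek haN (Se_symm hpe) hsa
      (convex_segment (v x) c).isPreconnected hxc (fun z hz => ⟨hcon z hz, missA z hz⟩)
      (right_mem_segment _ _ _) (left_mem_segment _ _ _) (bA1 tc c0 htc) xA2
  have htb : tb ≤ tc := by
    by_contra! h
    obtain ⟨n', h1, h2⟩ := B2 (by linarith)
    have := hmin tc c0 c1 (P.core_B hσ b0.le (by linarith) c0 c1 he hsb hpe hxc h1 h2)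
    linarith
  obtain ⟨n', h1, h2⟩ := B1 htb
  have hta := hmax tc c0 c1 (P.core_B hσ' (by linarith) a1.le c0 c1 he' hsa hpe' hxc h1 h2)
  obtain ⟨n'', h3, h4⟩ := B2 hta
  have hcR := right_mem_segment ℝ (v x) c
  have htb' : tb < tc := lt_of_le_of_ne htb fun h =>
    missB c hcR (by rw [hc, hb, ← h]; exact right_mem_segment _ _ _)
  have hta' : tc < ta := lt_of_le_of_ne hta fun h =>
    missA c hcR (by rw [hc, ha, ← h]; exact right_mem_segment _ _ _)
  rw [segment_symm] at h1 h2 h3 h4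
  obtain ⟨u', u0', u1', hu'⟩ := mem_seg'.1 h1
  obtain ⟨u, u0, u1, hu⟩ := mem_seg'.1 h3
  obtain ⟨q', q0', q1', hq'⟩ := mem_seg'.1 h2
  obtain ⟨q, q0, q1, hq⟩ := mem_seg'.1 h4
  have E1 : u' * cr (c - p) (v x - c) = -(q' * σ') * ((ta - tc) * ht v N p) := by
    rw [← cr_bs, ← hc, ← ha, ← cr_smul_right, ← cr_smul_right]
    have : u' • (v x - c) = -(c - p) + (-(q' * σ')) • (a - p) := by
      have : u' • (v x - c) = n' - c := by rw [hu']; abel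
      rw [this, hq', he']; module
    rw [this, cr_add_smul]
    simp only [cr, Prod.fst_sub, Prod.snd_sub, Prod.fst_neg, Prod.snd_neg, Prod.smul_fst,
      Prod.smul_snd, smul_eq_mul]; ring
  have E2 : u * cr (c - p) (v x - c) = -(q * σ) * ((tb - tc) * ht v N p) := by
    rw [← cr_bs, ← hc, ← hb, ← cr_smul_right, ← cr_smul_right]
    have : u • (v x - c) = -(c - p) + (-(q * σ)) • (b - p) := by
      have : u • (v x - c) = n'' - c := by rw [hu]; abel
      rw [this, hq, he]; module
    rw [this, cr_add_smul]
    simp only [cr, Prod.fst_sub, Prod.snd_sub, Prod.fst_neg, Prod.snd_neg, Prod.smul_fst,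
      Prod.smul_snd, smul_eq_mul]; ring
  have p1 : 0 < q' * σ' := by
    refine lt_of_le_of_ne (by positivity) fun h => ?_
    apply hpxc
    rw [segment_symm]
    have : n' = p := by rw [hq', he', add_sub_cancel_left, smul_smul, ← h, zero_smul, add_zero]
    rw [← this]; exact h1
  have p2 : 0 < q * σ := by
    refine lt_of_le_of_ne (by positivity) fun h => ?_
    apply hpxc
    rw [segment_symm]
    have : n'' = p := by rw [hq, he, add_sub_cancel_left, smul_smul, ← h, zero_smul, add_zero]
    rw [← this]; exact h3
  have hH : 0 < ht v N p * ht v N p := mul_self_pos.2 hht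
  have F : u' * cr (c - p) (v x - c) * (u * cr (c - p) (v x - c)) =
      -((q' * σ') * (q * σ) * (ta - tc) * (tc - tb) * (ht v N p * ht v N p)) := by
    rw [E1, E2]; ring
  have pos : 0 < (q' * σ') * (q * σ) * (ta - tc) * (tc - tb) * (ht v N p * ht v N p) := by
    have := sub_pos.2 htb'
    have := sub_pos.2 hta'
    positivity
  have neg : 0 ≤ u' * u * (cr (c - p) (v x - c) * cr (c - p) (v x - c)) :=
    mul_nonneg (mul_nonneg u0' u0) (mul_self_nonneg _)
  nlinarith

end PolyZ


open Topology Filter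

/-- Right domination. -/
def DR (v : ℤ → Pt) (N g x : ℕ) : Prop :=
  x ≤ g ∧ ∃ t : ℝ, 0 ≤ t ∧ t ≤ 1 ∧ ∃ e : Pt, (e = v x ∨ ∃ j : ℕ, j < x ∧ e ∈ sg v j) ∧
    Se v (bs v N t) e ∧ v g ∈ segment ℝ (bs v N t) e

/-- Left domination. -/
def DL (v : ℤ → Pt) (N g x : ℕ) : Prop :=
  x ≤ N ∧ DR (rv N v) N (N - g) (N - x)

namespace PolyZ
variable {N : ℕ} {v : ℤ → Pt} (P : PolyZ (N + 1) v)
include P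

omit P in
lemma DR_self (hW : ∀ p ∈ reg (bd v), ∃ t, 0 ≤ t ∧ t ≤ 1 ∧ Se v p (bs v N t)) (g : ℕ) :
    DR v N g g := by
  obtain ⟨t, h0, h1, h⟩ := hW (v g) (bd_reg ⟨g, left_mem_segment _ _ _⟩)
  exact ⟨le_rfl, t, h0, h1, v g, Or.inl rfl, Se_symm h, right_mem_segment _ _ _⟩

omit P in
lemma DR_conv {g x y : ℕ} (h : DR v N g x) (hxy : x ≤ y) (hy : y ≤ g) : DR v N g y := by
  obtain ⟨h0, t, t0, t1, e, he, h1, h2⟩ := h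
  refine ⟨hy, t, t0, t1, e, ?_, h1, h2⟩
  rcases he with he | ⟨j, hj, he⟩
  · rcases hxy.eq_or_lt with h | h
    · subst h; exact Or.inl he
    · exact Or.inr ⟨x, h, he ▸ left_mem_segment _ _ _⟩
  · exact Or.inr ⟨j, by omega, he⟩

omit P in
lemma DL_conv {g x y : ℕ} (h : DL v N g x) (hxy : g ≤ y) (hy : y ≤ x) : DL v N g y :=
  ⟨hy.trans h.1, DR_conv h.2 (by omega) (by omega)⟩

omit P in
lemma DL_le {g x : ℕ} (h : DL v N g x) (hg : g ≤ N) : g ≤ x := by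
  have := h.2.1
  have := h.1
  omega

/-- Right contiguity. -/
lemma claimR {p : Pt} {x g1 g2 g3 : ℕ} (h : DR v N g2 x) (h3 : x ≤ g3) (h32 : g3 < g2)
    (h21 : g2 < g1) (h1 : g1 < N) (hp1 : Se v p (v g1)) (hp3 : Se v p (v g3)) : Se v p (v g2) := by
  obtain ⟨-, t, t0, t1, e, he, hs, hg⟩ := h
  have hK : IsPreconnected (segment ℝ (v g1) p ∪ segment ℝ p (v g3)) := path_conn _ _ _
  have hKR : segment ℝ (v g1) p ∪ segment ℝ p (v g3) ⊆ reg (bd v) :=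
    Set.union_subset (Se_symm hp1) hp3
  have hKs : ∀ z ∈ segment ℝ (v g1) p ∪ segment ℝ p (v g3), Se v p z := by
    rintro z (hz | hz)
    · rw [segment_symm] at hz; exact Se_sub hp1 (left_mem_segment _ _ _) hz
    · exact Se_sub hp3 (left_mem_segment _ _ _) hz
  have hm1 : v g1 ∈ segment ℝ (v g1) p ∪ segment ℝ p (v g3) := Or.inl (left_mem_segment _ _ _)
  have hm3 : v g3 ∈ segment ℝ (v g1) p ∪ segment ℝ p (v g3) := Or.inr (right_mem_segment _ _ _)
  have hbg : Se v (v g2) (bs v N t) := Se_sub hs hg (left_mem_segment _ _ _)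
  have heg : Se v e (v g2) := Se_sub hs (right_mem_segment _ _ _) hg
  have Y1 : ∃ y ∈ segment ℝ (v g2) (bs v N t), Se v p y := by
    by_contra! hno
    refine P.sep (k := g2) (l := N) (by omega) (by omega) (e := v g2) (f := bs v N t) (m := bs v N t)
      (left_mem_segment _ _ _) (P.bs_mem t0 t1) hbg
      (by rw [segment_same]; rintro z rfl; exact hbg (right_mem_segment _ _ _))
      hK hKR ?_ hm1 hm3
      (Or.inr (Or.inr ⟨g1, h21, h1, left_mem_segment _ _ _⟩))
      (Or.inr (Or.inr ⟨g3, Or.inr h32, left_mem_segment _ _ _⟩))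
    intro z hz
    refine ⟨fun h => hno z h (hKs z hz), fun h => ?_⟩
    rw [segment_same] at h
    cases h
    exact hno _ (right_mem_segment _ _ _) (hKs _ hz)
  have Y2 : ∃ y ∈ segment ℝ e (v g2), Se v p y := by
    have main : ∀ j : ℕ, j < g3 → e ∈ sg v j → ∃ y ∈ segment ℝ e (v g2), Se v p y := by
      intro j hj hej
      by_contra! hno
      refine P.sep (k := j) (l := g2) (by omega) (by omega) (e := e) (f := v g2) (m := v g2)
        hej (left_mem_segment _ _ _) heg
        (by rw [segment_same]; rintro z rfl; exact hbg (left_mem_segment _ _ _))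
        hK hKR ?_ hm3 hm1
        (Or.inr (Or.inr ⟨g3, hj, h32, left_mem_segment _ _ _⟩))
        (Or.inr (Or.inr ⟨g1, Or.inl ⟨h21, by omega⟩, left_mem_segment _ _ _⟩))
      intro z hz
      refine ⟨fun h => hno z h (hKs z hz), fun h => ?_⟩
      rw [segment_same] at h
      cases h
      exact hno _ (right_mem_segment _ _ _) (hKs _ hz)
    rcases he with he | ⟨j, hj, he⟩
    · rcases h3.eq_or_lt with h | h
      · subst h; exact ⟨v x, he ▸ left_mem_segment _ _ _, hp3⟩
      · exact main x h (he ▸ left_mem_segment _ _ _)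
    · exact main j (by omega) he
  obtain ⟨y1, hy1, hp1'⟩ := Y1
  obtain ⟨y2, hy2, hp2'⟩ := Y2
  have hgy : v g2 ∈ segment ℝ y1 y2 := by
    obtain ⟨a, a0, a1, ha⟩ := mem_seg'.1 hg
    obtain ⟨b, b0, b1, hb⟩ := mem_seg'.1 hy1
    obtain ⟨c, c0, c1, hc⟩ := mem_seg'.1 hy2
    -- parameters along the segment
    have e1 : y1 = bs v N t + (a - b * a) • (e - bs v N t) := by rw [hb, ha]; module
    have e2 : y2 = bs v N t + (1 - c * (1 - a)) • (e - bs v N t) := by rw [hc, ha]; module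
    have i1 : a - b * a ≤ a := by nlinarith
    have i2 : a ≤ 1 - c * (1 - a) := by nlinarith
    rcases (i1.trans i2).eq_or_lt with h | h
    · have : a - b * a = a := by linarith
      rw [this, ← ha] at e1
      rw [e1]; exact left_mem_segment _ _ _
    · refine mem_seg'.2 ⟨(a - (a - b * a)) / (1 - c * (1 - a) - (a - b * a)),
        div_nonneg (by linarith) (by linarith), (div_le_one (by linarith)).2 (by linarith), ?_⟩
      rw [e1, e2, add_sub_add_left_eq_sub, ← sub_smul, smul_smul, div_mul_cancel₀ _ (by linarith), ha]
      module
  refine tri_see (m := y1) (m' := y2) hp1' hp2' ?_ hgy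
  exact Se_sub hs (seg_sub hg (by rw [segment_symm]; exact hy1)) (seg_sub' hg (by rw [segment_symm]; exact hy2))

lemma claimL {p : Pt} {x g1 g2 g3 : ℕ} (h : DL v N g2 x) (h3 : g3 ≤ x) (h32 : g2 < g3)
    (h21 : g1 < g2) (h1 : 0 < g1) (hp1 : Se v p (v g1)) (hp3 : Se v p (v g3)) : Se v p (v g2) := by
  have hx := h.1
  have := P.rev.claimR (p := p) (g1 := N - g1) (g2 := N - g2) (g3 := N - g3) h.2
    (by omega) (by omega) (by omega) (by omega)
    (by rw [Se_rv, rv_nat (by omega), show N - (N - g1) = g1 by omega]; exact hp1)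
    (by rw [Se_rv, rv_nat (by omega), show N - (N - g3) = g3 by omega]; exact hp3)
  rwa [Se_rv, rv_nat (by omega), show N - (N - g2) = g2 by omega] at this

/-- Extension point beyond `p`. -/
lemma zone_ext {p : Pt} (hp : p ∈ reg (bd v)) {t : ℝ} (hht : ht v N p ≠ 0) :
    ∃ σ : ℝ, 0 ≤ σ ∧ ∃ k : ℕ, k < N ∧ p + σ • (p - bs v N t) ∈ sg v k ∧
      Se v p (p + σ • (p - bs v N t)) := by
  have hpb : p ≠ bs v N t := by
    intro h; apply hht; rw [h, ht_bs]
  obtain ⟨σ, h0, h1, h2⟩ := P.extend hpb hp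
  obtain ⟨k, hk, hek⟩ := P.bd_fin.1 h1
  refine ⟨σ, h0, k, ?_, hek, h2⟩
  by_contra! h
  have hkN : k = N := by omega
  subst hkN
  have := P.ht_sgN hek
  rw [show p + σ • (p - bs v k t) = p + (-σ) • (bs v k t - p) by module, ht_line, ht_bs] at this
  have h3 : (1 + σ) * ht v k p = 0 := by linarith
  rcases mul_eq_zero.1 h3 with h4 | h4
  · linarith
  · exact hht h4

/-- Zone properties. -/
lemma zone (hW : ∀ p ∈ reg (bd v), ∃ t, 0 ≤ t ∧ t ≤ 1 ∧ Se v p (bs v N t)) {p : Pt}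
    (hp : p ∈ reg (bd v)) (hp0 : ¬ Se v p (v 0)) (hpN : ¬ Se v p (v N)) :
    (∃ g : ℕ, 0 < g ∧ g < N ∧ Se v p (v g)) ∧
    ∀ w x w2 : ℕ, 0 < w → w < x → x < w2 → w2 < N → Se v p (v w) → Se v p (v w2) →
      ∃ g : ℕ, 0 < g ∧ g < N ∧ Se v p (v g) ∧ (DR v N g x ∨ DL v N g x) := by
  obtain ⟨t, t0, t1, ht⟩ := hW p hp
  have hht := P.ht_ne t0 t1 ht hp0 hpN
  obtain ⟨tb, ⟨b0, b1, hsb⟩, hmin⟩ := (P.I_compact p).exists_isLeast ⟨t, t0, t1, ht⟩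
  obtain ⟨ta, ⟨a0, a1, hsa⟩, hmax⟩ := (P.I_compact p).exists_isGreatest ⟨t, t0, t1, ht⟩
  have hmin' : ∀ t, 0 ≤ t → t ≤ 1 → Se v p (bs v N t) → tb ≤ t := fun t h0 h1 h => hmin ⟨h0, h1, h⟩
  have hmax' : ∀ t, 0 ≤ t → t ≤ 1 → Se v p (bs v N t) → t ≤ ta := fun t h0 h1 h => hmax ⟨h0, h1, h⟩
  have ne0 : ∀ t, Se v p (bs v N t) → t ≠ 0 := by
    rintro t h rfl; rw [bs_0] at h; exact hpN h
  have ne1 : ∀ t, Se v p (bs v N t) → t ≠ 1 := by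
    rintro t h rfl; rw [bs_1] at h; exact hp0 h
  have b0' : 0 < tb := lt_of_le_of_ne b0 (ne0 _ hsb).symm
  have b1' : tb < 1 := lt_of_le_of_ne b1 (ne1 _ hsb)
  have a0' : 0 < ta := lt_of_le_of_ne a0 (ne0 _ hsa).symm
  have a1' : ta < 1 := lt_of_le_of_ne a1 (ne1 _ hsa)
  have hba : tb ≤ ta := hmin' ta a0 a1 hsa
  obtain ⟨σ, hσ, k, hk, hek, hpe⟩ := P.zone_ext hp (t := tb) hht
  obtain ⟨r, hkr, hrN, hro, hrmax⟩ := P.rot_max b0' b1' hsb hmin' hht hpN hσ rfl hk hek hpe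
  have hrp : Se v p (v r) := Se_sub hsb (left_mem_segment _ _ _) (openSegment_subset_segment _ _ _ hro)
  refine ⟨⟨r, by omega, hrN, hrp⟩, fun w x w2 hw hwx hxw hw2 hsw hsw2 => ?_⟩
  have hr2 := hrmax w2 hw2 hsw2
  by_cases hkx : k < x
  · refine ⟨r, by omega, hrN, hrp, Or.inl ⟨by omega, tb, b0, b1, _, Or.inr ⟨k, hkx, hek⟩, ?_, ?_⟩⟩
    · exact Se_symm (Se_ext hσ rfl hsb hpe).2
    · rw [segment_symm]
      exact seg_sub' (Se_ext hσ rfl hsb hpe).1 (openSegment_subset_segment _ _ _ hro)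
  have left : ∀ (σ' : ℝ) (k' : ℕ), 0 ≤ σ' → k' < N → p + σ' • (p - bs v N ta) ∈ sg v k' →
      Se v p (p + σ' • (p - bs v N ta)) → x ≤ k' →
      ∃ g : ℕ, 0 < g ∧ g < N ∧ Se v p (v g) ∧ (DR v N g x ∨ DL v N g x) := by
    intro σ' k' hσ' hk' hek' hpe' hxk
    obtain ⟨l, hl0, hlk, hlo, hlmin⟩ := P.rot_min a0' a1' hsa hmax' hht hp0 hσ' rfl hk' hek' hpe'
    have hlw := hlmin w hw (by omega) hsw
    refine ⟨l, hl0, by omega, Se_sub hsa (left_mem_segment _ _ _) (openSegment_subset_segment _ _ _ hlo),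
      Or.inr ⟨by omega, by omega, 1 - ta, by linarith, by linarith, p + σ' • (p - bs v N ta),
        Or.inr ⟨N - k' - 1, by omega, ?_⟩, ?_, ?_⟩⟩
    · rw [sg_rv, show (N : ℤ) - ((N - k' - 1 : ℕ) : ℤ) - 1 = k' by omega]; exact hek'
    · rw [bs_rv, Se_rv, sub_sub_cancel]
      exact Se_symm (Se_ext hσ' rfl hsa hpe').2
    · rw [bs_rv, sub_sub_cancel, segment_symm, rv_nat (by omega), show N - (N - l) = l by omega]
      exact seg_sub' (Se_ext hσ' rfl hsa hpe').1 (openSegment_subset_segment _ _ _ hlo)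
  push Not at hkx
  rcases hba.eq_or_lt with hab | hab
  · subst hab
    exact left σ k hσ hk hek hpe hkx
  obtain ⟨σ', hσ', k', hk', hek', hpe'⟩ := P.zone_ext hp (t := ta) hht
  by_cases hxk : x ≤ k'
  · exact left σ' k' hσ' hk' hek' hpe' hxk
  push Not at hxk
  obtain ⟨tc, c0, c1, hxc⟩ := hW (v x) (bd_reg (P.v_bd x))
  exact ⟨x, by omega, by omega, P.core hab b0' a1' c0 c1 hsb hsa hmin' hmax' hht hσ rfl hk hek hpe
    hσ' rfl hk' hek' hpe' hxk hkx hxc, Or.inl (DR_self hW x)⟩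

end PolyZ


open Topology Filter

lemma v2_between {a b : ℕ} (ha : 0 < a) (hab : a < b) (h : padicValNat 2 a = padicValNat 2 b) :
    ∃ c, a < c ∧ c < b ∧ padicValNat 2 a < padicValNat 2 c := by
  have : Fact (Nat.Prime 2) := ⟨Nat.prime_two⟩
  set k := padicValNat 2 a with hk
  have dv : ∀ m j : ℕ, 0 < m → (2 ^ j ∣ m ↔ j ≤ padicValNat 2 m) := fun m j hm =>
    padicValNat_dvd_iff_le (by omega)
  obtain ⟨u, hu⟩ := (dv a k ha).2 hk.le
  obtain ⟨w, hw⟩ := (dv b k (by omega)).2 h.le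
  have odd : ∀ m x : ℕ, 0 < m → padicValNat 2 m = k → m = 2 ^ k * x → x % 2 = 1 := by
    intro m x hm h1 h2
    by_contra h3
    have : 2 ^ (k + 1) ∣ m := by
      rw [h2, pow_succ]; exact mul_dvd_mul_left _ (by omega)
    have := (dv m (k + 1) hm).1 this
    omega
  have ou := odd a u ha rfl hu
  have ow := odd b w (by omega) h.symm hw
  have p2 : 0 < 2 ^ k := by positivity
  have huw : u < w := by
    rw [hu, hw] at hab; exact lt_of_mul_lt_mul_left hab p2.le
  refine ⟨2 ^ k * (u + 1), ?_, ?_, ?_⟩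
  · rw [hu]; exact Nat.mul_lt_mul_of_pos_left (by omega) p2
  · rw [hw]; exact Nat.mul_lt_mul_of_pos_left (by omega) p2
  · refine (dv _ (k + 1) (by positivity)).1 ?_
    rw [pow_succ]; exact mul_dvd_mul_left _ (by omega)

/-- The ruler colouring of a set of ranks. -/
lemma comb {ι : Type*} (N : ℕ) (hN : 2 ≤ N) (R L : ℕ → ℕ → Prop) (V : ι → ℕ → Prop)
    (hR : ∀ g x, R g x → x ≤ g) (hL : ∀ g x, g ≤ N → L g x → g ≤ x) (hself : ∀ g, R g g)
    (Rconv : ∀ g x y, R g x → x ≤ y → y ≤ g → R g y)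
    (Lconv : ∀ g x y, L g x → g ≤ y → y ≤ x → L g y)
    (CR : ∀ p x g1 g2 g3, R g2 x → x ≤ g3 → g3 < g2 → g2 < g1 → g1 < N → V p g1 → V p g3 → V p g2)
    (CL : ∀ p x g1 g2 g3, L g2 x → g3 ≤ x → g2 < g3 → g1 < g2 → 0 < g1 → V p g1 → V p g3 → V p g2)
    (hz : ∀ p, ¬ V p 0 → ¬ V p N → (∃ g, 0 < g ∧ g < N ∧ V p g) ∧
      ∀ w x w2, 0 < w → w < x → x < w2 → w2 < N → V p w → V p w2 →
        ∃ g, 0 < g ∧ g < N ∧ V p g ∧ (R g x ∨ L g x)) :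
    ∃ χ : ℕ → ℕ × Bool × ℕ,
      (∀ g, (χ g).1 ≤ Nat.log 2 (N + 1) ∧ (χ g).2.2 ≤ Nat.log 2 (N + 1)) ∧
      ∀ p, ∃ g, g ≤ N ∧ V p g ∧ ∀ h, h ≤ N → h ≠ g → V p h → χ h ≠ χ g := by
  classical
  have hc : ∀ g, 0 < g → g < N → ∃ x, 0 < x ∧ x < N ∧ (R g x ∨ L g x) ∧
      ∀ y, 0 < y → y < N → (R g y ∨ L g y) → padicValNat 2 y ≤ padicValNat 2 x := by
    intro g h0 h1
    obtain ⟨x, hx, hm⟩ := ((Finset.Ioo 0 N).filter fun x => R g x ∨ L g x).exists_max_image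
      (padicValNat 2) ⟨g, by simp [h0, h1, hself g]⟩
    simp only [Finset.mem_filter, Finset.mem_Ioo, and_imp] at hx hm
    exact ⟨x, hx.1.1, hx.1.2, hx.2, fun y a b c => hm y a b c⟩
  choose! ct ct0 ct1 ctD ctM using hc
  have conv : ∀ g x y, 0 < g → g < N → (R g x ∨ L g x) → (x ≤ y ∧ y ≤ g ∨ g ≤ y ∧ y ≤ x) →
      R g y ∨ L g y := by
    intro g x y h0 h1 hD hy
    rcases hD with h | h
    · have := hR _ _ h
      rcases hy with ⟨a, b⟩ | ⟨a, b⟩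
      · exact Or.inl (Rconv _ _ _ h a b)
      · obtain rfl : y = g := by omega
        exact Or.inl (hself y)
    · have := hL _ _ h1.le h
      rcases hy with ⟨a, b⟩ | ⟨a, b⟩
      · obtain rfl : y = g := by omega
        exact Or.inl (hself y)
      · exact Or.inr (Lconv _ _ _ h a b)
  set sd : ℕ → Bool := fun g => decide (R g (ct g)) with hsd
  set M : ℕ → Finset ℕ := fun g => (Finset.Ioo 0 N).filter fun h => ct h = ct g ∧ sd h = sd g with hM
  have memM : ∀ g h, h ∈ M g ↔ (0 < h ∧ h < N) ∧ ct h = ct g ∧ sd h = sd g := by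
    intro g h; simp [hM]
  set rk : ℕ → ℕ := fun g => ((M g).filter fun h => h ≤ g).card with hrk
  have rk_pos : ∀ g, 0 < g → g < N → 0 < rk g := by
    intro g h0 h1
    exact Finset.card_pos.2 ⟨g, by simp [memM, h0, h1]⟩
  have rk_lt : ∀ g, rk g < N := by
    intro g
    have : rk g ≤ (Finset.Ioo 0 N).card :=
      Finset.card_le_card ((Finset.filter_subset _ _).trans (Finset.filter_subset _ _))
    simp at this
    omega
  have log_le : ∀ m, m < N → padicValNat 2 m ≤ Nat.log 2 (N + 1) := by
    intro m hm
    exact (padicValNat_le_nat_log m).trans (Nat.log_mono_right (by omega))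
  have one_le : 1 ≤ Nat.log 2 (N + 1) := by
    exact Nat.le_log_of_pow_le (by norm_num) (by omega)
  -- level zero vertices have ruler zero
  have lvl0 : ∀ g, 0 < g → g < N → padicValNat 2 (ct g) = 0 → padicValNat 2 (rk g) = 0 := by
    have one : ∀ g, 0 < g → g < N → padicValNat 2 (ct g) = 0 → ct g = g := by
      intro g h0 h1 h
      by_contra hne
      have h2 := ctM g h0 h1 g h0 h1 (Or.inl (hself g))
      have h3 : padicValNat 2 (ct g) = padicValNat 2 g := by omega
      rcases Nat.lt_or_gt_of_ne hne with hlt | hlt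
      · obtain ⟨c, c1, c2, c3⟩ := v2_between (ct0 g h0 h1) hlt h3
        have := ctM g h0 h1 c (by omega) (by omega) (conv g _ c h0 h1 (ctD g h0 h1) (by omega))
        omega
      · obtain ⟨c, c1, c2, c3⟩ := v2_between h0 hlt h3.symm
        have := ct1 g h0 h1
        have := ctM g h0 h1 c (by omega) (by omega) (conv g _ c h0 h1 (ctD g h0 h1) (by omega))
        omega
    intro g h0 h1 h
    have : rk g = 1 := by
      refine Finset.card_eq_one.2 ⟨g, ?_⟩
      ext h'
      simp only [Finset.mem_filter, memM, Finset.mem_singleton]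
      constructor
      · rintro ⟨⟨⟨a, b⟩, c, -⟩, -⟩
        rw [one g h0 h1 h] at c
        have : padicValNat 2 (ct h') = 0 := by rw [c, ← one g h0 h1 h]; exact h
        rw [← one h' a b this, c]
      · rintro rfl
        exact ⟨⟨⟨h0, h1⟩, rfl, rfl⟩, le_rfl⟩
    rw [this]; simp
  set χ : ℕ → ℕ × Bool × ℕ := fun g =>
    if g = 0 then (0, true, 1) else if g < N then (padicValNat 2 (ct g), sd g, padicValNat 2 (rk g))
      else (0, false, 1) with hχ
  have χ0 : χ 0 = (0, true, 1) := by simp [hχ]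
  have χN : χ N = (0, false, 1) := by simp [hχ]; omega
  have χm : ∀ g, 0 < g → g < N → χ g = (padicValNat 2 (ct g), sd g, padicValNat 2 (rk g)) := by
    intro g h0 h1; simp [hχ, h1]; omega
  have χm1 : ∀ g b, 0 < g → g < N → χ g ≠ (0, b, 1) := by
    intro g b h0 h1 h
    rw [χm g h0 h1] at h
    simp only [Prod.mk.injEq] at h
    have := lvl0 g h0 h1 h.1
    omega
  refine ⟨χ, ?_, fun p => ?_⟩
  · intro g
    by_cases h0 : g = 0
    · subst h0; rw [χ0]; exact ⟨by simp, one_le⟩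
    by_cases h1 : g < N
    · rw [χm g (by omega) h1]
      exact ⟨log_le _ (ct1 g (by omega) h1), log_le _ (rk_lt g)⟩
    · simp only [hχ, h0, h1, if_false]; exact ⟨by simp, one_le⟩
  by_cases hp0 : V p 0
  · refine ⟨0, by omega, hp0, fun h hh hne _ heq => ?_⟩
    rw [χ0] at heq
    rcases hh.eq_or_lt with rfl | hh
    · rw [χN] at heq; simp at heq
    · exact χm1 h _ (by omega) hh heq
  by_cases hpN : V p N
  · refine ⟨N, le_rfl, hpN, fun h hh hne _ heq => ?_⟩
    rw [χN] at heq
    by_cases h0 : h = 0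
    · subst h0; rw [χ0] at heq; simp at heq
    · exact χm1 h _ (by omega) (by omega) heq
  obtain ⟨⟨ga, ga0, ga1, gaV⟩, hz2⟩ := hz p hp0 hpN
  -- maximal level
  obtain ⟨g0, hg0, hg0m⟩ := ((Finset.Ioo 0 N).filter fun g => V p g).exists_max_image
    (fun g => padicValNat 2 (ct g)) ⟨ga, by simp [ga0, ga1, gaV]⟩
  simp only [Finset.mem_filter, Finset.mem_Ioo, and_imp] at hg0 hg0m
  obtain ⟨⟨g00, g01⟩, g0V⟩ := hg0
  -- common centre
  have aux : ∀ g g', 0 < g → g < N → 0 < g' → g' < N → V p g → V p g' →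
      padicValNat 2 (ct g) = padicValNat 2 (ct g0) → padicValNat 2 (ct g') = padicValNat 2 (ct g0) →
      ¬ ct g < ct g' := by
    intro g g' a0 a1 b0 b1 hV hV' e1 e2 hlt
    obtain ⟨c, c1, c2, c3⟩ := v2_between (ct0 g a0 a1) hlt (e1.trans e2.symm)
    have cN : c < N := c2.trans (ct1 g' b0 b1)
    by_cases h1 : c ≤ g
    · have := ctM g a0 a1 c (by omega) cN (conv g _ c a0 a1 (ctD g a0 a1) (by omega))
      omega
    by_cases h2 : g' ≤ c
    · have := ctM g' b0 b1 c (by omega) cN (conv g' _ c b0 b1 (ctD g' b0 b1) (by omega))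
      omega
    obtain ⟨h, k0, k1, kV, kD⟩ := hz2 g c g' a0 (by omega) (by omega) b1 hV hV'
    have := ctM h k0 k1 c (by omega) cN kD
    have := hg0m h k0 k1 kV
    omega
  have cent : ∀ g, 0 < g → g < N → V p g → padicValNat 2 (ct g) = padicValNat 2 (ct g0) →
      ct g = ct g0 := by
    intro g a0 a1 hV e
    have := aux g g0 a0 a1 g00 g01 hV g0V e rfl
    have := aux g0 g g00 g01 a0 a1 g0V hV rfl e
    omega
  -- maximal ruler
  obtain ⟨g, hg, hgm⟩ := ((M g0).filter fun g => V p g).exists_max_image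
    (fun g => padicValNat 2 (rk g)) ⟨g0, by simp [memM, g00, g01, g0V]⟩
  simp only [Finset.mem_filter, and_imp] at hg hgm
  obtain ⟨hgM, hgV⟩ := hg
  obtain ⟨⟨gp, gN⟩, gc, gs⟩ := (memM _ _).1 hgM
  have Meq : ∀ h, h ∈ M g0 → M h = M g0 := by
    intro h hh
    obtain ⟨-, a, b⟩ := (memM _ _).1 hh
    simp only [hM, a, b]
  -- contiguity
  have contig : ∀ a b c, a ∈ M g0 → b ∈ M g0 → c ∈ M g0 → a < b → b < c → V p a → V p c → V p b := by
    intro a b c ha hb hc hab hbc hVa hVc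
    obtain ⟨⟨a0, aN⟩, ac, as⟩ := (memM _ _).1 ha
    obtain ⟨⟨b0, bN⟩, bc, bs⟩ := (memM _ _).1 hb
    obtain ⟨⟨c0, cN⟩, cc, cs⟩ := (memM _ _).1 hc
    by_cases hs : sd g0 = true
    · have key : ∀ y, ct y = ct g0 → sd y = sd g0 → R y (ct g0) := by
        intro y e1 e2; rw [hs] at e2; simpa [hsd, e1] using e2
      exact CR p (ct g0) c b a (key b bc bs) (hR _ _ (key a ac as)) hab hbc cN hVc hVa
    · have key : ∀ y, 0 < y → y < N → ct y = ct g0 → sd y = sd g0 → L y (ct g0) := by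
        intro y y0 y1 e1 e2
        have h1 := ctD y y0 y1
        rw [e1] at h1
        refine h1.resolve_left fun h2 => hs ?_
        rw [← e2]; simpa [hsd, e1] using h2
      exact CL p (ct g0) a b c (key b b0 bN bc bs) (hL _ _ cN.le (key c c0 cN cc cs)) hbc hab a0 hVa hVc
  -- intermediate ranks
  have rk_lt' : ∀ a b, a ∈ M g0 → b ∈ M g0 → a < b → rk a < rk b := by
    intro a b ha hb hab
    simp only [hrk, Meq a ha, Meq b hb]
    refine Finset.card_lt_card ⟨fun z hz => ?_, fun h => ?_⟩
    · simp only [Finset.mem_filter] at hz ⊢; exact ⟨hz.1, by omega⟩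
    · have := h (Finset.mem_filter.2 ⟨hb, le_refl b⟩)
      simp only [Finset.mem_filter] at this
      omega
  have rk_surj : ∀ a b r, a ∈ M g0 → b ∈ M g0 → rk a < r → r < rk b →
      ∃ c ∈ M g0, rk c = r := by
    intro a b r ha hb h1 h2
    have hinj : Set.InjOn rk (M g0 : Set ℕ) := by
      intro x hx y hy hxy
      rcases lt_trichotomy x y with h | h | h
      · have := rk_lt' x y hx hy h; omega
      · exact h
      · have := rk_lt' y x hy hx h; omega
    have hcard : ((M g0).image rk).card = (M g0).card := Finset.card_image_of_injOn hinj
    have hsub : (M g0).image rk ⊆ Finset.Icc 1 (M g0).card := by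
      intro z hz
      obtain ⟨y, hy, rfl⟩ := Finset.mem_image.1 hz
      obtain ⟨⟨y0, y1⟩, -⟩ := (memM _ _).1 hy
      refine Finset.mem_Icc.2 ⟨rk_pos y y0 y1, ?_⟩
      simp only [hrk, Meq y hy]
      exact Finset.card_filter_le _ _
    have heq := Finset.eq_of_subset_of_card_le hsub (by simp [hcard])
    have hbI := hsub (Finset.mem_image_of_mem rk hb)
    have : r ∈ (M g0).image rk := by
      rw [heq]; simp only [Finset.mem_Icc] at hbI ⊢; omega
    obtain ⟨c, hc, rfl⟩ := Finset.mem_image.1 this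
    exact ⟨c, hc, rfl⟩
  have fin : ∀ a b, a ∈ M g0 → b ∈ M g0 → V p a → V p b → a < b →
      padicValNat 2 (rk a) = padicValNat 2 (rk g) → padicValNat 2 (rk b) = padicValNat 2 (rk g) →
      False := by
    intro a b ha hb hVa hVb hab e1 e2
    obtain ⟨⟨a0, aN⟩, -⟩ := (memM _ _).1 ha
    obtain ⟨r, r1, r2, r3⟩ := v2_between (rk_pos a a0 aN) (rk_lt' a b ha hb hab) (e1.trans e2.symm)
    obtain ⟨c, hc, rfl⟩ := rk_surj a b r ha hb r1 r2
    have hac : a < c := by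
      by_contra! h
      rcases h.eq_or_lt with rfl | h
      · omega
      · have := rk_lt' c a hc ha h; omega
    have hcb : c < b := by
      by_contra! h
      rcases h.eq_or_lt with rfl | h
      · omega
      · have := rk_lt' b c hb hc h; omega
    have := hgm c hc (contig a c b ha hc hb hac hcb hVa hVb)
    omega
  refine ⟨g, gN.le, hgV, fun h hh hne hV heq => ?_⟩
  have h0 : 0 < h := by
    rcases Nat.eq_zero_or_pos h with rfl | h0
    · exact absurd hV hp0
    · exact h0
  have h1 : h < N := by
    rcases hh.eq_or_lt with rfl | h1
    · exact absurd hV hpN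
    · exact h1
  rw [χm h h0 h1, χm g gp gN] at heq
  simp only [Prod.mk.injEq] at heq
  obtain ⟨q1, q2, q3⟩ := heq
  rw [gc] at q1
  have hhM : h ∈ M g0 := (memM _ _).2 ⟨⟨h0, h1⟩, cent h h0 h1 hV q1, q2.trans gs⟩
  rcases Nat.lt_or_gt_of_ne hne with h2 | h2
  · exact fin h g hhM hgM hV hgV h2 q3 rfl
  · exact fin g h hgM hhM hgV hV h2 rfl q3


open Topology Filter

namespace Trans
variable (P : SimplePolygon) (i0 : Fin P.n)

/-- Integer indices of the vertices, starting after the base edge. -/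
def idx (k : ℤ) : Fin P.n := ⟨(((i0 : ℕ) + 1 + k) % (P.n : ℤ)).toNat, by
  have h3 := P.three_le
  have := Int.emod_lt_of_pos ((i0 : ℕ) + 1 + k) (show (0 : ℤ) < P.n by omega)
  omega⟩

lemma idx_val (k : ℤ) : ((idx P i0 k : ℕ) : ℤ) = ((i0 : ℕ) + 1 + k) % (P.n : ℤ) := by
  have h3 := P.three_le
  have := Int.emod_nonneg ((i0 : ℕ) + 1 + k) (show (P.n : ℤ) ≠ 0 by omega)
  simp only [idx]
  omega

lemma idx_eq {k l : ℤ} : idx P i0 k = idx P i0 l ↔ (P.n : ℤ) ∣ k - l := by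
  rw [Fin.ext_iff, ← Int.natCast_inj, idx_val, idx_val, Int.emod_eq_emod_iff_emod_sub_eq_zero,
    add_sub_add_left_eq_sub, ← Int.dvd_iff_emod_eq_zero]

lemma idx_succ (k : ℤ) : idx P i0 (k + 1) = idx P i0 k + 1 := by
  have h3 := P.three_le
  rw [Fin.ext_iff, ← Int.natCast_inj, idx_val, Fin.val_add, Fin.val_one']
  push_cast
  rw [idx_val, Int.add_emod_emod, Int.emod_add_emod, add_assoc, add_assoc, add_assoc]

lemma idx_surj (i : Fin P.n) : ∃ k : ℕ, k < P.n ∧ idx P i0 k = i := by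
  have h3 := P.three_le
  have h1 := i.2
  have h2 := i0.2
  have key : ∀ k : ℕ, ((i0 : ℕ) + 1 + (k : ℤ) = i ∨ (i0 : ℕ) + 1 + (k : ℤ) = i + P.n) → idx P i0 k = i := by
    intro k hk
    rw [Fin.ext_iff, ← Int.natCast_inj, idx_val]
    rcases hk with hk | hk <;> rw [hk]
    · exact Int.emod_eq_of_lt (by omega) (by omega)
    · rw [Int.add_emod_right]; exact Int.emod_eq_of_lt (by omega) (by omega)
  by_cases h : (i0 : ℕ) + 1 ≤ i
  · exact ⟨i - (i0 + 1), by omega, key _ (Or.inl (by omega))⟩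
  · exact ⟨i + P.n - (i0 + 1), by omega, key _ (Or.inr (by omega))⟩

/-- The integer-indexed vertices. -/
def vv (k : ℤ) : Pt := P.vtx (idx P i0 k)

lemma sg_vv (k : ℤ) : sg (vv P i0) k = segment ℝ (P.vtx (idx P i0 k)) (P.vtx (idx P i0 k + 1)) := by
  unfold sg vv; rw [idx_succ]

lemma bd_vv : bd (vv P i0) = P.boundary := by
  ext z
  simp only [bd, SimplePolygon.boundary, Set.mem_ofPred_eq, Set.mem_iUnion]
  constructor
  · rintro ⟨k, hk⟩; rw [sg_vv] at hk; exact ⟨_, hk⟩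
  · rintro ⟨i, hi⟩
    obtain ⟨k, -, rfl⟩ := idx_surj P i0 i
    exact ⟨k, by rw [sg_vv]; exact hi⟩

lemma reg_vv : reg (bd (vv P i0)) = P.region := by
  rw [bd_vv]
  ext z
  simp only [reg, extr, SimplePolygon.region, Set.mem_compl_iff, Set.mem_ofPred_eq, Set.mem_union]
  tauto

lemma Se_vv {p q : Pt} : Se (vv P i0) p q ↔ P.Sees p q := by
  unfold Se SimplePolygon.Sees; rw [reg_vv]

lemma poly_vv : PolyZ P.n (vv P i0) where
  n3 := P.three_le
  per k := by
    unfold vv; congr 1; rw [idx_eq]; simp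
  inj i j h := (idx_eq P i0).1 (P.inj h)
  cons k z h1 h2 := by
    rw [sg_vv] at h1 h2
    rw [idx_succ] at h2
    have := P.consec_edges (idx P i0 k)
    have hz : z ∈ ({P.vtx (idx P i0 k + 1)} : Set Pt) := by rw [← this]; exact ⟨h1, h2⟩
    unfold vv; rw [idx_succ]; exact hz
  disj i j z h1 h2 h3 hi hj := by
    rw [sg_vv] at hi hj
    have := P.nonconsec_edges (idx P i0 i) (idx P i0 j) (fun h => h1 ((idx_eq P i0).1 h))
      (fun h => h2 ((idx_eq P i0).1 (by rw [idx_succ]; exact h.symm)))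
      (fun h => h3 ((idx_eq P i0).1 (by rw [idx_succ]; exact h)))
    have hz : z ∈ (∅ : Set Pt) := by rw [← this]; exact ⟨hi, hj⟩
    exact hz

end Trans

/-- Every simple polygon with `n` vertices that is weakly
visible from one of its edges admits a vertex-to-point conflict-free chromatic
guarding using at most `2·(⌊log₂ n⌋ + 1)²` colours. -/
theorem weak_visibility_cf_colour_upper_bound (P : SimplePolygon)
    (hwv : ∃ i : Fin P.n, ∀ p ∈ P.region,
      ∃ q ∈ segment ℝ (P.vtx i) (P.vtx (i + 1)), P.Sees q p) :
    ∃ (k : ℕ) (G : Finset (ℝ × ℝ)) (χ : ℝ × ℝ → Fin k),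
      P.IsCFGuardV2P G k χ ∧ k ≤ 2 * (Nat.log 2 P.n + 1) ^ 2 := by
  classical
  obtain ⟨i0, hi0⟩ := hwv
  obtain ⟨N, hN⟩ : ∃ N, P.n = N + 1 := ⟨P.n - 1, by have := P.three_le; omega⟩
  set v := Trans.vv P i0 with hv
  have Q : PolyZ (N + 1) v := by rw [← hN]; exact Trans.poly_vv P i0
  have hreg : reg (bd v) = P.region := Trans.reg_vv P i0
  have hSe : ∀ p q, Se v p q ↔ P.Sees p q := fun p q => Trans.Se_vv P i0
  have hiN : Trans.idx P i0 N = i0 := by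
    have h2 := i0.2
    rw [Fin.ext_iff, ← Int.natCast_inj, Trans.idx_val,
      show ((i0 : ℕ) : ℤ) + 1 + N = i0 + P.n by omega, Int.add_emod_right]
    exact Int.emod_eq_of_lt (by omega) (by omega)
  have hW : ∀ p ∈ reg (bd v), ∃ t, 0 ≤ t ∧ t ≤ 1 ∧ Se v p (bs v N t) := by
    intro p hp
    rw [hreg] at hp
    obtain ⟨q, hq, hs⟩ := hi0 p hp
    have hq' : q ∈ segment ℝ (v N) (v 0) := by
      rw [← Q.sgN, hv, Trans.sg_vv, hiN]; exact hq
    obtain ⟨t, t0, t1, rfl⟩ := PolyZ.bs_v hq'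
    exact ⟨t, t0, t1, Se_symm ((hSe _ _).2 hs)⟩
  have hWr : ∀ p ∈ reg (bd (rv N v)), ∃ t, 0 ≤ t ∧ t ≤ 1 ∧ Se (rv N v) p (bs (rv N v) N t) := by
    intro p hp
    rw [bd_rv] at hp
    obtain ⟨t, t0, t1, h⟩ := hW p hp
    exact ⟨1 - t, by linarith, by linarith, by rw [bs_rv, Se_rv, sub_sub_cancel]; exact h⟩
  obtain ⟨c, cb, hc⟩ := comb (ι := {p // p ∈ reg (bd v)}) N Q.N2 (DR v N) (DL v N)
    (fun p g => Se v p (v g)) (fun g x h => h.1) (fun g x hg h => PolyZ.DL_le h hg)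
    (PolyZ.DR_self hW) (fun g x y h => PolyZ.DR_conv h) (fun g x y h => PolyZ.DL_conv h)
    (fun p x g1 g2 g3 h a b c d e f => Q.claimR h a b c d e f)
    (fun p x g1 g2 g3 h a b c d e f => Q.claimL h a b c d e f)
    (fun p h0 h1 => Q.zone hW p.2 (by simpa using h0) h1)
  set L := Nat.log 2 (N + 1) with hL
  set T := Fin (L + 1) × Bool × Fin (L + 1)
  have hcard : Fintype.card T = 2 * (L + 1) ^ 2 := by
    simp only [T, Fintype.card_prod, Fintype.card_fin, Fintype.card_bool]; ring
  let f : ℕ → T := fun g => (⟨(c g).1, by have := (cb g).1; omega⟩, (c g).2.1,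
    ⟨(c g).2.2, by have := (cb g).2; omega⟩)
  have hf : ∀ g h, f g = f h → c g = c h := by
    intro g h e
    have e1 : (c g).1 = (c h).1 := congrArg (fun x : T => (x.1 : ℕ)) e
    have e2 : (c g).2.1 = (c h).2.1 := congrArg (fun x : T => x.2.1) e
    have e3 : (c g).2.2 = (c h).2.2 := congrArg (fun x : T => (x.2.2 : ℕ)) e
    exact Prod.ext e1 (Prod.ext e2 e3)
  let col : ℝ × ℝ → Fin (Fintype.card T) := fun z =>
    Fintype.equivFin T (if h : ∃ g : ℕ, g ≤ N ∧ v g = z then f h.choose else f 0)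
  have hcol : ∀ g : ℕ, g ≤ N → col (v g) = Fintype.equivFin T (f g) := by
    intro g hg
    have h : ∃ g' : ℕ, g' ≤ N ∧ v g' = v g := ⟨g, hg, rfl⟩
    have e : h.choose = g := Q.vinj (by have := h.choose_spec.1; omega) (by omega) h.choose_spec.2
    simp only [col]
    rw [dif_pos h, e]
  refine ⟨Fintype.card T, Finset.univ.image P.vtx, col, ⟨by simp, fun p hp => ?_⟩, by
    rw [hcard, hL, hN]⟩
  rw [← hreg] at hp
  obtain ⟨g, hg, hs, huniq⟩ := hc ⟨p, hp⟩
  refine ⟨v g, Finset.mem_image.2 ⟨_, Finset.mem_univ _, rfl⟩, (hSe _ _).1 (Se_symm hs), ?_⟩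
  intro z hz hne hzs hcz
  obtain ⟨i, -, rfl⟩ := Finset.mem_image.1 hz
  obtain ⟨k, hk, rfl⟩ := Trans.idx_surj P i0 i
  have hk' : k ≤ N := by omega
  have hkc : col (v k) = col (v g) := hcz
  rw [hcol k hk', hcol g hg] at hkc
  refine huniq k hk' (fun h => hne (by rw [h]; rfl)) (Se_symm ((hSe _ _).2 hzs)) ?_
  exact hf _ _ ((Fintype.equivFin T).injective hkc)
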